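/- Let n ≥ 2, s ∈ ℝ, n/(n+1) < p ≤ ∞, 0 < q ≤ ∞ and set ν = (n−1)|1/p − 1/2|. For Schwartz functions f_0, f_1 on ℝ^n with Fourier transforms f̂_0, f̂_1 define, for t ∈ ℝ, u(t,x) = (2π)^{−n} ∫ e^{i(x·ξ + t|ξ|)} ( f̂_0(ξ)/2 + f̂_1(ξ)/(2i|ξ|) ) dξ + (2π)^{−n} ∫ e^{i(x·ξ − t|ξ|)} ( f̂_0(ξ)/2 − f̂_1(ξ)/(2i|ξ|) ) dξ (this is the solution of ∂_t^2 u = Δ_x u with u(0,·) = f_0 and ∂_t u(0,·) = f_1). Then for every τ > 0 there exists a constant C_τ such that sup_{t ∈ [−τ,τ]} ‖u(t,·)‖_{B^s_{p,q}} ≤ C_τ ( ‖f_0‖_{B^{s+ν}_{p,q}} + ‖f_1‖_{B^{s+ν−1}_{p,q}} ). -/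

import Mathlib

noncomputable section

open MeasureTheory Complex
open scoped ENNReal NNReal InnerProductSpace

/-- Euclidean space `ℝ^n`. -/
abbrev Rn (n : ℕ) := EuclideanSpace ℝ (Fin n)

/-- The Fourier transform `f̂(ξ) = ∫ e^{-i x·ξ} f(x) dx`. -/
def ftransform (n : ℕ) (f : Rn n → ℂ) (ξ : Rn n) : ℂ :=
  ∫ x : Rn n, Complex.exp (-(Complex.I * ((⟪x, ξ⟫_ℝ : ℝ) : ℂ))) * f x

/-- The Fourier integral operator `T_a^φ f(x) = (2π)^{-n} ∫ a(x,ξ) e^{iφ(x,ξ)} f̂(ξ) dξ`. -/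
def fio (n : ℕ) (a : Rn n → Rn n → ℂ) (φ : Rn n → Rn n → ℝ) (f : Rn n → ℂ) (x : Rn n) : ℂ :=
  ((((2 * Real.pi) ^ n)⁻¹ : ℝ) : ℂ) *
    ∫ ξ : Rn n, a x ξ * Complex.exp (Complex.I * ((φ x ξ : ℝ) : ℂ)) * ftransform n f ξ

/-- The Littlewood–Paley pieces `ψ_j` built from `ψ_0`. -/
def lpPiece (n : ℕ) (ψ0 : Rn n → ℝ) (j : ℕ) (ξ : Rn n) : ℝ :=
  if j = 0 then ψ0 ξ
  else ψ0 ((2 : ℝ) ^ (-(j : ℤ)) • ξ) - ψ0 ((2 : ℝ) ^ (-(j : ℤ) + 1) • ξ)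

/-- Hypotheses on the base function `ψ_0` of a Littlewood–Paley partition of unity. -/
def IsLPBase (n : ℕ) (ψ0 : Rn n → ℝ) : Prop :=
  ContDiff ℝ (⊤ : ℕ∞) ψ0 ∧ (∀ ξ : Rn n, ‖ξ‖ ≤ 1 → ψ0 ξ = 1) ∧ (∀ ξ : Rn n, 2 < ‖ξ‖ → ψ0 ξ = 0)

/-- Inverse Fourier transform of a real-valued function. -/
def invFT (n : ℕ) (h : Rn n → ℝ) (x : Rn n) : ℂ :=
  ((((2 * Real.pi) ^ n)⁻¹ : ℝ) : ℂ) *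
    ∫ ξ : Rn n, Complex.exp (Complex.I * ((⟪x, ξ⟫_ℝ : ℝ) : ℂ)) * ((h ξ : ℝ) : ℂ)

/-- The operator `h(D) g`: convolution of `g` with the inverse Fourier transform of `h`. -/
def smoothOp (n : ℕ) (h : Rn n → ℝ) (g : Rn n → ℂ) (x : Rn n) : ℂ :=
  ∫ y : Rn n, invFT n h (x - y) * g y

/-- `ℓ^q`-norm of a sequence in `ℝ≥0∞`, for `0 < q ≤ ∞`. -/
def lqSum (q : ℝ≥0∞) (u : ℕ → ℝ≥0∞) : ℝ≥0∞ :=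
  if q = ∞ then ⨆ j, u j else (∑' j, u j ^ q.toReal) ^ (1 / q.toReal)

/-- Besov–Lipschitz quasi-norm `‖g‖_{B^s_{p,q}}`. -/
def besovNorm (n : ℕ) (ψ0 : Rn n → ℝ) (s : ℝ) (p q : ℝ≥0∞) (g : Rn n → ℂ) : ℝ≥0∞ :=
  lqSum q fun j =>
    ENNReal.ofReal ((2 : ℝ) ^ ((j : ℝ) * s)) * eLpNorm (smoothOp n (lpPiece n ψ0 j) g) p volume

/-- Triebel–Lizorkin quasi-norm `‖g‖_{F^s_{p,q}}`. -/
def tlNorm (n : ℕ) (ψ0 : Rn n → ℝ) (s : ℝ) (p q : ℝ≥0∞) (g : Rn n → ℂ) : ℝ≥0∞ :=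
  if p = ∞ then
    essSup (fun x : Rn n => lqSum q fun j =>
      ENNReal.ofReal ((2 : ℝ) ^ ((j : ℝ) * s)) *
        (‖smoothOp n (lpPiece n ψ0 j) g x‖₊ : ℝ≥0∞)) volume
  else
    (∫⁻ x : Rn n, (lqSum q fun j =>
      ENNReal.ofReal ((2 : ℝ) ^ ((j : ℝ) * s)) *
        (‖smoothOp n (lpPiece n ψ0 j) g x‖₊ : ℝ≥0∞)) ^ p.toReal ∂volume) ^ (1 / p.toReal)

/-- Critical order `m_c(p) = -(n-1)|1/p - 1/2|`. -/
def criticalOrder (n : ℕ) (p : ℝ≥0∞) : ℝ := -((n : ℝ) - 1) * |p⁻¹.toReal - 1 / 2|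

/-- The symbol class `S^m(ℝ^n)`. -/
def SymbolClass (n : ℕ) (m : ℝ) (a : Rn n → Rn n → ℂ) : Prop :=
  ContDiff ℝ (⊤ : ℕ∞) (fun p : Rn n × Rn n => a p.1 p.2) ∧
  ∀ k l : ℕ, ∃ C : ℝ, ∀ x ξ : Rn n,
    ‖iteratedFDeriv ℝ k (fun ξ' => iteratedFDeriv ℝ l (fun x' => a x' ξ') x) ξ‖ ≤
      C * (1 + ‖ξ‖ ^ 2) ^ ((m - (k : ℝ)) / 2)

/-- Smoothness away from `ξ = 0` and positive homogeneity of degree 1 in `ξ` of a phase. -/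
def PhaseSmoothHomog (n : ℕ) (φ : Rn n → Rn n → ℝ) : Prop :=
  ContDiffOn ℝ (⊤ : ℕ∞) (fun p : Rn n × Rn n => φ p.1 p.2) {p : Rn n × Rn n | p.2 ≠ 0} ∧
  ∀ (x ξ : Rn n) (t : ℝ), 0 < t → φ x (t • ξ) = t * φ x ξ

/-- The phase class `Φ^k`. -/
def PhaseClass (n : ℕ) (k : ℕ) (φ : Rn n → Rn n → ℝ) : Prop :=
  PhaseSmoothHomog n φ ∧
  ∀ a b : ℕ, k ≤ a + b → ∃ C : ℝ, ∀ x ξ : Rn n, ξ ≠ 0 →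
    ‖ξ‖ ^ ((a : ℝ) - 1) *
      ‖iteratedFDerivWithin ℝ a
        (fun ξ' => iteratedFDeriv ℝ b (fun x' => φ x' ξ') x) {ξ' : Rn n | ξ' ≠ 0} ξ‖ ≤ C

/-- Determinant of the mixed Hessian `(∂²φ/∂x_i∂ξ_k)`. -/
def mixedHessianDet (n : ℕ) (φ : Rn n → Rn n → ℝ) (x ξ : Rn n) : ℝ :=
  Matrix.det (Matrix.of fun i k : Fin n =>
    fderiv ℝ (fun x' => fderiv ℝ (fun ξ' => φ x' ξ') ξ (EuclideanSpace.single k 1)) x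
      (EuclideanSpace.single i 1))

/-- The strong non-degeneracy (SND) condition. -/
def SNDCondition (n : ℕ) (φ : Rn n → Rn n → ℝ) : Prop :=
  ∃ δ : ℝ, 0 < δ ∧ ∀ x ξ : Rn n, ξ ≠ 0 → δ ≤ |mixedHessianDet n φ x ξ|

/-- Non-degeneracy of the phase on a compact set `K`. -/
def NonDegenerateOn (n : ℕ) (φ : Rn n → Rn n → ℝ) (K : Set (Rn n)) : Prop :=
  ∀ x ∈ K, ∀ ξ : Rn n, ξ ≠ 0 → mixedHessianDet n φ x ξ ≠ 0

/-- The solution of the Cauchy problem for the wave equation with initial data `f0, f1`. -/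
def waveSol (n : ℕ) (f0 f1 : Rn n → ℂ) (t : ℝ) (x : Rn n) : ℂ :=
  ((((2 * Real.pi) ^ n)⁻¹ : ℝ) : ℂ) *
      (∫ ξ : Rn n, Complex.exp (Complex.I * (((⟪x, ξ⟫_ℝ + t * ‖ξ‖ : ℝ)) : ℂ)) *
        (ftransform n f0 ξ / 2 + ftransform n f1 ξ / (2 * Complex.I * (‖ξ‖ : ℂ)))) +
    ((((2 * Real.pi) ^ n)⁻¹ : ℝ) : ℂ) *
      (∫ ξ : Rn n, Complex.exp (Complex.I * (((⟪x, ξ⟫_ℝ - t * ‖ξ‖ : ℝ)) : ℂ)) *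
        (ftransform n f0 ξ / 2 - ftransform n f1 ξ / (2 * Complex.I * (‖ξ‖ : ℂ))))

/-- The `L^1` norm of a function concentrated near the sphere of radius `L / 2π` grows at most like
the area of that sphere. -/
lemma lintegral_annulus_decay_le (n : ℕ) (hn : 2 ≤ n) :
    ∃ C : ℝ≥0, ∀ L : ℝ, 0 ≤ L →
      ∫⁻ x : Rn n, ENNReal.ofReal (((1 + |2 * Real.pi * ‖x‖ - L|) ^ (n + 1))⁻¹) ≤
        C * ENNReal.ofReal ((1 + L) ^ (n - 1)) := by
  have : Nontrivial (Rn n) := by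
    have : NeZero n := ⟨by omega⟩
    infer_instance
  have hpi := Real.pi_gt_three
  have h0 : Integrable (fun y : ℝ => ((1 + |y|) ^ 2)⁻¹) := by
    have := integrable_one_add_norm (E := ℝ) (μ := volume) (r := 2) (by simp)
    refine this.congr (.of_forall fun y => ?_)
    simp only [Real.norm_eq_abs]
    rw [Real.rpow_neg (by positivity), Real.rpow_two]
  set I : ℝ := ∫ y : ℝ, ((1 + |y|) ^ 2)⁻¹ with hI
  have hI0 : 0 ≤ I := integral_nonneg fun y => by positivity
  set A : ℝ := (Module.finrank ℝ (Rn n)) * (volume.real (Metric.ball (0 : Rn n) 1)) with hA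
  have hA0 : 0 ≤ A := by positivity
  refine ⟨⟨A * I, by positivity⟩, fun L hL => ?_⟩
  set f : ℝ → ℝ := fun y => ((1 + |2 * Real.pi * y - L|) ^ (n + 1))⁻¹ with hf
  have hcont : Continuous f := by
    refine Continuous.inv₀ (by fun_prop) fun y => by positivity
  have hint0 : Integrable (fun y : ℝ => (1 + L) ^ (n - 1) * ((1 + |y - L / (2 * Real.pi)|) ^ 2)⁻¹) :=
    (h0.comp_sub_right (L / (2 * Real.pi))).const_mul _
  have hbd : ∀ y ∈ Set.Ioi (0 : ℝ), y ^ (n - 1) * f y ≤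
      (1 + L) ^ (n - 1) * ((1 + |y - L / (2 * Real.pi)|) ^ 2)⁻¹ := by
    intro y hy
    have hy : 0 < y := hy
    set v := 1 + |2 * Real.pi * y - L| with hv
    have hv1 : 1 ≤ v := by simp [hv]
    have h1 : y ≤ (1 + L) * v := by
      have := le_abs_self (2 * Real.pi * y - L)
      nlinarith
    have h2 : 1 + |y - L / (2 * Real.pi)| ≤ v := by
      have : 2 * Real.pi * y - L = (2 * Real.pi) * (y - L / (2 * Real.pi)) := by
        field_simp
      rw [hv, this, abs_mul, abs_of_pos (by positivity : 0 < 2 * Real.pi)]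
      nlinarith [abs_nonneg (y - L / (2 * Real.pi))]
    have h3 : f y = (v ^ (n - 1))⁻¹ * (v ^ 2)⁻¹ := by
      simp only [hf]
      rw [← mul_inv, ← pow_add]
      congr 2
      omega
    rw [h3, ← mul_assoc]
    refine mul_le_mul ?_ ?_ (by positivity) (by positivity)
    · rw [← div_eq_mul_inv, div_le_iff₀ (by positivity), ← mul_pow]
      exact pow_le_pow_left₀ hy.le h1 _
    · gcongr
  have hintOn : IntegrableOn (fun y : ℝ => y ^ (n - 1) • f y) (Set.Ioi 0) := by
    refine (hint0.integrableOn (s := Set.Ioi 0)).mono' ?_ ?_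
    · exact ((continuous_pow _).smul hcont).aestronglyMeasurable
    · refine (ae_restrict_iff' measurableSet_Ioi).2 (.of_forall fun y hy => ?_)
      have : 0 ≤ y ^ (n - 1) * f y := by
        have : 0 < y := hy
        positivity
      rw [smul_eq_mul, Real.norm_of_nonneg this]
      exact hbd y hy
  have hInt : Integrable (fun x : Rn n => f ‖x‖) := by
    rw [integrable_fun_norm_addHaar]
    simpa using hintOn
  have key : ∫ x : Rn n, f ‖x‖ ≤ A * I * (1 + L) ^ (n - 1) := by
    rw [integral_fun_norm_addHaar, nsmul_eq_mul, smul_eq_mul, ← mul_assoc, ← hA, mul_assoc A]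
    refine mul_le_mul_of_nonneg_left ?_ hA0
    have e1 : Module.finrank ℝ (Rn n) - 1 = n - 1 := by simp
    rw [e1]
    calc ∫ y in Set.Ioi (0 : ℝ), y ^ (n - 1) • f y
        ≤ ∫ y in Set.Ioi (0 : ℝ), (1 + L) ^ (n - 1) * ((1 + |y - L / (2 * Real.pi)|) ^ 2)⁻¹ :=
          setIntegral_mono_on hintOn hint0.integrableOn measurableSet_Ioi hbd
      _ ≤ ∫ y : ℝ, (1 + L) ^ (n - 1) * ((1 + |y - L / (2 * Real.pi)|) ^ 2)⁻¹ :=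
          setIntegral_le_integral hint0 (.of_forall fun y => by positivity)
      _ = I * (1 + L) ^ (n - 1) := by
          rw [integral_const_mul, integral_sub_right_eq_self (fun y : ℝ => ((1 + |y|) ^ 2)⁻¹),
            mul_comm]
  have := ofReal_integral_eq_lintegral_ofReal hInt (.of_forall fun x => by positivity)
  rw [← this]
  calc ENNReal.ofReal (∫ x : Rn n, f ‖x‖) ≤ ENNReal.ofReal (A * I * (1 + L) ^ (n - 1)) :=
        ENNReal.ofReal_le_ofReal key
    _ = _ := by
        rw [ENNReal.ofReal_mul (by positivity)]
        congr 1
        exact ENNReal.ofReal_eq_coe_nnreal _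

/-- The weight adapted to the light cone at time `L`. -/
def coneWeight (n : ℕ) (L : ℝ) (x : Rn n) : ℝ :=
  ((2 * Real.pi * ‖x‖) ^ 2 - L ^ 2) / (1 + L)

lemma one_add_abs_sub_le_coneWeight {n : ℕ} {L : ℝ} (hL : 0 ≤ L) (x : Rn n) :
    1 + |2 * Real.pi * ‖x‖ - L| ≤ 3 * (1 + |coneWeight n L x|) := by
  have hr : 0 ≤ 2 * Real.pi * ‖x‖ := by positivity
  unfold coneWeight
  generalize 2 * Real.pi * ‖x‖ = r at hr
  have e : r ^ 2 - L ^ 2 = (r - L) * (r + L) := by ring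
  rw [e, abs_div, abs_mul, abs_of_nonneg (by positivity : 0 ≤ r + L),
    abs_of_pos (by positivity : 0 < 1 + L)]
  have : 3 * (1 + |r - L| * (r + L) / (1 + L)) = (3 * (1 + L) + 3 * |r - L| * (r + L)) / (1 + L) := by
    field_simp
  rw [this, le_div_iff₀ (by positivity)]
  by_cases h : 1 + L ≤ 3 * (r + L)
  · nlinarith [abs_nonneg (r - L)]
  · have : |r - L| ≤ 1 := by
      rw [abs_le]; constructor <;> linarith
    nlinarith [abs_nonneg (r - L)]

/-- Weighted `L^2` bounds imply `L^r` bounds for `r < 2`, with the gain of the cone geometry. -/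
lemma exists_eLpNorm_le_of_coneWeight (n : ℕ) (hn : 2 ≤ n) {r : ℝ} (hr : 0 < r) (hr2 : r < 2) :
    ∃ N : ℕ, ∃ C : ℝ≥0, ∀ (L : ℝ) (_ : 0 ≤ L) (K : Rn n → ℂ) (_ : AEStronglyMeasurable K volume)
      (B : ℝ≥0∞),
      eLpNorm K 2 volume ≤ B →
      eLpNorm (fun x => (((coneWeight n L x) ^ N : ℝ) : ℂ) * K x) 2 volume ≤ B →
      eLpNorm K (ENNReal.ofReal r) volume ≤
        C * B * ENNReal.ofReal ((1 + L) ^ (((n : ℝ) - 1) * (1 / r - 1 / 2))) := by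
  obtain ⟨C₁, hC₁⟩ := lintegral_annulus_decay_le n hn
  -- the conjugate exponent
  set t : ℝ := (1 / r - 1 / 2)⁻¹ with ht
  have hti : 0 < 1 / r - 1 / 2 := by
    rw [sub_pos]; exact one_div_lt_one_div_of_lt hr hr2
  have ht0 : 0 < t := inv_pos.2 hti
  obtain ⟨N, hN⟩ := exists_nat_ge ((n + 1) / t)
  have hNt : (n : ℝ) + 1 ≤ N * t := by rwa [div_le_iff₀ ht0] at hN
  refine ⟨N, (C₁ ^ (1 / t)) * (6 ^ N * 2), fun L hL K hK B h1 h2 => ?_⟩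
  set v : Rn n → ℝ := fun x => 1 + |2 * Real.pi * ‖x‖ - L| with hv
  have hv1 : ∀ x, 1 ≤ v x := fun x => by simp [hv]
  have hv0 : ∀ x, 0 < v x := fun x => lt_of_lt_of_le one_pos (hv1 x)
  have hvc : Continuous v := by fun_prop
  have hvK : eLpNorm (fun x => ((v x ^ N : ℝ) : ℂ) * K x) 2 volume ≤ 6 ^ N * 2 * B := by
    have hpt : ∀ x, ‖((v x ^ N : ℝ) : ℂ) * K x‖ ≤
        (6 : ℝ) ^ N * (‖K x‖ + ‖(((coneWeight n L x) ^ N : ℝ) : ℂ) * K x‖) := by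
      intro x
      rw [norm_mul, norm_mul, Complex.norm_real, Complex.norm_real, Real.norm_eq_abs,
        Real.norm_eq_abs, abs_pow, abs_pow, abs_of_pos (hv0 x)]
      have hw := abs_nonneg (coneWeight n L x)
      set w := |coneWeight n L x|
      have h3 : v x ^ N ≤ 6 ^ N * (1 + w ^ N) := by
        calc v x ^ N ≤ (3 * (1 + w)) ^ N :=
              pow_le_pow_left₀ (hv0 x).le (one_add_abs_sub_le_coneWeight hL x) _
          _ ≤ (6 * max 1 w) ^ N := by
              refine pow_le_pow_left₀ (by positivity) ?_ _
              nlinarith [le_max_left 1 w, le_max_right 1 w]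
          _ = 6 ^ N * (max 1 w) ^ N := mul_pow _ _ _
          _ ≤ 6 ^ N * (1 + w ^ N) := by
              gcongr
              rcases max_choice 1 w with h | h <;> rw [h]
              · simp; positivity
              · linarith
      calc v x ^ N * ‖K x‖ ≤ 6 ^ N * (1 + w ^ N) * ‖K x‖ := by gcongr
        _ = _ := by ring
    have hwm : AEStronglyMeasurable (fun x => (((coneWeight n L x) ^ N : ℝ) : ℂ) * K x) volume := by
      refine AEStronglyMeasurable.mul (Continuous.aestronglyMeasurable ?_) hK
      unfold coneWeight
      fun_prop
    calc eLpNorm (fun x => ((v x ^ N : ℝ) : ℂ) * K x) 2 volume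
        ≤ eLpNorm (fun x => (6 : ℝ) ^ N * (‖K x‖ + ‖(((coneWeight n L x) ^ N : ℝ) : ℂ) * K x‖)) 2
            volume := eLpNorm_mono_real hpt
      _ = 6 ^ N * eLpNorm ((fun x => ‖K x‖) +
            fun x => ‖(((coneWeight n L x) ^ N : ℝ) : ℂ) * K x‖) 2 volume := by
          have := eLpNorm_const_smul ((6 : ℝ) ^ N) ((fun x => ‖K x‖) +
            fun x => ‖(((coneWeight n L x) ^ N : ℝ) : ℂ) * K x‖) 2 (volume : Measure (Rn n))
          rw [Real.enorm_of_nonneg (by positivity), ENNReal.ofReal_pow (by norm_num),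
            ENNReal.ofReal_ofNat] at this
          exact this
      _ ≤ 6 ^ N * (B + B) := by
          gcongr
          refine (eLpNorm_add_le hK.norm hwm.norm one_le_two).trans ?_
          rw [eLpNorm_norm, eLpNorm_norm]
          gcongr
      _ = _ := by ring
  have hvinv : eLpNorm (fun x => (v x ^ N)⁻¹) (ENNReal.ofReal t) volume ≤
      (C₁ * ENNReal.ofReal ((1 + L) ^ (n - 1))) ^ (1 / t) := by
    rw [eLpNorm_eq_lintegral_rpow_enorm_toReal (by simpa using ht0) ENNReal.ofReal_ne_top,
      ENNReal.toReal_ofReal ht0.le]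
    refine ENNReal.rpow_le_rpow ((lintegral_mono fun x => ?_).trans (hC₁ L hL)) (by positivity)
    rw [Real.enorm_of_nonneg (by have := hv0 x; positivity),
      ENNReal.ofReal_rpow_of_nonneg (by have := hv0 x; positivity) ht0.le]
    refine ENNReal.ofReal_le_ofReal ?_
    rw [Real.inv_rpow (by have := hv0 x; positivity)]
    refine inv_anti₀ (by have := hv0 x; positivity) ?_
    rw [← Real.rpow_natCast, ← Real.rpow_natCast (v x) N, ← Real.rpow_mul (hv0 x).le]
    exact Real.rpow_le_rpow_of_exponent_le (hv1 x) (by push_cast; exact hNt)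
  have hH : ENNReal.HolderTriple (ENNReal.ofReal t) 2 (ENNReal.ofReal r) := by
    constructor
    rw [← ENNReal.ofReal_inv_of_pos ht0, ← ENNReal.ofReal_inv_of_pos hr, ht, inv_inv]
    rw [show (2 : ℝ≥0∞)⁻¹ = ENNReal.ofReal (1 / 2) by
      rw [one_div, ENNReal.ofReal_inv_of_pos two_pos]; simp, ← ENNReal.ofReal_add hti.le (by norm_num)]
    congr 1
    ring
  have hprod := eLpNorm_smul_le_mul_eLpNorm (p := ENNReal.ofReal t) (q := 2)
    (r := ENNReal.ofReal r) (f := fun x => ((v x ^ N : ℝ) : ℂ) * K x) (φ := fun x => (v x ^ N)⁻¹)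
    (μ := (volume : Measure (Rn n)))
    ((Continuous.aestronglyMeasurable (by fun_prop)).mul hK)
    (Continuous.aestronglyMeasurable (Continuous.inv₀ (by fun_prop) fun x => by
      have := hv0 x; positivity))
  have e : ((fun x => (v x ^ N)⁻¹) • fun x => ((v x ^ N : ℝ) : ℂ) * K x) = K := by
    ext x
    have : ((v x ^ N : ℝ) : ℂ) ≠ 0 := by
      have := hv0 x
      exact_mod_cast (pow_pos this N).ne'
    simp only [Pi.smul_apply', Complex.real_smul, Complex.ofReal_inv]
    rw [inv_mul_cancel_left₀ this]
  rw [e] at hprod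
  refine hprod.trans ((mul_le_mul' hvinv hvK).trans (le_of_eq ?_))
  rw [ENNReal.mul_rpow_of_nonneg _ _ (by positivity : 0 ≤ 1 / t),
    ENNReal.ofReal_rpow_of_nonneg (by positivity) (by positivity)]
  have e2 : ((1 + L) ^ (n - 1) : ℝ) ^ (1 / t) = (1 + L) ^ (((n : ℝ) - 1) * (1 / r - 1 / 2)) := by
    rw [← Real.rpow_natCast, ← Real.rpow_mul (by positivity), ht, one_div, inv_inv,
      Nat.cast_sub (by omega), Nat.cast_one]
  rw [e2]
  push_cast
  rw [← ENNReal.coe_rpow_of_nonneg _ (by positivity)]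
  ring

section Truncation

variable {α : Type*} [MeasurableSpace α] {μ : Measure α} [SFinite μ]

lemma lintegral_Ioi_mul_setLIntegral_swap {w : ℝ → ℝ≥0∞} (hw : Measurable w) {h : α → ℝ≥0∞}
    (hh : Measurable h) {S : Set (ℝ × α)} (hS : MeasurableSet S) :
    ∫⁻ r in Set.Ioi (0 : ℝ), w r * ∫⁻ x in {x | (r, x) ∈ S}, h x ∂μ =
      ∫⁻ x, h x * (∫⁻ r in Set.Ioi (0 : ℝ) ∩ {r | (r, x) ∈ S}, w r) ∂μ := by
  have h1 : ∀ r, w r * ∫⁻ x in {x | (r, x) ∈ S}, h x ∂μ =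
      ∫⁻ x, S.indicator (fun z => w z.1 * h z.2) (r, x) ∂μ := by
    intro r
    have hm : MeasurableSet {x | (r, x) ∈ S} := measurable_prodMk_left hS
    rw [← lintegral_indicator hm, ← lintegral_const_mul _ (hh.indicator hm)]
    refine lintegral_congr fun x => ?_
    by_cases hx : (r, x) ∈ S
    · simp [Set.indicator, hx]
    · simp [Set.indicator, hx]
  have h2 : ∀ x, h x * ∫⁻ r in Set.Ioi (0 : ℝ) ∩ {r | (r, x) ∈ S}, w r =
      ∫⁻ r in Set.Ioi (0 : ℝ), S.indicator (fun z => w z.1 * h z.2) (r, x) := by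
    intro x
    have hm : MeasurableSet {r | (r, x) ∈ S} := measurable_prodMk_right hS
    rw [Set.inter_comm, ← Measure.restrict_restrict hm, ← lintegral_indicator hm,
      ← lintegral_const_mul _ (hw.indicator hm)]
    refine lintegral_congr fun r => ?_
    by_cases hx : (r, x) ∈ S
    · simp [Set.indicator, hx, mul_comm]
    · simp [Set.indicator, hx]
  simp_rw [h1, h2]
  refine lintegral_lintegral_swap ?_
  refine Measurable.aemeasurable (Measurable.indicator ?_ hS)
  exact (hw.comp measurable_fst).mul (hh.comp measurable_snd)

lemma lintegral_Ioo_rpow {e b : ℝ} (he : -1 < e) (hb : 0 ≤ b) :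
    ∫⁻ r in Set.Ioo 0 b, ENNReal.ofReal (r ^ e) = ENNReal.ofReal (b ^ (e + 1) / (e + 1)) := by
  have hi : IntervalIntegrable (fun r : ℝ => r ^ e) volume 0 b :=
    intervalIntegral.intervalIntegrable_rpow' he
  rw [setLIntegral_congr Ioo_ae_eq_Ioc, ← ofReal_integral_eq_lintegral_ofReal
    ((intervalIntegrable_iff_integrableOn_Ioc_of_le hb).1 hi)
    ((ae_restrict_iff' measurableSet_Ioc).2 (.of_forall fun r hr => Real.rpow_nonneg hr.1.le _)),
    ← intervalIntegral.integral_of_le hb, integral_rpow (Or.inl he)]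
  rw [Real.zero_rpow (by linarith), sub_zero]

lemma lintegral_Ici_rpow {e b : ℝ} (he : e < -1) (hb : 0 < b) :
    ∫⁻ r in Set.Ici b, ENNReal.ofReal (r ^ e) = ENNReal.ofReal (b ^ (e + 1) / (-(e + 1))) := by
  rw [setLIntegral_congr Ioi_ae_eq_Ici.symm, ← ofReal_integral_eq_lintegral_ofReal
    (integrableOn_Ioi_rpow_of_lt he hb)
    ((ae_restrict_iff' measurableSet_Ioi).2
      (.of_forall fun r hr => Real.rpow_nonneg (hb.le.trans (le_of_lt hr)) _)),
    integral_Ioi_rpow_of_lt he hb]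
  congr 1
  rw [div_neg, neg_div]

lemma lintegral_rpow_mul_setLIntegral_lt {G : α → ℝ} (hG : Measurable G) (hG0 : ∀ x, 0 ≤ G x)
    {a k e : ℝ} (ha : 0 < a) (hk : 0 < k) (he : -1 < e) :
    ∫⁻ r in Set.Ioi (0 : ℝ), ENNReal.ofReal (r ^ e) *
        ∫⁻ x in {x | a * r < G x}, ENNReal.ofReal (G x ^ k) ∂μ =
      ENNReal.ofReal (a ^ (-(e + 1)) / (e + 1)) *
        ∫⁻ x, ENNReal.ofReal (G x ^ (k + (e + 1))) ∂μ := by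
  have hS : MeasurableSet {z : ℝ × α | a * z.1 < G z.2} :=
    measurableSet_lt (by fun_prop) (by fun_prop)
  have := lintegral_Ioi_mul_setLIntegral_swap (μ := μ) (w := fun r => ENNReal.ofReal (r ^ e))
    (by fun_prop) (h := fun x => ENNReal.ofReal (G x ^ k)) (by fun_prop) hS
  simp only [Set.mem_ofPred_eq] at this
  rw [this, ← lintegral_const_mul _ (by fun_prop)]
  refine lintegral_congr fun x => ?_
  have hset : Set.Ioi (0 : ℝ) ∩ {r | a * r < G x} = Set.Ioo 0 (G x / a) := by
    ext r
    simp [lt_div_iff₀ ha, mul_comm a]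
  rw [hset, lintegral_Ioo_rpow he (by have := hG0 x; positivity),
    ← ENNReal.ofReal_mul (by have := hG0 x; positivity), ← ENNReal.ofReal_mul (by
      have : 0 < e + 1 := by linarith
      positivity)]
  congr 1
  rw [Real.div_rpow (hG0 x) ha.le, Real.rpow_neg ha.le, Real.rpow_add_of_nonneg (hG0 x) hk.le
    (by linarith)]
  field_simp

lemma lintegral_rpow_mul_setLIntegral_le {G : α → ℝ} (hG : Measurable G) (hG0 : ∀ x, 0 ≤ G x)
    {a k e : ℝ} (ha : 0 < a) (hk : 0 < k) (he : e < -1) (hke : 0 < k + (e + 1)) :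
    ∫⁻ r in Set.Ioi (0 : ℝ), ENNReal.ofReal (r ^ e) *
        ∫⁻ x in {x | G x ≤ a * r}, ENNReal.ofReal (G x ^ k) ∂μ =
      ENNReal.ofReal (a ^ (-(e + 1)) / (-(e + 1))) *
        ∫⁻ x, ENNReal.ofReal (G x ^ (k + (e + 1))) ∂μ := by
  have hS : MeasurableSet {z : ℝ × α | G z.2 ≤ a * z.1} :=
    measurableSet_le (by fun_prop) (by fun_prop)
  have := lintegral_Ioi_mul_setLIntegral_swap (μ := μ) (w := fun r => ENNReal.ofReal (r ^ e))
    (by fun_prop) (h := fun x => ENNReal.ofReal (G x ^ k)) (by fun_prop) hS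
  simp only [Set.mem_ofPred_eq] at this
  rw [this, ← lintegral_const_mul _ (by fun_prop)]
  refine lintegral_congr fun x => ?_
  rcases (hG0 x).eq_or_lt with h0 | h0
  · rw [← h0, Real.zero_rpow hk.ne', Real.zero_rpow hke.ne']
    simp
  have hset : Set.Ioi (0 : ℝ) ∩ {r | G x ≤ a * r} = Set.Ici (G x / a) := by
    ext r
    simp only [Set.mem_inter_iff, Set.mem_Ioi, Set.mem_ofPred_eq, Set.mem_Ici, div_le_iff₀ ha,
      mul_comm a]
    refine ⟨fun h => h.2, fun h => ⟨?_, h⟩⟩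
    exact pos_of_mul_pos_left (h0.trans_le h) ha.le
  rw [hset, lintegral_Ici_rpow he (by positivity),
    ← ENNReal.ofReal_mul (by positivity), ← ENNReal.ofReal_mul (by
      have : 0 < -(e + 1) := by linarith
      positivity)]
  congr 1
  have : -(e + 1) ≠ 0 := by linarith
  rw [Real.div_rpow (hG0 x) ha.le, Real.rpow_neg ha.le, Real.rpow_add h0 k (e + 1)]
  field_simp

lemma measure_lt_norm_mul_rpow_le {F : α → ℂ} (hF : AEStronglyMeasurable F μ) {r p : ℝ}
    (hr : 0 < r) (k : ℕ) :
    μ {x | r / 2 ≤ ‖F x‖} * ENNReal.ofReal (r ^ (p - 1)) ≤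
      2 ^ k * (ENNReal.ofReal (r ^ (p - 1 - k)) * ∫⁻ x, ‖F x‖ₑ ^ k ∂μ) := by
  have h := mul_meas_ge_le_lintegral₀ (μ := μ) (f := fun x => ‖F x‖ₑ ^ k)
    (hF.enorm.pow_const k) (ENNReal.ofReal ((r / 2) ^ k))
  have hsub : {x | r / 2 ≤ ‖F x‖} ⊆ {x | ENNReal.ofReal ((r / 2) ^ k) ≤ ‖F x‖ₑ ^ k} := by
    intro x hx
    have hx : r / 2 ≤ ‖F x‖ := hx
    simp only [Set.mem_ofPred_eq]
    rw [ENNReal.ofReal_pow (by positivity), ← ofReal_norm]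
    gcongr
  have e : ENNReal.ofReal (r ^ (p - 1)) =
      2 ^ k * ENNReal.ofReal (r ^ (p - 1 - k)) * ENNReal.ofReal ((r / 2) ^ k) := by
    rw [show (2 : ℝ≥0∞) ^ k = ENNReal.ofReal (2 ^ k) by
        rw [ENNReal.ofReal_pow (by norm_num)]; simp,
      ← ENNReal.ofReal_mul (by positivity), ← ENNReal.ofReal_mul (by positivity)]
    congr 1
    rw [Real.rpow_sub hr (p - 1) k, Real.rpow_natCast, div_pow]
    field_simp
  calc μ {x | r / 2 ≤ ‖F x‖} * ENNReal.ofReal (r ^ (p - 1))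
      = 2 ^ k * (ENNReal.ofReal (r ^ (p - 1 - k)) *
        (ENNReal.ofReal ((r / 2) ^ k) * μ {x | r / 2 ≤ ‖F x‖})) := by rw [e]; ring
    _ ≤ _ := by
        gcongr
        exact (mul_le_mul_right (measure_mono hsub) _).trans h

/-- Marcinkiewicz interpolation between strong type `(1,1)` and strong type `(2,2)`, with explicit
dependence on the `(1,1)` constant. -/
lemma lintegral_rpow_le_of_truncation_lt_two {p B : ℝ} (hp1 : 1 < p) (hp2 : p < 2) (hB : 0 ≤ B)
    {A : ℝ} (hA : 0 < A) {F g : α → ℂ} (hF : AEStronglyMeasurable F μ) (hg : Measurable g)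
    {U V : ℝ → α → ℂ} (hUm : ∀ a, AEStronglyMeasurable (U a) μ)
    (hVm : ∀ a, AEStronglyMeasurable (V a) μ)
    (hUV : ∀ a, 0 < a → ∀ x, ‖F x‖ ≤ ‖U a x‖ + ‖V a x‖)
    (hU : ∀ a, 0 < a → ∫⁻ x, ‖U a x‖ₑ ∂μ ≤
      ENNReal.ofReal A * ∫⁻ x in {x | a < ‖g x‖}, ‖g x‖ₑ ∂μ)
    (hV : ∀ a, 0 < a → ∫⁻ x, ‖V a x‖ₑ ^ 2 ∂μ ≤
      ENNReal.ofReal B * ∫⁻ x in {x | ‖g x‖ ≤ a}, ‖g x‖ₑ ^ 2 ∂μ) :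
    ∫⁻ x, ‖F x‖ₑ ^ p ∂μ ≤ ENNReal.ofReal (p * (2 / (p - 1) + 4 * B / (2 - p)) * A ^ (2 - p)) *
      ∫⁻ x, ‖g x‖ₑ ^ p ∂μ := by
  have hp0 : 0 < p := by linarith
  have hen : ∀ (f : α → ℂ) (k : ℝ) (_ : 0 ≤ k) (x : α),
      ‖f x‖ₑ ^ k = ENNReal.ofReal (‖f x‖ ^ k) := fun f k hk x => by
    rw [← ofReal_norm, ENNReal.ofReal_rpow_of_nonneg (norm_nonneg _) hk]
  have hg1 : ∀ x, ‖g x‖ₑ = ENNReal.ofReal (‖g x‖ ^ (1 : ℝ)) := fun x => by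
    rw [Real.rpow_one, ofReal_norm]
  have hg2 : ∀ x, ‖g x‖ₑ ^ 2 = ENNReal.ofReal (‖g x‖ ^ (2 : ℝ)) := fun x => by
    rw [Real.rpow_two, ENNReal.ofReal_pow (norm_nonneg _), ofReal_norm]
  simp_rw [hen _ p hp0.le]
  rw [lintegral_rpow_eq_lintegral_meas_lt_mul μ (.of_forall fun x => norm_nonneg _)
    hF.norm.aemeasurable hp0]
  have hlevel : ∀ r ∈ Set.Ioi (0 : ℝ), μ {x | r < ‖F x‖} * ENNReal.ofReal (r ^ (p - 1)) ≤
      ENNReal.ofReal (2 * A) * (ENNReal.ofReal (r ^ (p - 2)) *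
        ∫⁻ x in {x | A * r < ‖g x‖}, ENNReal.ofReal (‖g x‖ ^ (1 : ℝ)) ∂μ) +
      ENNReal.ofReal (4 * B) * (ENNReal.ofReal (r ^ (p - 3)) *
        ∫⁻ x in {x | ‖g x‖ ≤ A * r}, ENNReal.ofReal (‖g x‖ ^ (2 : ℝ)) ∂μ) := by
    intro r hr
    have hr : 0 < r := hr
    have hAr : 0 < A * r := by positivity
    have hsub : {x | r < ‖F x‖} ⊆ {x | r / 2 ≤ ‖U (A * r) x‖} ∪ {x | r / 2 ≤ ‖V (A * r) x‖} := by
      intro x hx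
      have hx : r < ‖F x‖ := hx
      by_contra hcon
      simp only [Set.mem_union, Set.mem_ofPred_eq, not_or, not_le] at hcon
      linarith [hUV (A * r) hAr x]
    have h1 := measure_lt_norm_mul_rpow_le (hUm (A * r)) hr 1 (p := p)
    have h2 := measure_lt_norm_mul_rpow_le (hVm (A * r)) hr 2 (p := p)
    have hU' := hU (A * r) hAr
    have hV' := hV (A * r) hAr
    simp_rw [hg1] at hU'
    simp_rw [hg2] at hV'
    calc μ {x | r < ‖F x‖} * ENNReal.ofReal (r ^ (p - 1))
        ≤ (μ {x | r / 2 ≤ ‖U (A * r) x‖} + μ {x | r / 2 ≤ ‖V (A * r) x‖}) *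
          ENNReal.ofReal (r ^ (p - 1)) := by
          gcongr
          exact (measure_mono hsub).trans (measure_union_le _ _)
      _ ≤ 2 ^ 1 * (ENNReal.ofReal (r ^ (p - 1 - (1 : ℕ))) * (ENNReal.ofReal A *
            ∫⁻ x in {x | A * r < ‖g x‖}, ENNReal.ofReal (‖g x‖ ^ (1 : ℝ)) ∂μ)) +
          2 ^ 2 * (ENNReal.ofReal (r ^ (p - 1 - (2 : ℕ))) * (ENNReal.ofReal B *
            ∫⁻ x in {x | ‖g x‖ ≤ A * r}, ENNReal.ofReal (‖g x‖ ^ (2 : ℝ)) ∂μ)) := by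
          rw [add_mul]
          refine add_le_add (h1.trans ?_) (h2.trans ?_)
          · simp only [pow_one]
            gcongr
          · gcongr
      _ = _ := by
          rw [ENNReal.ofReal_mul (by norm_num : (0 : ℝ) ≤ 2),
            ENNReal.ofReal_mul (by norm_num : (0 : ℝ) ≤ 4)]
          have e1 : p - 1 - ((1 : ℕ) : ℝ) = p - 2 := by push_cast; ring
          have e2 : p - 1 - ((2 : ℕ) : ℝ) = p - 3 := by push_cast; ring
          have e3 : ENNReal.ofReal 2 = 2 := by simp
          have e4 : ENNReal.ofReal 4 = 4 := by simp
          rw [e1, e2, e3, e4]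
          ring
  have hmain := setLIntegral_mono' (μ := volume) measurableSet_Ioi hlevel
  have hmeas : Measurable fun r : ℝ => ENNReal.ofReal (2 * A) * (ENNReal.ofReal (r ^ (p - 2)) *
        ∫⁻ x in {x | A * r < ‖g x‖}, ENNReal.ofReal (‖g x‖ ^ (1 : ℝ)) ∂μ) := by
    have hS : MeasurableSet {z : ℝ × α | A * z.1 < ‖g z.2‖} :=
      measurableSet_lt (by fun_prop) (by fun_prop)
    have : ∀ r : ℝ, ∫⁻ x in {x | A * r < ‖g x‖}, ENNReal.ofReal (‖g x‖ ^ (1 : ℝ)) ∂μ =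
        ∫⁻ x, {z : ℝ × α | A * z.1 < ‖g z.2‖}.indicator
          (fun z => ENNReal.ofReal (‖g z.2‖ ^ (1 : ℝ))) (r, x) ∂μ := fun r => by
      rw [← lintegral_indicator (measurableSet_lt (by fun_prop) (by fun_prop))]
      rfl
    simp_rw [this]
    have h2 : Measurable ({z : ℝ × α | A * z.1 < ‖g z.2‖}.indicator
          (fun z => ENNReal.ofReal (‖g z.2‖ ^ (1 : ℝ)))) := Measurable.indicator (by fun_prop) hS
    have := h2.lintegral_prod_right' (ν := μ)
    fun_prop
  rw [lintegral_add_left hmeas, lintegral_const_mul' _ _ ENNReal.ofReal_ne_top,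
    lintegral_const_mul' _ _ ENNReal.ofReal_ne_top,
    lintegral_rpow_mul_setLIntegral_lt hg.norm (fun x => norm_nonneg _) hA one_pos
      (by linarith : -1 < p - 2),
    lintegral_rpow_mul_setLIntegral_le hg.norm (fun x => norm_nonneg _) hA two_pos
      (by linarith : p - 3 < -1) (by linarith)] at hmain
  refine (mul_le_mul_right hmain _).trans (le_of_eq ?_)
  have e1 : 1 + (p - 2 + 1) = p := by ring
  have e2 : 2 + (p - 3 + 1) = p := by ring
  have hp1' : 0 < p - 1 := by linarith
  have hp2' : 0 < 2 - p := by linarith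
  rw [e1, e2, ← mul_assoc, ← mul_assoc, ← ENNReal.ofReal_mul (by positivity),
    ← ENNReal.ofReal_mul (by positivity), ← add_mul, ← mul_assoc,
    ← ENNReal.ofReal_add, ← ENNReal.ofReal_mul hp0.le]
  · congr 2
    have e3 : A ^ (-(p - 2 + 1)) = A ^ (2 - p) / A := by
      rw [← Real.rpow_sub_one hA.ne']; congr 1; ring
    have e4 : A ^ (-(p - 3 + 1)) = A ^ (2 - p) := by congr 1; ring
    have e5 : p - 2 + 1 = p - 1 := by ring
    have e6 : -(p - 3 + 1) = 2 - p := by ring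
    rw [e3, e5, e6]
    field_simp
  · have : 0 < p - 2 + 1 := by linarith
    positivity
  · have : 0 < -(p - 3 + 1) := by linarith
    positivity

/-- Marcinkiewicz interpolation between strong type `(2,2)` and strong type `(∞,∞)`, with explicit
dependence on the `(∞,∞)` constant. -/
lemma lintegral_rpow_le_of_truncation_two_lt {p B : ℝ} (hp2 : 2 < p) (hB : 0 ≤ B)
    {A : ℝ} (hA : 0 < A) {F g : α → ℂ} (hF : AEStronglyMeasurable F μ) (hg : Measurable g)
    {U V : ℝ → α → ℂ} (hUm : ∀ a, AEStronglyMeasurable (U a) μ)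
    (hUV : ∀ a, 0 < a → ∀ x, ‖F x‖ ≤ ‖U a x‖ + ‖V a x‖)
    (hU : ∀ a, 0 < a → ∫⁻ x, ‖U a x‖ₑ ^ 2 ∂μ ≤
      ENNReal.ofReal B * ∫⁻ x in {x | a < ‖g x‖}, ‖g x‖ₑ ^ 2 ∂μ)
    (hV : ∀ a, 0 < a → ∀ x, ‖V a x‖ ≤ A * a) :
    ∫⁻ x, ‖F x‖ₑ ^ p ∂μ ≤ ENNReal.ofReal (p * (4 * B * 2 ^ (p - 2) / (p - 2)) * A ^ (p - 2)) *
      ∫⁻ x, ‖g x‖ₑ ^ p ∂μ := by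
  have hp0 : 0 < p := by linarith
  have hen : ∀ (f : α → ℂ) (k : ℝ) (_ : 0 ≤ k) (x : α),
      ‖f x‖ₑ ^ k = ENNReal.ofReal (‖f x‖ ^ k) := fun f k hk x => by
    rw [← ofReal_norm, ENNReal.ofReal_rpow_of_nonneg (norm_nonneg _) hk]
  have hg2 : ∀ x, ‖g x‖ₑ ^ 2 = ENNReal.ofReal (‖g x‖ ^ (2 : ℝ)) := fun x => by
    rw [Real.rpow_two, ENNReal.ofReal_pow (norm_nonneg _), ofReal_norm]
  simp_rw [hen _ p hp0.le]
  rw [lintegral_rpow_eq_lintegral_meas_lt_mul μ (.of_forall fun x => norm_nonneg _)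
    hF.norm.aemeasurable hp0]
  set a : ℝ := (2 * A)⁻¹ with ha
  have ha0 : 0 < a := by positivity
  have hlevel : ∀ r ∈ Set.Ioi (0 : ℝ), μ {x | r < ‖F x‖} * ENNReal.ofReal (r ^ (p - 1)) ≤
      ENNReal.ofReal (4 * B) * (ENNReal.ofReal (r ^ (p - 3)) *
        ∫⁻ x in {x | a * r < ‖g x‖}, ENNReal.ofReal (‖g x‖ ^ (2 : ℝ)) ∂μ) := by
    intro r hr
    have hr : 0 < r := hr
    have har : 0 < a * r := by positivity
    have hsub : {x | r < ‖F x‖} ⊆ {x | r / 2 ≤ ‖U (a * r) x‖} := by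
      intro x hx
      have hx : r < ‖F x‖ := hx
      have h3 := hV (a * r) har x
      have h4 : A * (a * r) = r / 2 := by rw [ha]; field_simp
      rw [h4] at h3
      have := hUV (a * r) har x
      simp only [Set.mem_ofPred_eq]
      linarith
    have h2 := measure_lt_norm_mul_rpow_le (hUm (a * r)) hr 2 (p := p)
    have hU' := hU (a * r) har
    simp_rw [hg2] at hU'
    calc μ {x | r < ‖F x‖} * ENNReal.ofReal (r ^ (p - 1))
        ≤ μ {x | r / 2 ≤ ‖U (a * r) x‖} * ENNReal.ofReal (r ^ (p - 1)) := by
          gcongr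
      _ ≤ 2 ^ 2 * (ENNReal.ofReal (r ^ (p - 1 - (2 : ℕ))) * (ENNReal.ofReal B *
            ∫⁻ x in {x | a * r < ‖g x‖}, ENNReal.ofReal (‖g x‖ ^ (2 : ℝ)) ∂μ)) := by
          refine h2.trans ?_
          gcongr
      _ = _ := by
          rw [ENNReal.ofReal_mul (by norm_num : (0 : ℝ) ≤ 4)]
          have e2 : p - 1 - ((2 : ℕ) : ℝ) = p - 3 := by push_cast; ring
          have e4 : ENNReal.ofReal 4 = 4 := by simp
          rw [e2, e4]
          ring
  have hmain := setLIntegral_mono' (μ := volume) measurableSet_Ioi hlevel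
  rw [lintegral_const_mul' _ _ ENNReal.ofReal_ne_top,
    lintegral_rpow_mul_setLIntegral_lt hg.norm (fun x => norm_nonneg _) ha0 two_pos
      (by linarith : -1 < p - 3)] at hmain
  refine (mul_le_mul_right hmain _).trans (le_of_eq ?_)
  have e2 : 2 + (p - 3 + 1) = p := by ring
  have hp2' : 0 < p - 2 := by linarith
  rw [e2, ← mul_assoc, ← ENNReal.ofReal_mul (by positivity), ← mul_assoc,
    ← ENNReal.ofReal_mul (by positivity)]
  congr 2
  have e3 : a ^ (-(p - 3 + 1)) = 2 ^ (p - 2) * A ^ (p - 2) := by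
    rw [ha, Real.inv_rpow (by positivity), Real.rpow_neg (by positivity), inv_inv,
      Real.mul_rpow (by norm_num) hA.le]
    congr 2 <;> ring
  have e5 : p - 3 + 1 = p - 2 := by ring
  rw [e3, e5]
  field_simp

end Truncation

section

open scoped FourierTransform SchwartzMap

section ConvolutionOperator

variable {V : Type*} [NormedAddCommGroup V] [InnerProductSpace ℝ V] [FiniteDimensional ℝ V]
  [MeasurableSpace V] [BorelSpace V]

/-- The convolution `∫ K(x - y) g(y) dy`. -/
def kernelConv (K g : V → ℂ) (x : V) : ℂ := ∫ y, K (x - y) * g y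

lemma measurable_kernelConv {K g : V → ℂ} (hK : Measurable K) (hg : Measurable g) :
    StronglyMeasurable (kernelConv K g) := by
  refine StronglyMeasurable.integral_prod_right' (ν := volume)
    (f := fun z : V × V => K (z.1 - z.2) * g z.2) ?_
  exact Measurable.stronglyMeasurable (by fun_prop)

lemma kernelConv_schwartz_eq (K g : 𝓢(V, ℂ)) :
    kernelConv K g = (SchwartzMap.convolution (ContinuousLinearMap.mul ℂ ℂ) g K : V → ℂ) := by
  ext x
  rw [SchwartzMap.convolution_apply]
  simp [kernelConv, convolution, mul_comm]

lemma fourier_kernelConv_schwartz (K g : 𝓢(V, ℂ)) (ξ : V) :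
    𝓕 (kernelConv K g) ξ = 𝓕 (K : V → ℂ) ξ * 𝓕 (g : V → ℂ) ξ := by
  rw [kernelConv_schwartz_eq, ← SchwartzMap.fourier_coe, SchwartzMap.fourier_convolution,
    SchwartzMap.pairing_apply_apply]
  simp [SchwartzMap.fourier_coe, mul_comm]

lemma eLpNorm_two_sq (f : V → ℂ) : eLpNorm f 2 volume ^ 2 = ∫⁻ x, ‖f x‖ₑ ^ 2 := by
  rw [eLpNorm_eq_lintegral_rpow_enorm_toReal (by simp) (by simp)]
  simp only [ENNReal.toReal_ofNat, ENNReal.rpow_ofNat]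
  rw [← ENNReal.rpow_natCast, ← ENNReal.rpow_mul]
  simp

lemma lintegral_enorm_sq_schwartz (f : 𝓢(V, ℂ)) :
    ∫⁻ x, ‖f x‖ₑ ^ 2 = ENNReal.ofReal (∫ x, ‖f x‖ ^ 2) := by
  have h := (f.memLp 2 volume).integrable_norm_pow (by simp)
  rw [ofReal_integral_eq_lintegral_ofReal (by simpa using h) (.of_forall fun x => by positivity)]
  refine lintegral_congr fun x => ?_
  rw [ENNReal.ofReal_pow (norm_nonneg _), ofReal_norm]

lemma eLpNorm_fourier_schwartz (f : 𝓢(V, ℂ)) :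
    eLpNorm (𝓕 f : 𝓢(V, ℂ)) 2 volume = eLpNorm f 2 volume := by
  have h : eLpNorm (𝓕 f : 𝓢(V, ℂ)) 2 volume ^ 2 = eLpNorm f 2 volume ^ 2 := by
    rw [eLpNorm_two_sq, eLpNorm_two_sq, lintegral_enorm_sq_schwartz, lintegral_enorm_sq_schwartz,
      SchwartzMap.integral_norm_sq_fourier]
  exact ENNReal.rpow_left_injective two_ne_zero (by simpa using h)

lemma eLpNorm_two_kernelConv_schwartz_le (K g : 𝓢(V, ℂ)) {B : ℝ} (hB : 0 ≤ B)
    (hK : ∀ ξ, ‖𝓕 (K : V → ℂ) ξ‖ ≤ B) :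
    eLpNorm (kernelConv K g) 2 volume ≤ ENNReal.ofReal B * eLpNorm g 2 volume := by
  rw [kernelConv_schwartz_eq, ← eLpNorm_fourier_schwartz, ← eLpNorm_fourier_schwartz g]
  refine (eLpNorm_le_mul_eLpNorm_of_ae_le_mul (c := B) (.of_forall fun ξ => ?_) 2)
  rw [SchwartzMap.fourier_convolution, SchwartzMap.pairing_apply_apply]
  simp only [ContinuousLinearMap.mul_apply', norm_mul]
  rw [mul_comm, SchwartzMap.fourier_coe K]
  gcongr
  exact hK ξ

lemma lintegral_kernel_mul_le (K : 𝓢(V, ℂ)) {g : V → ℂ} (hg : AEStronglyMeasurable g volume)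
    (x : V) : ∫⁻ y, ‖K (x - y) * g y‖ₑ ≤ eLpNorm K 2 volume * eLpNorm g 2 volume := by
  have h := eLpNorm_smul_le_mul_eLpNorm (p := 2) (q := 2) (r := 1) (μ := volume) hg
    (φ := fun y => K (x - y)) (K.continuous.comp (by fun_prop)).aestronglyMeasurable
  rw [eLpNorm_one_eq_lintegral_enorm] at h
  refine h.trans_eq ?_
  congr 1
  exact eLpNorm_comp_measurePreserving K.continuous.aestronglyMeasurable
    (Measure.measurePreserving_sub_left volume x)

lemma eLpNorm_two_kernelConv_le (K : 𝓢(V, ℂ)) {g : V → ℂ} (hg : MemLp g 2 volume) {B : ℝ}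
    (hB : 0 ≤ B) (hK : ∀ ξ, ‖𝓕 (K : V → ℂ) ξ‖ ≤ B) :
    eLpNorm (kernelConv K g) 2 volume ≤ ENNReal.ofReal B * eLpNorm g 2 volume := by
  have happ : ∀ k : ℕ, ∃ h : 𝓢(V, ℂ),
      eLpNorm (fun y => g y - h y) 2 volume ≤ ENNReal.ofReal (1 / ((k : ℝ) + 1)) := fun k => by
    obtain ⟨h, h1, h2, h3⟩ := hg.exist_eLpNorm_sub_le (by simp) (by simp)
      (show 0 < 1 / ((k : ℝ) + 1) by positivity)
    exact ⟨h1.toSchwartzMap h2, h3⟩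
  choose h hh using happ
  have h0 : Filter.Tendsto (fun k : ℕ => ENNReal.ofReal (1 / ((k : ℝ) + 1))) Filter.atTop
      (nhds 0) := by
    rw [← ENNReal.ofReal_zero]
    exact ENNReal.tendsto_ofReal tendsto_one_div_add_atTop_nhds_zero_nat
  have hInt : ∀ x, ∀ f : V → ℂ, MemLp f 2 volume → Integrable (fun y => K (x - y) * f y) := by
    intro x f hf
    refine ⟨((K.continuous.comp (by fun_prop)).aestronglyMeasurable).mul hf.1, ?_⟩
    exact (lintegral_kernel_mul_le K hf.1 x).trans_lt
      (ENNReal.mul_lt_top (K.memLp 2 volume).2 hf.2)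
  have hlim : ∀ x, Filter.Tendsto (fun k => kernelConv K (h k) x) Filter.atTop
      (nhds (kernelConv K g x)) := by
    intro x
    rw [tendsto_iff_edist_tendsto_0]
    have hz : Filter.Tendsto (fun k : ℕ => eLpNorm K 2 volume *
        ENNReal.ofReal (1 / ((k : ℝ) + 1))) Filter.atTop (nhds 0) := by
      have := ENNReal.Tendsto.const_mul h0 (Or.inr (K.memLp 2 volume).2.ne)
      rwa [mul_zero] at this
    refine tendsto_of_tendsto_of_tendsto_of_le_of_le tendsto_const_nhds hz (fun _ => bot_le)
      fun k => ?_
    simp only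
    rw [edist_comm, edist_eq_enorm_sub]
    have e : kernelConv K g x - kernelConv K (h k) x = ∫ y, K (x - y) * (g y - h k y) := by
      rw [kernelConv, kernelConv, ← integral_sub (hInt x g hg) (hInt x _ ((h k).memLp 2 volume))]
      refine integral_congr_ae (.of_forall fun y => ?_)
      simp [mul_sub]
    rw [e]
    refine (enorm_integral_le_lintegral_enorm _).trans ?_
    refine (lintegral_kernel_mul_le K (hg.1.sub ((h k).memLp 2 volume).1) x).trans ?_
    gcongr
    exact hh k
  refine (Lp.eLpNorm_lim_le_liminf_eLpNorm (fun k => ?_) _ (.of_forall hlim)).trans ?_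
  · exact (measurable_kernelConv K.continuous.measurable
      (h k).continuous.measurable).aestronglyMeasurable
  have hb : ∀ k, eLpNorm (kernelConv K (h k)) 2 volume ≤
      ENNReal.ofReal B * (eLpNorm g 2 volume + ENNReal.ofReal (1 / ((k : ℝ) + 1))) := by
    intro k
    refine (eLpNorm_two_kernelConv_schwartz_le K (h k) hB hK).trans ?_
    gcongr
    have e : (h k : V → ℂ) = g - (fun y => g y - h k y) := by ext; simp
    calc eLpNorm (h k) 2 volume = eLpNorm (g - fun y => g y - h k y) 2 volume := by rw [← e]
      _ ≤ eLpNorm g 2 volume + eLpNorm (fun y => g y - h k y) 2 volume :=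
        eLpNorm_sub_le hg.1 (hg.1.sub ((h k).memLp 2 volume).1) (by norm_num)
      _ ≤ _ := by gcongr; exact hh k
  have hlim2 : Filter.Tendsto (fun k : ℕ => ENNReal.ofReal B * (eLpNorm g 2 volume +
      ENNReal.ofReal (1 / ((k : ℝ) + 1)))) Filter.atTop
      (nhds (ENNReal.ofReal B * (eLpNorm g 2 volume + 0))) :=
    ENNReal.Tendsto.const_mul (tendsto_const_nhds.add h0) (Or.inr ENNReal.ofReal_ne_top)
  rw [add_zero] at hlim2
  rw [← hlim2.liminf_eq]
  exact Filter.liminf_le_liminf (.of_forall hb)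

lemma lintegral_kernelConv_le (K : 𝓢(V, ℂ)) {g : V → ℂ} (hg : Measurable g) :
    ∫⁻ x, ‖kernelConv K g x‖ₑ ≤ (∫⁻ x, ‖K x‖ₑ) * ∫⁻ x, ‖g x‖ₑ := by
  have hK := K.continuous.measurable
  calc ∫⁻ x, ‖kernelConv K g x‖ₑ ≤ ∫⁻ x, ∫⁻ y, ‖K (x - y)‖ₑ * ‖g y‖ₑ := by
        refine lintegral_mono fun x => ?_
        refine (enorm_integral_le_lintegral_enorm _).trans_eq ?_
        simp [enorm_mul]
    _ = ∫⁻ y, ∫⁻ x, ‖K (x - y)‖ₑ * ‖g y‖ₑ := by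
        refine lintegral_lintegral_swap (Measurable.aemeasurable ?_)
        fun_prop
    _ = ∫⁻ y, (∫⁻ x, ‖K x‖ₑ) * ‖g y‖ₑ := by
        refine lintegral_congr fun y => ?_
        rw [lintegral_mul_const _ (by fun_prop), lintegral_sub_right_eq_self (fun x => ‖K x‖ₑ) y]
    _ = _ := lintegral_const_mul _ (by fun_prop)

lemma norm_kernelConv_le (K : 𝓢(V, ℂ)) {g : V → ℂ} {a : ℝ} (ha : ∀ᵐ y, ‖g y‖ ≤ a)
    (x : V) : ‖kernelConv K g x‖ ≤ (∫ y, ‖K y‖) * a := by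
  calc ‖kernelConv K g x‖ ≤ ∫ y, ‖K (x - y)‖ * a := by
        refine norm_integral_le_of_norm_le ?_ ?_
        · exact (K.integrable.comp_sub_left x).norm.mul_const a
        · filter_upwards [ha] with y hy
          rw [norm_mul]
          gcongr
    _ = _ := by
        rw [integral_mul_const, integral_sub_left_eq_self (fun y => ‖K y‖)]

end ConvolutionOperator

section BandLimited

variable {V : Type*} [NormedAddCommGroup V] [InnerProductSpace ℝ V] [FiniteDimensional ℝ V]
  [MeasurableSpace V] [BorelSpace V]

/-- Reflection and translation `y ↦ K (x - y)` of a Schwartz function. -/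
def reflectTranslate (K : 𝓢(V, ℂ)) (x : V) : 𝓢(V, ℂ) :=
  SchwartzMap.compCLMOfAntilipschitz (K := 1) ℂ (g := fun y : V => x - y)
    (by fun_prop)
    (fun y z => by rw [edist_sub_left]; simp) K

lemma reflectTranslate_apply (K : 𝓢(V, ℂ)) (x y : V) : reflectTranslate K x y = K (x - y) := rfl

lemma norm_fourierInv_reflectTranslate (K : 𝓢(V, ℂ)) (x ξ : V) :
    ‖𝓕⁻ (reflectTranslate K x : V → ℂ) ξ‖ = ‖𝓕 (K : V → ℂ) ξ‖ := by
  have : 𝓕⁻ (reflectTranslate K x : V → ℂ) ξ = Real.fourierChar (⟪x, ξ⟫_ℝ) • 𝓕 (K : V → ℂ) ξ := by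
    rw [Real.fourierInv_eq, Real.fourier_eq, Circle.smul_def, ← integral_smul,
      ← integral_sub_left_eq_self _ volume x]
    refine integral_congr_ae (.of_forall fun y => ?_)
    simp only [reflectTranslate_apply, sub_sub_cancel, inner_sub_left]
    rw [sub_eq_add_neg, AddChar.map_add_eq_mul, mul_smul, Circle.smul_def (Real.fourierChar ⟪x, ξ⟫_ℝ)]
  rw [this, Circle.norm_smul]

lemma norm_le_volume_mul_integral (h : 𝓢(V, ℂ)) {R : ℝ}
    (hR : ∀ ξ, R < ‖ξ‖ → 𝓕⁻ (h : V → ℂ) ξ = 0) (y : V) :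
    ‖h y‖ₑ ≤ volume (Metric.closedBall (0 : V) R) * ∫⁻ z, ‖h z‖ₑ := by
  have e : h y = 𝓕 (𝓕⁻ h : 𝓢(V, ℂ)) y := by simp
  rw [e, SchwartzMap.fourier_coe, Real.fourier_eq]
  refine (enorm_integral_le_lintegral_enorm _).trans ?_
  calc ∫⁻ ξ, ‖Real.fourierChar (-⟪ξ, y⟫_ℝ) • (𝓕⁻ h : 𝓢(V, ℂ)) ξ‖ₑ
      = ∫⁻ ξ, ‖(𝓕⁻ h : 𝓢(V, ℂ)) ξ‖ₑ := by
        refine lintegral_congr fun ξ => ?_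
        rw [← ofReal_norm, Circle.norm_smul, ofReal_norm]
    _ ≤ ∫⁻ ξ, (Metric.closedBall (0 : V) R).indicator (fun _ => ∫⁻ z, ‖h z‖ₑ) ξ := by
        refine lintegral_mono fun ξ => ?_
        rw [SchwartzMap.fourierInv_coe]
        by_cases hξ : ξ ∈ Metric.closedBall (0 : V) R
        · rw [Set.indicator_of_mem hξ, Real.fourierInv_eq]
          refine (enorm_integral_le_lintegral_enorm _).trans_eq ?_
          refine lintegral_congr fun y => ?_
          rw [← ofReal_norm, Circle.norm_smul, ofReal_norm]
        · rw [hR ξ (by simpa using hξ)]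
          simp
    _ = _ := by
        rw [lintegral_indicator Metric.isClosed_closedBall.measurableSet, setLIntegral_const,
          mul_comm]

lemma fourierInv_mul_eq_zero (h₁ h₂ : 𝓢(V, ℂ)) {R : ℝ}
    (h₁R : ∀ ξ, R < ‖ξ‖ → 𝓕⁻ (h₁ : V → ℂ) ξ = 0) (h₂R : ∀ ξ, R < ‖ξ‖ → 𝓕⁻ (h₂ : V → ℂ) ξ = 0)
    {ξ : V} (hξ : 2 * R < ‖ξ‖) :
    𝓕⁻ (SchwartzMap.pairing (ContinuousLinearMap.mul ℂ ℂ) h₁ h₂ : V → ℂ) ξ = 0 := by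
  have e : SchwartzMap.pairing (ContinuousLinearMap.mul ℂ ℂ) h₁ h₂ =
      𝓕 (SchwartzMap.convolution (ContinuousLinearMap.mul ℂ ℂ) (𝓕⁻ h₁) (𝓕⁻ h₂)) := by
    rw [SchwartzMap.fourier_convolution]
    simp
  rw [← SchwartzMap.fourierInv_coe, e, FourierTransform.fourierInv_fourier_eq,
    SchwartzMap.convolution_apply, convolution]
  refine integral_eq_zero_of_ae (.of_forall fun t => ?_)
  simp only [ContinuousLinearMap.mul_apply', Pi.zero_apply, mul_eq_zero, SchwartzMap.fourierInv_coe]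
  by_cases ht : R < ‖t‖
  · exact Or.inl (h₁R t ht)
  · refine Or.inr (h₂R _ ?_)
    have := norm_sub_norm_le ξ t
    linarith

lemma lintegral_rpow_le_of_enorm_le {α : Type*} [MeasurableSpace α] {μ : Measure α} {h : α → ℂ}
    (hI : ∫⁻ z, ‖h z‖ₑ ∂μ ≠ ∞) {M : ℝ≥0∞} (hM : ∀ y, ‖h y‖ₑ ≤ M * ∫⁻ z, ‖h z‖ₑ ∂μ) (hMtop : M ≠ ∞)
    {p : ℝ} (hp : 0 < p) (hp1 : p ≤ 1) :
    (∫⁻ z, ‖h z‖ₑ ∂μ) ^ p ≤ M ^ (1 - p) * ∫⁻ z, ‖h z‖ₑ ^ p ∂μ := by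
  set I := ∫⁻ z, ‖h z‖ₑ ∂μ with hIdef
  by_cases hI0 : I = 0
  · rw [hI0, ENNReal.zero_rpow_of_pos hp]
    exact bot_le
  have h1 : I ≤ (M * I) ^ (1 - p) * ∫⁻ z, ‖h z‖ₑ ^ p ∂μ := by
    rw [← lintegral_const_mul' _ _ (ENNReal.rpow_ne_top_of_nonneg (by linarith)
      (ENNReal.mul_ne_top hMtop hI)), hIdef]
    refine lintegral_mono fun z => ?_
    calc ‖h z‖ₑ = ‖h z‖ₑ ^ (1 - p) * ‖h z‖ₑ ^ p := by
          rw [← ENNReal.rpow_add_of_nonneg _ _ (by linarith) hp.le]; simp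
      _ ≤ _ := by
          gcongr
          exact hM z
  have h2 : I ^ (1 - p) ≠ 0 := by
    simp [ENNReal.rpow_eq_zero_iff, hI0, hI]
  have h3 : I ^ (1 - p) ≠ ∞ := ENNReal.rpow_ne_top_of_nonneg (by linarith) hI
  rw [← ENNReal.mul_le_mul_iff_right h2 h3]
  calc I ^ (1 - p) * I ^ p = I := by
        rw [← ENNReal.rpow_add_of_nonneg _ _ (by linarith) hp.le]; simp
    _ ≤ _ := h1
    _ = _ := by rw [ENNReal.mul_rpow_of_nonneg _ _ (by linarith)]; ring

/-- Band-limited convolution estimate in `L^p`, `0 < p ≤ 1`. -/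
lemma lintegral_rpow_kernelConv_le (K g : 𝓢(V, ℂ)) {R : ℝ}
    (hK : ∀ ξ, R < ‖ξ‖ → 𝓕 (K : V → ℂ) ξ = 0) (hg : ∀ ξ, R < ‖ξ‖ → 𝓕 (g : V → ℂ) ξ = 0)
    {p : ℝ} (hp : 0 < p) (hp1 : p ≤ 1) :
    ∫⁻ x, ‖kernelConv K g x‖ₑ ^ p ≤ volume (Metric.closedBall (0 : V) (2 * R)) ^ (1 - p) *
      ((∫⁻ x, ‖K x‖ₑ ^ p) * ∫⁻ x, ‖g x‖ₑ ^ p) := by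
  have hKm := K.continuous.measurable
  have hgm := g.continuous.measurable
  have hg' : ∀ ξ, R < ‖ξ‖ → 𝓕⁻ (g : V → ℂ) ξ = 0 := fun ξ hξ => by
    rw [Real.fourierInv_eq_fourier_neg]
    exact hg _ (by simpa using hξ)
  have hpt : ∀ x, ‖kernelConv K g x‖ₑ ^ p ≤ volume (Metric.closedBall (0 : V) (2 * R)) ^ (1 - p) *
      ∫⁻ y, ‖K (x - y)‖ₑ ^ p * ‖g y‖ₑ ^ p := by
    intro x
    set h := SchwartzMap.pairing (ContinuousLinearMap.mul ℂ ℂ) (reflectTranslate K x) g with hh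
    have hy : ∀ y, h y = K (x - y) * g y := fun y => by
      rw [hh, SchwartzMap.pairing_apply_apply]; rfl
    have hR : ∀ ξ, 2 * R < ‖ξ‖ → 𝓕⁻ (h : V → ℂ) ξ = 0 := fun ξ hξ =>
      fourierInv_mul_eq_zero _ _ (fun ξ hξ => by
        rw [← norm_eq_zero, norm_fourierInv_reflectTranslate, hK ξ hξ, norm_zero]) hg' hξ
    have := lintegral_rpow_le_of_enorm_le (μ := volume) (h := h) h.integrable.2.ne
      (norm_le_volume_mul_integral h hR) measure_closedBall_lt_top.ne hp hp1
    simp only [hy] at this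
    simp only [enorm_mul, ENNReal.mul_rpow_of_nonneg _ _ hp.le] at this
    refine le_trans ?_ this
    gcongr
    refine (enorm_integral_le_lintegral_enorm _).trans_eq ?_
    simp [enorm_mul]
  refine (lintegral_mono hpt).trans ?_
  rw [lintegral_const_mul' _ _ (ENNReal.rpow_ne_top_of_nonneg (by linarith)
    measure_closedBall_lt_top.ne)]
  gcongr
  refine le_of_eq ?_
  rw [lintegral_lintegral_swap (Measurable.aemeasurable (by fun_prop))]
  rw [← lintegral_const_mul _ (by fun_prop)]
  refine lintegral_congr fun y => ?_
  rw [lintegral_mul_const _ (by fun_prop), lintegral_sub_right_eq_self (fun x => ‖K x‖ₑ ^ p) y]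

end BandLimited

section KernelBound

variable {V : Type*} [NormedAddCommGroup V] [InnerProductSpace ℝ V] [FiniteDimensional ℝ V]
  [MeasurableSpace V] [BorelSpace V]

lemma eLpNorm_le_of_lintegral_rpow_le {α : Type*} [MeasurableSpace α] {μ : Measure α}
    {f g : α → ℂ} {p : ℝ≥0∞} (hp0 : p ≠ 0) (hp : p ≠ ∞) {c : ℝ≥0∞}
    (h : ∫⁻ x, ‖f x‖ₑ ^ p.toReal ∂μ ≤ c * ∫⁻ x, ‖g x‖ₑ ^ p.toReal ∂μ) :
    eLpNorm f p μ ≤ c ^ (1 / p.toReal) * eLpNorm g p μ := by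
  have hp' : 0 ≤ 1 / p.toReal := by positivity
  rw [eLpNorm_eq_lintegral_rpow_enorm_toReal hp0 hp, eLpNorm_eq_lintegral_rpow_enorm_toReal hp0 hp,
    ← ENNReal.mul_rpow_of_nonneg _ _ hp']
  gcongr

/-- Band-limited convolution estimate in `L^p`, `0 < p ≤ 1`. -/
lemma eLpNorm_kernelConv_le_of_le_one (K g : 𝓢(V, ℂ)) {R : ℝ}
    (hK : ∀ ξ, R < ‖ξ‖ → 𝓕 (K : V → ℂ) ξ = 0) (hg : ∀ ξ, R < ‖ξ‖ → 𝓕 (g : V → ℂ) ξ = 0)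
    {p : ℝ≥0∞} (hp : p ≠ 0) (hp1 : p ≤ 1) :
    eLpNorm (kernelConv K g) p volume ≤
      volume (Metric.closedBall (0 : V) (2 * R)) ^ ((1 - p.toReal) / p.toReal) *
        eLpNorm K p volume * eLpNorm g p volume := by
  have hpt : p ≠ ∞ := (hp1.trans_lt ENNReal.one_lt_top).ne
  have hp0 : 0 < p.toReal := ENNReal.toReal_pos hp hpt
  have h := lintegral_rpow_kernelConv_le K g hK hg hp0
    (by simpa using ENNReal.toReal_mono ENNReal.one_ne_top hp1)
  rw [← mul_assoc] at h
  refine (eLpNorm_le_of_lintegral_rpow_le hp hpt h).trans_eq ?_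
  rw [ENNReal.mul_rpow_of_nonneg _ _ (by positivity), ← ENNReal.rpow_mul,
    eLpNorm_eq_lintegral_rpow_enorm_toReal hp hpt (f := K), mul_one_div]

lemma lintegral_indicator_enorm {α : Type*} [MeasurableSpace α] {μ : Measure α} {g : α → ℂ}
    {S : Set α} (hS : MeasurableSet S) {k : ℕ} (hk : k ≠ 0) :
    ∫⁻ x, ‖S.indicator g x‖ₑ ^ k ∂μ = ∫⁻ x in S, ‖g x‖ₑ ^ k ∂μ := by
  rw [← lintegral_indicator hS]
  refine lintegral_congr fun x => ?_
  by_cases hx : x ∈ S <;> simp [hx, hk]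

lemma lintegral_sq_kernelConv_le (K g : 𝓢(V, ℂ)) {B : ℝ}
    (hB : 0 ≤ B) (hK : ∀ ξ, ‖𝓕 (K : V → ℂ) ξ‖ ≤ B) {S : Set V} (hS : MeasurableSet S) :
    ∫⁻ x, ‖kernelConv K (S.indicator g) x‖ₑ ^ 2 ≤
      ENNReal.ofReal (B ^ 2) * ∫⁻ x in S, ‖g x‖ₑ ^ 2 := by
  have h := eLpNorm_two_kernelConv_le K ((g.memLp 2 volume).indicator hS) hB hK
  have h2 := pow_le_pow_left₀ bot_le h 2
  rw [mul_pow, eLpNorm_two_sq, eLpNorm_two_sq, lintegral_indicator_enorm hS two_ne_zero,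
    ← ENNReal.ofReal_pow hB] at h2
  exact h2

lemma norm_kernelConv_le_add_compl (K g : 𝓢(V, ℂ)) {S : Set V} (hS : MeasurableSet S) (x : V) :
    ‖kernelConv K g x‖ ≤
      ‖kernelConv K (S.indicator g) x‖ + ‖kernelConv K (Sᶜ.indicator g) x‖ := by
  refine le_trans (le_of_eq ?_) (norm_add_le _ _)
  have hi : ∀ T : Set V, MeasurableSet T →
      Integrable (fun y => K (x - y) * T.indicator g y) := fun T hT => by
    refine ⟨((K.continuous.comp (by fun_prop)).aestronglyMeasurable).mul
      (g.continuous.aestronglyMeasurable.indicator hT), ?_⟩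
    exact (lintegral_kernel_mul_le K (g.continuous.aestronglyMeasurable.indicator hT) x).trans_lt
      (ENNReal.mul_lt_top (K.memLp 2 volume).2 ((g.memLp 2 volume).indicator hT).2)
  rw [kernelConv, kernelConv, kernelConv, ← integral_add (hi S hS) (hi _ hS.compl)]
  congr 1
  refine integral_congr_ae (.of_forall fun y => ?_)
  simp only [← mul_add, Set.indicator_self_add_compl_apply]

/-- Convolution with a kernel whose `L^1` norm is at most `A` and whose Fourier transform is
bounded by `B`: the operator norm on `L^p` is `O(A^{|2/p - 1|})`. -/
lemma exists_eLpNorm_kernelConv_le {p : ℝ≥0∞} (hp : 1 ≤ p) {B : ℝ} (hB : 0 ≤ B) :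
    ∃ C : ℝ, ∀ A : ℝ, 0 < A → ∀ K g : 𝓢(V, ℂ),
      eLpNorm K 1 volume ≤ ENNReal.ofReal A → (∀ ξ, ‖𝓕 (K : V → ℂ) ξ‖ ≤ B) →
      eLpNorm (kernelConv K g) p volume ≤
        ENNReal.ofReal (C * A ^ |2 * p⁻¹.toReal - 1|) * eLpNorm g p volume := by
  rcases eq_or_ne p ∞ with rfl | hpt
  · refine ⟨1, fun A hA K g hK _ => ?_⟩
    have hK1 : ∫ y, ‖K y‖ ≤ A := by
      rw [eLpNorm_one_eq_lintegral_enorm] at hK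
      rw [integral_norm_eq_lintegral_enorm K.integrable.1]
      exact ENNReal.toReal_le_of_le_ofReal hA.le hK
    have hgt : eLpNorm g ∞ volume ≠ ∞ := (g.memLp ∞ volume).2.ne
    have hae : ∀ᵐ y, ‖g y‖ ≤ (eLpNorm g ∞ volume).toReal := by
      filter_upwards [ae_le_eLpNormEssSup (f := (g : V → ℂ)) (μ := volume)] with y hy
      rw [← toReal_enorm]
      exact ENNReal.toReal_mono hgt (by rwa [eLpNorm_exponent_top])
    have := eLpNormEssSup_le_of_ae_bound (μ := volume) (f := kernelConv K g)
      (C := A * (eLpNorm g ∞ volume).toReal) (.of_forall fun x =>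
        (norm_kernelConv_le K hae x).trans (by gcongr))
    rw [← eLpNorm_exponent_top, ENNReal.ofReal_mul hA.le, ENNReal.ofReal_toReal hgt] at this
    simpa using this
  have hp0 : p ≠ 0 := (zero_lt_one.trans_le hp).ne'
  set r := p.toReal with hr
  have hr1 : 1 ≤ r := by simpa using ENNReal.toReal_mono hpt hp
  have hr0 : 0 < r := by linarith
  have hrinv : p⁻¹.toReal = r⁻¹ := ENNReal.toReal_inv p
  have hS : ∀ (g : 𝓢(V, ℂ)) (a : ℝ), MeasurableSet {x | a < ‖g x‖} := fun g a =>
    measurableSet_lt measurable_const g.continuous.norm.measurable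
  have hSc : ∀ (g : 𝓢(V, ℂ)) (a : ℝ), {x | a < ‖g x‖}ᶜ = {x | ‖g x‖ ≤ a} := fun g a => by
    ext x; simp
  have hm : ∀ (K g : 𝓢(V, ℂ)) (S : Set V), MeasurableSet S →
      AEStronglyMeasurable (kernelConv K (S.indicator g)) volume := fun K g S hS =>
    (measurable_kernelConv K.continuous.measurable
      (g.continuous.measurable.indicator hS)).aestronglyMeasurable
  have hm' : ∀ (K g : 𝓢(V, ℂ)), AEStronglyMeasurable (kernelConv K g) volume := fun K g =>
    (measurable_kernelConv K.continuous.measurable g.continuous.measurable).aestronglyMeasurable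
  have hL1 : ∀ (A : ℝ) (K g : 𝓢(V, ℂ)) (S : Set V), MeasurableSet S →
      eLpNorm K 1 volume ≤ ENNReal.ofReal A →
      ∫⁻ x, ‖kernelConv K (S.indicator g) x‖ₑ ≤ ENNReal.ofReal A * ∫⁻ x in S, ‖g x‖ₑ := by
    intro A K g S hS hK
    refine (lintegral_kernelConv_le K (g.continuous.measurable.indicator hS)).trans ?_
    rw [eLpNorm_one_eq_lintegral_enorm] at hK
    have := lintegral_indicator_enorm (μ := volume) (g := g) hS one_ne_zero
    simp only [pow_one] at this
    rw [this]
    gcongr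
  have hconv : ∀ {A c e : ℝ}, 0 < A → 0 ≤ c → (ENNReal.ofReal (c * A ^ e)) ^ (1 / r) =
      ENNReal.ofReal (c ^ (1 / r) * A ^ (e / r)) := by
    intro A c e hA hc
    rw [ENNReal.ofReal_rpow_of_nonneg (by positivity) (by positivity),
      Real.mul_rpow hc (by positivity), ← Real.rpow_mul hA.le, mul_one_div]
  rcases lt_trichotomy r 2 with h2 | h2 | h2
  · rcases hr1.eq_or_lt with h1 | h1
    · refine ⟨1, fun A hA K g hK _ => ?_⟩
      have hp1 : p = 1 := by
        rw [← ENNReal.toReal_eq_one_iff]; exact h1.symm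
      have := hL1 A K g Set.univ MeasurableSet.univ hK
      rw [hrinv, ← h1, hp1, eLpNorm_one_eq_lintegral_enorm, eLpNorm_one_eq_lintegral_enorm]
      norm_num
      simpa using this
    · refine ⟨(r * (2 / (r - 1) + 4 * B ^ 2 / (2 - r))) ^ (1 / r), fun A hA K g hK hKB => ?_⟩
      have := lintegral_rpow_le_of_truncation_lt_two (μ := volume) (B := B ^ 2) h1 h2
        (by positivity) hA (hm' K g) g.continuous.measurable
        (fun a => hm K g {x | a < ‖g x‖} (hS g a)) (fun a => hm K g {x | a < ‖g x‖}ᶜ (hS g a).compl)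
        (fun a _ x => norm_kernelConv_le_add_compl K g (hS g a) x)
        (fun a _ => hL1 A K g _ (hS g a) hK)
        (fun a _ => by rw [← hSc]; exact lintegral_sq_kernelConv_le K g hB hKB (hS g a).compl)
      refine (eLpNorm_le_of_lintegral_rpow_le hp0 hpt this).trans_eq ?_
      have hc : 0 ≤ r * (2 / (r - 1) + 4 * B ^ 2 / (2 - r)) := by
        have : 0 < r - 1 := by linarith
        have : 0 < 2 - r := by linarith
        positivity
      rw [← hr, hconv hA hc, hrinv]
      congr 4
      rw [abs_of_nonneg]
      · field_simp
      · rw [← div_eq_mul_inv, sub_nonneg, le_div_iff₀ hr0]; linarith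
  · refine ⟨B, fun A hA K g hK hKB => ?_⟩
    have hp2 : p = 2 := by
      rw [← ENNReal.toReal_eq_toReal_iff' hpt (by simp)]; simpa using h2
    rw [hrinv, h2, hp2]
    norm_num
    exact eLpNorm_two_kernelConv_le K (g.memLp 2 volume) hB hKB
  · refine ⟨(r * (4 * B ^ 2 * 2 ^ (r - 2) / (r - 2))) ^ (1 / r), fun A hA K g hK hKB => ?_⟩
    have hK1 : ∫ y, ‖K y‖ ≤ A := by
      rw [eLpNorm_one_eq_lintegral_enorm] at hK
      rw [integral_norm_eq_lintegral_enorm K.integrable.1]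
      exact ENNReal.toReal_le_of_le_ofReal hA.le hK
    have := lintegral_rpow_le_of_truncation_two_lt (μ := volume) (B := B ^ 2) h2
      (by positivity) hA (hm' K g) g.continuous.measurable
      (fun a => hm K g {x | a < ‖g x‖} (hS g a)) (V := fun a => kernelConv K
        ({x | a < ‖g x‖}ᶜ.indicator g))
      (fun a _ x => norm_kernelConv_le_add_compl K g (hS g a) x)
      (fun a _ => lintegral_sq_kernelConv_le K g hB hKB (hS g a))
      (fun a ha x => by
        refine (norm_kernelConv_le K (a := a) (.of_forall fun y => ?_) x).trans (by gcongr)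
        by_cases hy : a < ‖g y‖
        · simp [Set.indicator, hy, ha.le]
        · simp [Set.indicator, hy, not_lt.1 hy])
    refine (eLpNorm_le_of_lintegral_rpow_le hp0 hpt this).trans_eq ?_
    have hc : 0 ≤ r * (4 * B ^ 2 * 2 ^ (r - 2) / (r - 2)) := by
      have : 0 < r - 2 := by linarith
      positivity
    rw [← hr, hconv hA hc, hrinv]
    congr 4
    rw [abs_of_nonpos]
    · field_simp; ring
    · rw [← div_eq_mul_inv, sub_nonpos, div_le_iff₀ hr0]; linarith

end KernelBound

section TestFunctions

variable {V : Type*} [NormedAddCommGroup V] [InnerProductSpace ℝ V]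

/-- Smooth compactly supported functions with support in `U`. -/
structure IsTestOn (U : Set V) (a : V → ℂ) : Prop where
  contDiff : ContDiff ℝ (⊤ : ℕ∞) a
  compact : HasCompactSupport a
  tsupport_subset : tsupport a ⊆ U

/-- Directional derivative. -/
def dirD (v : V) (a : V → ℂ) (ξ : V) : ℂ := fderiv ℝ a ξ v

lemma IsTestOn.mul {U : Set V} (hU : IsOpen U) {F : V → ℂ} (hF : ContDiffOn ℝ (⊤ : ℕ∞) F U)
    {a : V → ℂ} (ha : IsTestOn U a) : IsTestOn U (fun ξ => F ξ * a ξ) := by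
  have hsub : tsupport (fun ξ => F ξ * a ξ) ⊆ tsupport a :=
    closure_mono fun ξ hξ => right_ne_zero_of_mul hξ
  refine ⟨contDiff_iff_contDiffAt.2 fun ξ => ?_, ha.compact.mul_left, hsub.trans ha.tsupport_subset⟩
  by_cases hξ : ξ ∈ tsupport a
  · exact (hF.contDiffAt (hU.mem_nhds (ha.tsupport_subset hξ))).mul ha.contDiff.contDiffAt
  · have h0 : (fun ξ => F ξ * a ξ) =ᶠ[nhds ξ] fun _ => 0 := by
      have := notMem_tsupport_iff_eventuallyEq.1 hξ
      filter_upwards [this] with y hy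
      simp [hy]
    exact contDiffAt_const.congr_of_eventuallyEq h0

lemma IsTestOn.dirD {U : Set V} {a : V → ℂ} (ha : IsTestOn U a) (v : V) :
    IsTestOn U (dirD v a) := by
  have hsub : tsupport (_root_.dirD v a) ⊆ tsupport a := by
    refine (closure_mono fun ξ hξ => ?_).trans (tsupport_fderiv_subset ℝ (f := a))
    intro h
    exact hξ (by simp [_root_.dirD, h])
  refine ⟨?_, ha.compact.mono' (subset_closure.trans hsub), hsub.trans ha.tsupport_subset⟩
  exact (ha.contDiff.fderiv_right (m := (⊤ : ℕ∞)) (by simp)).clm_apply contDiff_const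

lemma IsTestOn.add {U : Set V} {a b : V → ℂ} (ha : IsTestOn U a) (hb : IsTestOn U b) :
    IsTestOn U (fun ξ => a ξ + b ξ) := by
  refine ⟨ha.contDiff.add hb.contDiff, ha.compact.add hb.compact, ?_⟩
  exact (tsupport_add a b).trans (Set.union_subset ha.tsupport_subset hb.tsupport_subset)

lemma IsTestOn.zero (U : Set V) : IsTestOn U (fun _ => 0) :=
  ⟨contDiff_const, HasCompactSupport.zero, by simp [tsupport]⟩

lemma IsTestOn.sum {U : Set V} {ι : Type*} (s : Finset ι) {a : ι → V → ℂ}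
    (ha : ∀ i, IsTestOn U (a i)) : IsTestOn U (fun ξ => ∑ i ∈ s, a i ξ) := by
  classical
  induction s using Finset.induction_on with
  | empty => simpa using IsTestOn.zero U
  | insert i s hi ih =>
    simp only [Finset.sum_insert hi]
    exact (ha i).add ih

lemma dirD_comp_mul {U : Set V} (hU : IsOpen U) {φ : V → ℝ} (hφ : ContDiffOn ℝ (⊤ : ℕ∞) φ U)
    {c : ℝ → ℂ} (hc : ContDiff ℝ (⊤ : ℕ∞) c) {a : V → ℂ} (ha : IsTestOn U a) (κ : ℝ) (v ξ : V) :
    dirD v (fun η => c (κ * φ η) * a η) ξ =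
      c (κ * φ ξ) * dirD v a ξ + κ * (deriv c (κ * φ ξ) * ((fderiv ℝ φ ξ v : ℝ) * a ξ)) := by
  by_cases hξ : ξ ∈ tsupport a
  · have hφ1 : HasFDerivAt φ (fderiv ℝ φ ξ) ξ :=
      ((hφ.contDiffAt (hU.mem_nhds (ha.tsupport_subset hξ))).differentiableAt
        (by simp)).hasFDerivAt
    have ha1 : HasFDerivAt a (fderiv ℝ a ξ) ξ :=
      (ha.contDiff.contDiffAt.differentiableAt (by simp)).hasFDerivAt
    have hc1 : HasDerivAt c (deriv c (κ * φ ξ)) (κ * φ ξ) :=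
      (hc.contDiffAt.differentiableAt (by simp)).hasDerivAt
    have h2 := (hc1.hasFDerivAt.comp ξ (hφ1.const_mul κ)).mul ha1
    have h3 : HasFDerivAt (fun η => c (κ * φ η) * a η) _ ξ := h2
    rw [dirD, h3.fderiv]
    simp [dirD]
    ring
  · have h0 := notMem_tsupport_iff_eventuallyEq.1 hξ
    have h1 : (fun η => c (κ * φ η) * a η) =ᶠ[nhds ξ] fun _ => 0 := by
      filter_upwards [h0] with y hy
      simp [hy]
    rw [dirD, dirD, h1.fderiv_eq, h0.fderiv_eq, h0.eq_of_nhds]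
    simp

lemma IsTestOn.comp_mul {U : Set V} (hU : IsOpen U) {φ : V → ℝ} (hφ : ContDiffOn ℝ (⊤ : ℕ∞) φ U)
    {c : ℝ → ℂ} (hc : ContDiff ℝ (⊤ : ℕ∞) c) {a : V → ℂ} (ha : IsTestOn U a) (κ : ℝ) :
    IsTestOn U (fun η => c (κ * φ η) * a η) :=
  ha.mul hU (hc.comp_contDiffOn (contDiffOn_const.mul hφ))

end TestFunctions

section OscillatoryKernel

variable {V : Type*} [NormedAddCommGroup V] [InnerProductSpace ℝ V] [FiniteDimensional ℝ V]
  [MeasurableSpace V] [BorelSpace V]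

lemma IsTestOn.integrable {U : Set V} {a : V → ℂ} (ha : IsTestOn U a) : Integrable a :=
  ha.contDiff.continuous.integrable_of_hasCompactSupport ha.compact

lemma IsTestOn.fourierInv_dirD {U : Set V} {a : V → ℂ} (ha : IsTestOn U a) (v x : V) :
    𝓕⁻ (_root_.dirD v a) x = -(2 * Real.pi * I * (⟪x, v⟫_ℝ : ℝ)) * 𝓕⁻ a x := by
  set s := ha.compact.toSchwartzMap ha.contDiff with hs
  have h := DFunLike.congr_fun (SchwartzMap.fourierInv_lineDerivOp_eq s v) x
  rw [SchwartzMap.fourierInv_coe] at h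
  have e1 : ((LineDeriv.lineDerivOp v s : 𝓢(V, ℂ)) : V → ℂ) = _root_.dirD v a := rfl
  have e2 : (s : V → ℂ) = a := rfl
  rw [e1] at h
  rw [h, smul_apply, SchwartzMap.smulLeftCLM_apply_apply (by fun_prop),
    SchwartzMap.fourierInv_coe, e2]
  simp
  ring

lemma IsTestOn.eLpNorm_fourierInv {U : Set V} {a : V → ℂ} (ha : IsTestOn U a) :
    eLpNorm (𝓕⁻ a) 2 volume = eLpNorm a 2 volume := by
  have h := eLpNorm_fourier_schwartz (𝓕⁻ (ha.compact.toSchwartzMap ha.contDiff))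
  rw [FourierTransform.fourier_fourierInv_eq, SchwartzMap.fourierInv_coe] at h
  exact h.symm

/-- The kernel `𝓕⁻ (c(κ φ) a)`. -/
def oscKernel (c : ℝ → ℂ) (φ : V → ℝ) (κ : ℝ) (a : V → ℂ) : V → ℂ :=
  𝓕⁻ (fun η => c (κ * φ η) * a η)

lemma exists_oscKernel_laplacian {U : Set V} (hU : IsOpen U) {φ : V → ℝ}
    (hφ : ContDiffOn ℝ (⊤ : ℕ∞) φ U) {a : V → ℂ} (ha : IsTestOn U a) :
    ∃ a₀ a₁ : V → ℂ, IsTestOn U a₀ ∧ IsTestOn U a₁ ∧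
      ∀ c : ℝ → ℂ, ContDiff ℝ (⊤ : ℕ∞) c → ∀ (κ : ℝ) (x : V),
      (((2 * Real.pi * ‖x‖) ^ 2 : ℝ) : ℂ) * oscKernel c φ κ a x =
        -(oscKernel c φ κ a₀ x + κ * oscKernel (deriv c) φ κ a₁ x +
          κ ^ 2 * oscKernel (deriv (deriv c)) φ κ
            (fun ξ => ((‖fderiv ℝ φ ξ‖ ^ 2 : ℝ) : ℂ) * a ξ) x) := by
  set b := stdOrthonormalBasis ℝ V with hb
  set D : Fin (Module.finrank ℝ V) → V → ℂ := fun i ξ => ((fderiv ℝ φ ξ (b i) : ℝ) : ℂ) with hD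
  have hDs : ∀ i, ContDiffOn ℝ (⊤ : ℕ∞) (D i) U := fun i => by
    refine Complex.ofRealCLM.contDiff.comp_contDiffOn ?_
    exact (hφ.fderiv_of_isOpen hU (m := (⊤ : ℕ∞)) (by simp)).clm_apply contDiffOn_const
  have hDa : ∀ i, IsTestOn U (fun ξ => D i ξ * a ξ) := fun i => ha.mul hU (hDs i)
  have hDda : ∀ i, IsTestOn U (fun ξ => D i ξ * dirD (b i) a ξ) := fun i =>
    (ha.dirD _).mul hU (hDs i)
  have hDDa : ∀ i, IsTestOn U (fun ξ => D i ξ * (D i ξ * a ξ)) := fun i => (hDa i).mul hU (hDs i)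
  set p₀ : Fin (Module.finrank ℝ V) → V → ℂ := fun i => dirD (b i) (dirD (b i) a) with hp₀
  set p₁ : Fin (Module.finrank ℝ V) → V → ℂ := fun i ξ =>
    D i ξ * dirD (b i) a ξ + dirD (b i) (fun ξ => D i ξ * a ξ) ξ with hp₁
  have h₀ : ∀ i, IsTestOn U (p₀ i) := fun i => (ha.dirD _).dirD _
  have h₁ : ∀ i, IsTestOn U (p₁ i) := fun i => (hDda i).add ((hDa i).dirD _)
  refine ⟨fun ξ => ∑ i, p₀ i ξ, fun ξ => ∑ i, p₁ i ξ, IsTestOn.sum _ h₀, IsTestOn.sum _ h₁, ?_⟩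
  intro c hc κ x
  have hc' : ContDiff ℝ (⊤ : ℕ∞) (deriv c) := by
    exact (contDiff_infty_iff_deriv.1 hc).2
  have hc'' : ContDiff ℝ (⊤ : ℕ∞) (deriv (deriv c)) := (contDiff_infty_iff_deriv.1 hc').2
  have hi : ∀ {e : ℝ → ℂ}, ContDiff ℝ (⊤ : ℕ∞) e → ∀ {f : V → ℂ}, IsTestOn U f →
      IsTestOn U (fun η => e (κ * φ η) * f η) := fun he _ hf => hf.comp_mul hU hφ he κ
  have hInt : ∀ {f : V → ℂ}, IsTestOn U f → Integrable (fun ξ => Real.fourierChar ⟪ξ, x⟫_ℝ • f ξ) :=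
    fun hf => by
      have := (Real.fourierIntegral_convergent_iff (μ := volume) (f := _) (-x)).2 hf.integrable
      simpa using this
  have hsumK : ∀ {e : ℝ → ℂ}, ContDiff ℝ (⊤ : ℕ∞) e → ∀ {f : Fin (Module.finrank ℝ V) → V → ℂ},
      (∀ i, IsTestOn U (f i)) → oscKernel e φ κ (fun ξ => ∑ i, f i ξ) x =
        ∑ i, oscKernel e φ κ (f i) x := by
    intro e he f hf
    simp only [oscKernel, Real.fourierInv_eq]
    rw [← integral_finsetSum _ fun i _ => hInt (hi he (hf i))]
    refine integral_congr_ae (.of_forall fun ξ => ?_)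
    simp only [Finset.mul_sum, Finset.smul_sum]
  have hA2 : (fun ξ => ((‖fderiv ℝ φ ξ‖ ^ 2 : ℝ) : ℂ) * a ξ) =
      fun ξ => ∑ i, D i ξ * (D i ξ * a ξ) := by
    ext ξ
    have h := b.sum_sq_norm_inner_right ((InnerProductSpace.toDual ℝ V).symm (fderiv ℝ φ ξ))
    simp only [LinearIsometryEquiv.norm_map] at h
    rw [← h]
    push_cast
    rw [Finset.sum_mul]
    refine Finset.sum_congr rfl fun i _ => ?_
    rw [real_inner_comm, InnerProductSpace.toDual_symm_apply, hD]
    simp only [Real.norm_eq_abs]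
    rw [← mul_assoc, ← sq]
    congr 1
    norm_cast
    exact sq_abs _
  have hcoord : ∀ i, (((2 * Real.pi * ⟪x, b i⟫_ℝ) ^ 2 : ℝ) : ℂ) * oscKernel c φ κ a x =
      -(oscKernel c φ κ (p₀ i) x + κ * oscKernel (deriv c) φ κ (p₁ i) x +
        κ ^ 2 * oscKernel (deriv (deriv c)) φ κ (fun ξ => D i ξ * (D i ξ * a ξ)) x) := by
    intro i
    have hF := hi hc ha
    have e1 := (hF.dirD (b i)).fourierInv_dirD (b i) x
    rw [hF.fourierInv_dirD] at e1
    have e2 : dirD (b i) (dirD (b i) (fun η => c (κ * φ η) * a η)) = fun ξ =>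
        c (κ * φ ξ) * p₀ i ξ + (κ * (deriv c (κ * φ ξ) * p₁ i ξ) +
          κ ^ 2 * (deriv (deriv c) (κ * φ ξ) * (D i ξ * (D i ξ * a ξ)))) := by
      have e3 : dirD (b i) (fun η => c (κ * φ η) * a η) = fun ξ =>
          c (κ * φ ξ) * dirD (b i) a ξ + κ * (deriv c (κ * φ ξ) * (D i ξ * a ξ)) := by
        ext ξ
        exact dirD_comp_mul hU hφ hc ha κ (b i) ξ
      ext ξ
      have d1 := (hi hc (ha.dirD (b i))).contDiff.contDiffAt (x := ξ) |>.differentiableAt (by simp)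
      have d2 := (hi hc' (hDa i)).contDiff.contDiffAt (x := ξ) |>.differentiableAt (by simp)
      have e4 := dirD_comp_mul hU hφ hc (ha.dirD (b i)) κ (b i) ξ
      have e5 := dirD_comp_mul hU hφ hc' (hDa i) κ (b i) ξ
      rw [dirD] at e4 e5
      rw [e3, dirD, fderiv_fun_add d1 (d2.const_mul _), fderiv_const_mul d2]
      simp only [add_apply, smul_apply, e4, e5, smul_eq_mul, hp₀, hp₁]
      ring
    have e6 : 𝓕⁻ (dirD (b i) (dirD (b i) (fun η => c (κ * φ η) * a η))) x =
        oscKernel c φ κ (p₀ i) x + (κ * oscKernel (deriv c) φ κ (p₁ i) x +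
        κ ^ 2 * oscKernel (deriv (deriv c)) φ κ (fun ξ => D i ξ * (D i ξ * a ξ)) x) := by
      rw [e2]
      simp only [oscKernel, Real.fourierInv_eq]
      have i0 := hInt (hi hc (h₀ i))
      have i1 := (hInt (hi hc' (h₁ i))).const_mul (κ : ℂ)
      have i2 := (hInt (hi hc'' (hDDa i))).const_mul ((κ : ℂ) ^ 2)
      rw [← integral_const_mul, ← integral_const_mul, ← integral_add i1 i2]
      refine Eq.trans ?_ (integral_add i0 (i1.add i2))
      refine integral_congr_ae (.of_forall fun ξ => ?_)
      simp only [Circle.smul_def, smul_eq_mul]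
      ring
    rw [e1] at e6
    rw [add_assoc, ← e6, oscKernel]
    push_cast
    linear_combination (4 * (Real.pi : ℂ) ^ 2 * (⟪x, b i⟫_ℝ : ℂ) ^ 2 *
      𝓕⁻ (fun η => c (κ * φ η) * a η) x) * I_sq
  have hnorm : (2 * Real.pi * ‖x‖) ^ 2 = ∑ i, (2 * Real.pi * ⟪x, b i⟫_ℝ) ^ 2 := by
    rw [mul_pow, ← b.sum_sq_norm_inner_left x, Finset.mul_sum]
    refine Finset.sum_congr rfl fun i _ => ?_
    rw [Real.norm_eq_abs, sq_abs]
    ring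
  rw [hA2, hsumK hc h₀, hsumK hc' h₁, hsumK hc'' hDDa, hnorm, ofReal_sum, Finset.sum_mul,
    Finset.mul_sum, Finset.mul_sum, ← Finset.sum_add_distrib, ← Finset.sum_add_distrib,
    ← Finset.sum_neg_distrib]
  exact Finset.sum_congr rfl fun i _ => hcoord i

end OscillatoryKernel

section KernelDecay

lemma IsTestOn.aestronglyMeasurable_fourierInv {n : ℕ} {U : Set (Rn n)} {a : Rn n → ℂ}
    (ha : IsTestOn U a) : AEStronglyMeasurable (𝓕⁻ a) volume := by
  have := (𝓕⁻ (ha.compact.toSchwartzMap ha.contDiff)).continuous.aestronglyMeasurable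
    (μ := volume)
  rwa [SchwartzMap.fourierInv_coe] at this

lemma continuous_coneWeight (n : ℕ) (L : ℝ) : Continuous (coneWeight n L) := by
  unfold coneWeight
  fun_prop

lemma contDiff_cexp_I : ContDiff ℝ (⊤ : ℕ∞) (fun s : ℝ => cexp (I * s)) := by
  have : ContDiff ℝ (⊤ : ℕ∞) (fun s : ℝ => (s : ℂ)) := Complex.ofRealCLM.contDiff
  exact (contDiff_const.mul this).cexp

lemma deriv_cexp_I : deriv (fun s : ℝ => cexp (I * s)) = fun s : ℝ => I * cexp (I * s) := by
  ext s
  have h : HasDerivAt (fun s : ℝ => I * (s : ℂ)) (I * 1) s :=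
    (Complex.ofRealCLM.hasDerivAt (x := s)).const_mul I
  rw [(h.cexp).deriv]
  ring

lemma oscKernel_const_mul {n : ℕ} (e : ℝ → ℂ) (z : ℂ) (φ : Rn n → ℝ) (κ : ℝ) (a : Rn n → ℂ)
    (x : Rn n) : oscKernel (fun s => z * e s) φ κ a x = z * oscKernel e φ κ a x := by
  simp only [oscKernel, Real.fourierInv_eq, ← integral_const_mul]
  refine integral_congr_ae (.of_forall fun ξ => ?_)
  simp only [Circle.smul_def, smul_eq_mul]
  ring

/-- Uniform weighted `L^2` bounds for the kernels of `e^{iκ|ξ|} a(ξ)`. -/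
lemma exists_coneWeight_pow_mul_oscKernel_le {n : ℕ} (N : ℕ) {a : Rn n → ℂ}
    (ha : IsTestOn {0}ᶜ a) : ∃ C : ℝ≥0, ∀ κ : ℝ,
      eLpNorm (fun x => (((coneWeight n |κ| x) ^ N : ℝ) : ℂ) *
        oscKernel (fun s => cexp (I * s)) norm κ a x) 2 volume ≤ C := by
  have hU : IsOpen ({0}ᶜ : Set (Rn n)) := isOpen_compl_singleton
  have hφ : ContDiffOn ℝ (⊤ : ℕ∞) (norm : Rn n → ℝ) {0}ᶜ := fun ξ hξ =>
    (contDiffAt_norm ℝ hξ).contDiffWithinAt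
  induction N generalizing a with
  | zero =>
    have hfin : eLpNorm a 2 volume ≠ ∞ :=
      (ha.contDiff.continuous.memLp_of_hasCompactSupport ha.compact).2.ne
    refine ⟨(eLpNorm a 2 volume).toNNReal, fun κ => ?_⟩
    rw [ENNReal.coe_toNNReal hfin]
    simp only [pow_zero, ofReal_one, one_mul]
    refine ((ha.comp_mul hU hφ contDiff_cexp_I κ).eLpNorm_fourierInv).trans_le ?_
    refine eLpNorm_mono fun ξ => ?_
    rw [norm_mul, mul_comm I, norm_exp_ofReal_mul_I, one_mul]
  | succ N ih =>
    obtain ⟨a₀, a₁, h₀, h₁, hlap⟩ := exists_oscKernel_laplacian hU hφ ha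
    obtain ⟨C₀, hC₀⟩ := ih h₀
    obtain ⟨C₁, hC₁⟩ := ih h₁
    refine ⟨C₀ + C₁, fun κ => ?_⟩
    have hgrad : (fun ξ => ((‖fderiv ℝ (norm : Rn n → ℝ) ξ‖ ^ 2 : ℝ) : ℂ) * a ξ) = a := by
      ext ξ
      by_cases hξ : ξ = 0
      · have : a ξ = 0 := by
          by_contra h
          exact ha.tsupport_subset (subset_tsupport a h) hξ
        rw [this, mul_zero]
      · have : Nontrivial (Rn n) := ⟨⟨ξ, 0, hξ⟩⟩
        have := norm_fderiv_norm ((contDiffAt_norm ℝ hξ (n := 1)).differentiableAt (by simp))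
        rw [show fderiv ℝ (norm : Rn n → ℝ) ξ = fderiv ℝ (fun x => ‖x‖) ξ from rfl, this]
        simp
    have hrec : ∀ x, ((coneWeight n |κ| x : ℝ) : ℂ) *
        oscKernel (fun s => cexp (I * s)) norm κ a x =
        -(((1 / (1 + |κ|) : ℝ) : ℂ) * oscKernel (fun s => cexp (I * s)) norm κ a₀ x) +
        -((κ / (1 + |κ|) : ℝ) * I * oscKernel (fun s => cexp (I * s)) norm κ a₁ x) := by
      intro x
      have h := hlap _ contDiff_cexp_I κ x
      have hd2 : deriv (deriv fun s : ℝ => cexp (I * s)) = fun s : ℝ => -1 * cexp (I * s) := by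
        rw [deriv_cexp_I]
        ext s
        rw [deriv_const_mul _ (contDiff_cexp_I.differentiable (by simp) s), deriv_cexp_I,
          ← mul_assoc, I_mul_I]
      rw [hgrad, hd2, deriv_cexp_I, oscKernel_const_mul, oscKernel_const_mul] at h
      have hκ : (1 + |κ| : ℝ) ≠ 0 := by positivity
      have hκ' : (1 + ((|κ| : ℝ) : ℂ)) ≠ 0 := by exact_mod_cast hκ
      rw [coneWeight, sq_abs]
      push_cast at h ⊢
      field_simp
      linear_combination h
    have hmeas : ∀ {f : Rn n → ℂ} (z : ℂ), IsTestOn {0}ᶜ f → AEStronglyMeasurable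
        (fun x => z * ((((coneWeight n |κ| x) ^ N : ℝ) : ℂ) *
          oscKernel (fun s => cexp (I * s)) norm κ f x)) volume := fun z hf => by
      refine AEStronglyMeasurable.const_mul (AEStronglyMeasurable.mul ?_
        (hf.comp_mul hU hφ contDiff_cexp_I κ).aestronglyMeasurable_fourierInv) z
      have := continuous_coneWeight n |κ|
      exact (Continuous.aestronglyMeasurable (by fun_prop))
    have hz : ∀ {f : Rn n → ℂ} {C : ℝ≥0} (z : ℂ), ‖z‖ ≤ 1 →
        eLpNorm (fun x => (((coneWeight n |κ| x) ^ N : ℝ) : ℂ) *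
          oscKernel (fun s => cexp (I * s)) norm κ f x) 2 volume ≤ C →
        eLpNorm (fun x => z * ((((coneWeight n |κ| x) ^ N : ℝ) : ℂ) *
          oscKernel (fun s => cexp (I * s)) norm κ f x)) 2 volume ≤ C := fun z hz h => by
      refine (eLpNorm_mono fun x => ?_).trans h
      rw [norm_mul]
      exact mul_le_of_le_one_left (norm_nonneg _) hz
    have hκ : (0 : ℝ) < 1 + |κ| := by positivity
    have hz₀ : ‖-((1 / (1 + |κ|) : ℝ) : ℂ)‖ ≤ 1 := by
      rw [norm_neg, norm_real, Real.norm_eq_abs, abs_div, abs_of_pos hκ, abs_one, div_le_one hκ]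
      linarith [abs_nonneg κ]
    have hz₁ : ‖-((κ / (1 + |κ|) : ℝ) * I)‖ ≤ 1 := by
      rw [norm_neg, norm_mul, norm_I, mul_one, norm_real, Real.norm_eq_abs, abs_div,
        abs_of_pos hκ, div_le_one hκ]
      linarith [abs_nonneg κ]
    have hsplit : (fun x => (((coneWeight n |κ| x) ^ (N + 1) : ℝ) : ℂ) *
        oscKernel (fun s => cexp (I * s)) norm κ a x) =
        (fun x => -((1 / (1 + |κ|) : ℝ) : ℂ) * ((((coneWeight n |κ| x) ^ N : ℝ) : ℂ) *
          oscKernel (fun s => cexp (I * s)) norm κ a₀ x)) +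
        (fun x => -((κ / (1 + |κ|) : ℝ) * I) * ((((coneWeight n |κ| x) ^ N : ℝ) : ℂ) *
          oscKernel (fun s => cexp (I * s)) norm κ a₁ x)) := by
      ext x
      have := hrec x
      rw [Pi.add_apply, pow_succ, ofReal_mul, mul_assoc, this]
      ring
    rw [hsplit, ENNReal.coe_add]
    refine (eLpNorm_add_le (hmeas _ h₀) (hmeas _ h₁) (by norm_num)).trans ?_
    exact add_le_add (hz _ hz₀ (hC₀ κ)) (hz _ hz₁ (hC₁ κ))

/-- Weighted `L^2` bounds for the kernels of `c(κ|ξ|²) a(ξ)`, uniformly for bounded `κ`. -/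
lemma exists_pow_mul_oscKernel_sq_le {n : ℕ} (N : ℕ) {c : ℝ → ℂ} (hc : ContDiff ℝ (⊤ : ℕ∞) c)
    {a : Rn n → ℂ} (ha : IsTestOn Set.univ a) {κ₀ : ℝ} (hκ₀ : 0 ≤ κ₀) :
    ∃ C : ℝ≥0, ∀ κ : ℝ, |κ| ≤ κ₀ →
      eLpNorm (fun x => (((coneWeight n 0 x) ^ N : ℝ) : ℂ) *
        oscKernel c (fun ξ => ‖ξ‖ ^ 2) κ a x) 2 volume ≤ C := by
  have hU : IsOpen (Set.univ : Set (Rn n)) := isOpen_univ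
  have hφ : ContDiffOn ℝ (⊤ : ℕ∞) (fun ξ : Rn n => ‖ξ‖ ^ 2) Set.univ :=
    (contDiff_norm_sq ℝ).contDiffOn
  induction N generalizing a c with
  | zero =>
    have hfin : eLpNorm a 2 volume ≠ ∞ :=
      (ha.contDiff.continuous.memLp_of_hasCompactSupport ha.compact).2.ne
    obtain ⟨R, hR⟩ := ha.compact.isCompact.isBounded.exists_norm_le
    obtain ⟨M, hM⟩ := (isCompact_Icc (a := -(κ₀ * R ^ 2)) (b := κ₀ * R ^ 2)).exists_bound_of_continuousOn
      hc.continuous.continuousOn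
    refine ⟨(ENNReal.ofReal M * eLpNorm a 2 volume).toNNReal, fun κ hκ => ?_⟩
    rw [ENNReal.coe_toNNReal (ENNReal.mul_ne_top ENNReal.ofReal_ne_top hfin)]
    simp only [pow_zero, ofReal_one, one_mul]
    refine ((ha.comp_mul hU hφ hc κ).eLpNorm_fourierInv).trans_le ?_
    refine eLpNorm_le_mul_eLpNorm_of_ae_le_mul (.of_forall fun ξ => ?_) 2
    rw [norm_mul]
    by_cases hξ : a ξ = 0
    · simp [hξ]
    · gcongr
      refine hM _ (abs_le.1 ?_)
      have := hR ξ (subset_tsupport a hξ)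
      rw [abs_mul, abs_of_nonneg (by positivity : 0 ≤ ‖ξ‖ ^ 2)]
      gcongr
  | succ N ih =>
    obtain ⟨a₀, a₁, h₀, h₁, hlap⟩ := exists_oscKernel_laplacian hU hφ ha
    have hc' : ContDiff ℝ (⊤ : ℕ∞) (deriv c) := (contDiff_infty_iff_deriv.1 hc).2
    have hc'' : ContDiff ℝ (⊤ : ℕ∞) (deriv (deriv c)) := (contDiff_infty_iff_deriv.1 hc').2
    have h₂ : IsTestOn Set.univ (fun ξ : Rn n =>
        ((‖fderiv ℝ (fun ξ : Rn n => ‖ξ‖ ^ 2) ξ‖ ^ 2 : ℝ) : ℂ) * a ξ) := by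
      refine ha.mul hU (Complex.ofRealCLM.contDiff.comp_contDiffOn ?_)
      have : ContDiff ℝ (⊤ : ℕ∞) (fun ξ : Rn n => 4 * ‖ξ‖ ^ 2) :=
        contDiff_const.mul (contDiff_norm_sq ℝ)
      refine this.contDiffOn.congr fun ξ _ => ?_
      have h2 : fderiv ℝ (fun ξ : Rn n => ‖ξ‖ ^ 2) ξ = (2 : ℝ) • innerSL ℝ ξ := by
        rw [fderiv_norm_sq_apply, two_nsmul, two_smul]
      simp only [h2, norm_smul, innerSL_apply_norm, Real.norm_ofNat]
      change (2 * ‖ξ‖) ^ 2 = _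
      ring
    obtain ⟨C₀, hC₀⟩ := ih hc h₀
    obtain ⟨C₁, hC₁⟩ := ih hc' h₁
    obtain ⟨C₂, hC₂⟩ := ih hc'' h₂
    refine ⟨C₀ + (Real.toNNReal κ₀ * C₁ + Real.toNNReal (κ₀ ^ 2) * C₂), fun κ hκ => ?_⟩
    have hmeas : ∀ {e : ℝ → ℂ} {f : Rn n → ℂ} (z : ℂ), ContDiff ℝ (⊤ : ℕ∞) e →
        IsTestOn Set.univ f → AEStronglyMeasurable
        (fun x => z * ((((coneWeight n 0 x) ^ N : ℝ) : ℂ) *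
          oscKernel e (fun ξ => ‖ξ‖ ^ 2) κ f x)) volume := fun z he hf => by
      refine AEStronglyMeasurable.const_mul (AEStronglyMeasurable.mul ?_
        (hf.comp_mul hU hφ he κ).aestronglyMeasurable_fourierInv) z
      have := continuous_coneWeight n 0
      exact (Continuous.aestronglyMeasurable (by fun_prop))
    have hz : ∀ {e : ℝ → ℂ} {f : Rn n → ℂ} {C : ℝ≥0} (z : ℂ) (m : ℝ), ‖z‖ ≤ m →
        eLpNorm (fun x => (((coneWeight n 0 x) ^ N : ℝ) : ℂ) *
          oscKernel e (fun ξ => ‖ξ‖ ^ 2) κ f x) 2 volume ≤ C →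
        eLpNorm (fun x => z * ((((coneWeight n 0 x) ^ N : ℝ) : ℂ) *
          oscKernel e (fun ξ => ‖ξ‖ ^ 2) κ f x)) 2 volume ≤ (Real.toNNReal m * C : ℝ≥0) :=
      fun z m hz h => by
        refine (eLpNorm_le_mul_eLpNorm_of_ae_le_mul (c := m) (.of_forall fun x => ?_) 2).trans
          (mul_le_mul_right h _) |>.trans_eq ?_
        · rw [norm_mul]
          gcongr
        · rw [ENNReal.coe_mul]; rfl
    have hsplit : (fun x => (((coneWeight n 0 x) ^ (N + 1) : ℝ) : ℂ) *
        oscKernel c (fun ξ => ‖ξ‖ ^ 2) κ a x) =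
        (fun x => (-1 : ℂ) * ((((coneWeight n 0 x) ^ N : ℝ) : ℂ) *
          oscKernel c (fun ξ => ‖ξ‖ ^ 2) κ a₀ x)) +
        ((fun x => -(κ : ℂ) * ((((coneWeight n 0 x) ^ N : ℝ) : ℂ) *
          oscKernel (deriv c) (fun ξ => ‖ξ‖ ^ 2) κ a₁ x)) +
        (fun x => -(κ : ℂ) ^ 2 * ((((coneWeight n 0 x) ^ N : ℝ) : ℂ) *
          oscKernel (deriv (deriv c)) (fun ξ => ‖ξ‖ ^ 2) κ (fun ξ : Rn n =>
        ((‖fderiv ℝ (fun ξ : Rn n => ‖ξ‖ ^ 2) ξ‖ ^ 2 : ℝ) : ℂ) * a ξ) x))) := by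
      ext x
      have h := hlap c hc κ x
      have hw : coneWeight n 0 x = (2 * Real.pi * ‖x‖) ^ 2 := by simp [coneWeight]
      rw [Pi.add_apply, Pi.add_apply, pow_succ, ofReal_mul, mul_assoc]
      nth_rewrite 2 [hw]
      rw [h]
      ring
    rw [hsplit, ENNReal.coe_add, ENNReal.coe_add]
    refine (eLpNorm_add_le (hmeas _ hc h₀) ((hmeas _ hc' h₁).add (hmeas _ hc'' h₂))
      (by norm_num)).trans (add_le_add ?_ ?_)
    · have := hz (-1) 1 (by simp) (hC₀ κ hκ)
      simpa using this
    · refine (eLpNorm_add_le (hmeas _ hc' h₁) (hmeas _ hc'' h₂) (by norm_num)).trans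
        (add_le_add ?_ ?_)
      · exact hz _ κ₀ (by simpa using hκ) (hC₁ κ hκ)
      · refine hz _ (κ₀ ^ 2) ?_ (hC₂ κ hκ)
        rw [norm_neg, norm_pow, norm_real, Real.norm_eq_abs]
        gcongr

end KernelDecay

section MultiplierBounds

/-- The Fourier multiplier `m` is bounded with constant `D` in `L^p` on Schwartz functions with
spectrum in the ball of radius `R`. -/
def IsMultiplierBound {n : ℕ} (p : ℝ≥0∞) (R : ℝ) (D : ℝ≥0∞) (m : Rn n → ℂ) : Prop :=
  ∀ g : 𝓢(Rn n, ℂ), (∀ ξ, R < ‖ξ‖ → 𝓕 (g : Rn n → ℂ) ξ = 0) →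
    eLpNorm (𝓕⁻ (fun ξ => m ξ * 𝓕 (g : Rn n → ℂ) ξ)) p volume ≤ D * eLpNorm g p volume

lemma IsTestOn.kernelConv_fourierInv {n : ℕ} {U : Set (Rn n)} {m : Rn n → ℂ} (hm : IsTestOn U m)
    (g : 𝓢(Rn n, ℂ)) :
    kernelConv (𝓕⁻ m) g = 𝓕⁻ (fun ξ => m ξ * 𝓕 (g : Rn n → ℂ) ξ) := by
  set K := 𝓕⁻ (hm.compact.toSchwartzMap hm.contDiff) with hK
  have hcoe : (K : Rn n → ℂ) = 𝓕⁻ m := by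
    rw [hK, SchwartzMap.fourierInv_coe]; rfl
  have hF : ∀ ξ, 𝓕 (K : Rn n → ℂ) ξ = m ξ := fun ξ => by
    rw [← SchwartzMap.fourier_coe, hK, FourierTransform.fourier_fourierInv_eq]; rfl
  rw [← hcoe]
  simp only [← hF, ← fourier_kernelConv_schwartz]
  rw [kernelConv_schwartz_eq, ← SchwartzMap.fourier_coe, ← SchwartzMap.fourierInv_coe,
    FourierTransform.fourierInv_fourier_eq]

lemma exists_isMultiplierBound {n : ℕ} (hn : 2 ≤ n) {p : ℝ≥0∞} (hp : p ≠ 0) :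
    ∃ N : ℕ, ∀ (B : ℝ≥0) (R : ℝ), ∃ D : ℝ≥0, ∀ L : ℝ, 0 ≤ L → ∀ m : Rn n → ℂ,
      IsTestOn Set.univ m → (∀ ξ, ‖m ξ‖ ≤ B) → (∀ ξ, R < ‖ξ‖ → m ξ = 0) →
      eLpNorm (𝓕⁻ m) 2 volume ≤ B →
      eLpNorm (fun x => (((coneWeight n L x) ^ N : ℝ) : ℂ) * 𝓕⁻ m x) 2 volume ≤ B →
      IsMultiplierBound p R
        (D * ENNReal.ofReal ((1 + L) ^ (((n : ℝ) - 1) * |p⁻¹.toReal - 1 / 2|))) m := by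
  have hcoe : ∀ {m : Rn n → ℂ} (hm : IsTestOn Set.univ m),
      ((𝓕⁻ (hm.compact.toSchwartzMap hm.contDiff) : 𝓢(Rn n, ℂ)) : Rn n → ℂ) = 𝓕⁻ m := fun hm => by
    rw [SchwartzMap.fourierInv_coe]; rfl
  have hF : ∀ {m : Rn n → ℂ} (hm : IsTestOn Set.univ m) (ξ : Rn n),
      𝓕 ((𝓕⁻ (hm.compact.toSchwartzMap hm.contDiff) : 𝓢(Rn n, ℂ)) : Rn n → ℂ) ξ = m ξ :=
    fun hm ξ => by
      rw [← SchwartzMap.fourier_coe, FourierTransform.fourier_fourierInv_eq]; rfl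
  have hn1 : (0 : ℝ) ≤ (n : ℝ) - 1 := by
    have : (2 : ℝ) ≤ n := by exact_mod_cast hn
    linarith
  rcases lt_or_ge p 1 with hp1 | hp1
  · have hpt : p ≠ ∞ := (hp1.trans ENNReal.one_lt_top).ne
    have hr : 0 < p.toReal := ENNReal.toReal_pos hp hpt
    have hr1 : p.toReal < 1 := by
      rw [← ENNReal.toReal_one]; exact (ENNReal.toReal_lt_toReal hpt ENNReal.one_ne_top).2 hp1
    obtain ⟨N, C, hC⟩ := exists_eLpNorm_le_of_coneWeight n hn hr (by linarith)
    refine ⟨N, fun B R => ?_⟩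
    set v := volume (Metric.closedBall (0 : Rn n) (2 * R)) ^ ((1 - p.toReal) / p.toReal) with hv
    have hvt : v ≠ ∞ := ENNReal.rpow_ne_top_of_nonneg (div_nonneg (by linarith) hr.le)
      measure_closedBall_lt_top.ne
    refine ⟨v.toNNReal * (C * B), fun L hL m hm _ hmR h0 hN g hg => ?_⟩
    have hK := hC L hL (𝓕⁻ m) hm.aestronglyMeasurable_fourierInv B h0 hN
    rw [ENNReal.ofReal_toReal hpt] at hK
    have h := eLpNorm_kernelConv_le_of_le_one (𝓕⁻ (hm.compact.toSchwartzMap hm.contDiff)) g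
      (fun ξ hξ => (hF hm ξ).trans (hmR ξ hξ)) hg hp hp1.le
    rw [hcoe hm] at h
    have he : |p⁻¹.toReal - 1 / 2| = 1 / p.toReal - 1 / 2 := by
      rw [ENNReal.toReal_inv, one_div p.toReal, abs_of_nonneg]
      have := (one_le_inv₀ hr).2 hr1.le
      linarith
    rw [he, ← hm.kernelConv_fourierInv]
    refine h.trans (mul_le_mul_left ?_ _)
    rw [ENNReal.coe_mul, ENNReal.coe_toNNReal hvt, mul_assoc, ENNReal.coe_mul]
    exact mul_le_mul_right hK _
  · obtain ⟨N, C, hC⟩ := exists_eLpNorm_le_of_coneWeight n hn one_pos one_lt_two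
    refine ⟨N, fun B R => ?_⟩
    obtain ⟨C', hC'⟩ := exists_eLpNorm_kernelConv_le (V := Rn n) hp1 B.coe_nonneg
    refine ⟨Real.toNNReal (C' * ((C * B : ℝ) + 1) ^ |2 * p⁻¹.toReal - 1|),
      fun L hL m hm hmB hmR h0 hN g hg => ?_⟩
    have hK := hC L hL (𝓕⁻ m) hm.aestronglyMeasurable_fourierInv B h0 hN
    have hL1 : (0 : ℝ) < 1 + L := by positivity
    rw [ENNReal.ofReal_one] at hK
    have h := hC' (((C * B : ℝ) + 1) * (1 + L) ^ (((n : ℝ) - 1) * (1 / 1 - 1 / 2)))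
      (by positivity) (𝓕⁻ (hm.compact.toSchwartzMap hm.contDiff)) g ?_
      (fun ξ => by rw [hF hm]; exact hmB ξ)
    · rw [hcoe hm, hm.kernelConv_fourierInv] at h
      refine h.trans_eq ?_
      congr 1
      rw [Real.mul_rpow (by positivity) (by positivity), ← Real.rpow_mul hL1.le, ← mul_assoc,
        ENNReal.ofReal_mul' (by positivity)]
      congr 3
      have : 2 * p⁻¹.toReal - 1 = 2 * (p⁻¹.toReal - 1 / 2) := by ring
      rw [this, abs_mul, abs_two]
      ring
    · rw [hcoe hm]
      refine hK.trans ?_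
      rw [ENNReal.ofReal_mul (by positivity)]
      refine mul_le_mul_left ?_ _
      rw [← ENNReal.coe_mul, ← ENNReal.ofReal_coe_nnreal]
      refine ENNReal.ofReal_le_ofReal ?_
      push_cast
      linarith

lemma exists_isMultiplierBound_exp_norm {n : ℕ} (hn : 2 ≤ n) {p : ℝ≥0∞} (hp : p ≠ 0)
    {a : Rn n → ℂ} (ha : IsTestOn {0}ᶜ a) {R : ℝ} (hR : ∀ ξ, R < ‖ξ‖ → a ξ = 0) :
    ∃ D : ℝ≥0, ∀ κ : ℝ, IsMultiplierBound p R
      (D * ENNReal.ofReal ((1 + |κ|) ^ (((n : ℝ) - 1) * |p⁻¹.toReal - 1 / 2|)))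
      (fun ξ => cexp (I * ((κ * ‖ξ‖ : ℝ) : ℂ)) * a ξ) := by
  obtain ⟨N, hN⟩ := exists_isMultiplierBound hn hp
  obtain ⟨C₀, hC₀⟩ := exists_coneWeight_pow_mul_oscKernel_le 0 ha
  obtain ⟨C₁, hC₁⟩ := exists_coneWeight_pow_mul_oscKernel_le N ha
  obtain ⟨M, hM⟩ := ha.contDiff.continuous.bounded_above_of_compact_support ha.compact
  obtain ⟨D, hD⟩ := hN (max (max C₀ C₁) M.toNNReal) R
  have hφ : ContDiffOn ℝ (⊤ : ℕ∞) (norm : Rn n → ℝ) {0}ᶜ := fun ξ hξ =>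
    (contDiffAt_norm ℝ hξ).contDiffWithinAt
  refine ⟨D, fun κ => hD |κ| (abs_nonneg κ) _ ?_ ?_ ?_ ?_ ?_⟩
  · have := ha.comp_mul isOpen_compl_singleton hφ contDiff_cexp_I κ
    exact ⟨this.contDiff, this.compact, Set.subset_univ _⟩
  · intro ξ
    rw [norm_mul, mul_comm I, norm_exp_ofReal_mul_I, one_mul]
    refine (hM ξ).trans ((Real.le_coe_toNNReal M).trans ?_)
    exact_mod_cast le_max_right _ _
  · intro ξ hξ
    rw [hR ξ hξ, mul_zero]
  · have := hC₀ κ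
    simp only [pow_zero, ofReal_one, one_mul] at this
    refine le_trans this ?_
    exact_mod_cast (le_max_left C₀ C₁).trans (le_max_left _ _)
  · refine le_trans (hC₁ κ) ?_
    exact_mod_cast (le_max_right C₀ C₁).trans (le_max_left _ _)

lemma exists_isMultiplierBound_comp_norm_sq {n : ℕ} (hn : 2 ≤ n) {p : ℝ≥0∞} (hp : p ≠ 0)
    {c : ℝ → ℂ} (hc : ContDiff ℝ (⊤ : ℕ∞) c)
    {a : Rn n → ℂ} (ha : IsTestOn Set.univ a) {R : ℝ} (hR : ∀ ξ, R < ‖ξ‖ → a ξ = 0)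
    {κ₀ : ℝ} (hκ₀ : 0 ≤ κ₀) :
    ∃ D : ℝ≥0, ∀ κ : ℝ, |κ| ≤ κ₀ → IsMultiplierBound p R D
      (fun ξ => c (κ * ‖ξ‖ ^ 2) * a ξ) := by
  obtain ⟨N, hN⟩ := exists_isMultiplierBound hn hp
  obtain ⟨C₀, hC₀⟩ := exists_pow_mul_oscKernel_sq_le 0 hc ha hκ₀
  obtain ⟨C₁, hC₁⟩ := exists_pow_mul_oscKernel_sq_le N hc ha hκ₀
  obtain ⟨M, hM⟩ := ha.contDiff.continuous.bounded_above_of_compact_support ha.compact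
  obtain ⟨M', hM'⟩ := (isCompact_Icc (a := -(κ₀ * R ^ 2)) (b := κ₀ * R ^ 2)).exists_bound_of_continuousOn
      hc.continuous.continuousOn
  obtain ⟨D, hD⟩ := hN (max (max C₀ C₁) (M'.toNNReal * M.toNNReal)) R
  refine ⟨D, fun κ hκ => ?_⟩
  have key := hD 0 le_rfl (fun ξ => c (κ * ‖ξ‖ ^ 2) * a ξ) ?_ ?_ ?_ ?_ ?_
  · simpa using key
  · exact ha.comp_mul isOpen_univ (contDiff_norm_sq ℝ).contDiffOn hc κ
  · intro ξ
    rcases lt_or_ge R ‖ξ‖ with hξ | hξ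
    · rw [hR ξ hξ, mul_zero, norm_zero]
      exact NNReal.coe_nonneg _
    · have h1 : ‖c (κ * ‖ξ‖ ^ 2)‖ ≤ M' := by
        refine hM' _ (abs_le.1 ?_)
        rw [abs_mul, abs_of_nonneg (by positivity : 0 ≤ ‖ξ‖ ^ 2)]
        gcongr
      have h2 : ‖c (κ * ‖ξ‖ ^ 2) * a ξ‖ ≤ ((M'.toNNReal * M.toNNReal : ℝ≥0) : ℝ) := by
        rw [norm_mul]
        push_cast
        gcongr
        · exact h1.trans (Real.le_coe_toNNReal _)
        · exact (hM ξ).trans (Real.le_coe_toNNReal _)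
      refine h2.trans ?_
      exact_mod_cast le_max_right _ _
  · intro ξ hξ
    rw [hR ξ hξ, mul_zero]
  · have := hC₀ κ hκ
    simp only [pow_zero, ofReal_one, one_mul] at this
    refine le_trans this ?_
    exact_mod_cast (le_max_left C₀ C₁).trans (le_max_left _ _)
  · refine le_trans (hC₁ κ hκ) ?_
    exact_mod_cast (le_max_right C₀ C₁).trans (le_max_left _ _)

end MultiplierBounds

section MultiplierAlgebra

variable {n : ℕ} {p : ℝ≥0∞} {R : ℝ}

lemma fourierInv_const_mul (z : ℂ) (f : Rn n → ℂ) :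
    𝓕⁻ (fun ξ => z * f ξ) = fun x => z * 𝓕⁻ f x := by
  ext x
  simp only [Real.fourierInv_eq', smul_eq_mul, ← integral_const_mul]
  refine integral_congr_ae (.of_forall fun ξ => ?_)
  simp only
  ring

lemma continuous_fourierInv {f : Rn n → ℂ} (hf : Integrable f) : Continuous (𝓕⁻ f) := by
  have h : Continuous (𝓕 f) := VectorFourier.fourierIntegral_continuous Real.continuous_fourierChar
    continuous_inner hf
  have : 𝓕⁻ f = fun x => 𝓕 f (-x) := by
    ext x
    exact Real.fourierInv_eq_fourier_neg f x
  rw [this]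
  exact h.comp continuous_neg

lemma fourierInv_add_apply {f g : Rn n → ℂ} (hf : Integrable f) (hg : Integrable g) :
    𝓕⁻ (fun ξ => f ξ + g ξ) = 𝓕⁻ f + 𝓕⁻ g := by
  ext x
  have h : ∀ {f : Rn n → ℂ}, Integrable f →
      Integrable fun ξ => Real.fourierChar ⟪ξ, x⟫_ℝ • f ξ := fun {f} hf => by
    have := (Real.fourierIntegral_convergent_iff (-x)).2 hf
    simpa using this
  rw [Pi.add_apply]
  simp only [Real.fourierInv_eq, smul_add]
  exact integral_add (h hf) (h hg)

lemma IsMultiplierBound.const_mul {D : ℝ≥0∞} {m : Rn n → ℂ} (h : IsMultiplierBound p R D m)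
    (z : ℂ) : IsMultiplierBound p R (‖z‖ₑ * D) (fun ξ => z * m ξ) := fun g hg => by
  simp only [mul_assoc]
  rw [fourierInv_const_mul]
  refine (eLpNorm_const_smul z (𝓕⁻ fun ξ => m ξ * 𝓕 (g : Rn n → ℂ) ξ) p volume).trans_le ?_
  exact mul_le_mul_right (h g hg) _

lemma IsTestOn.integrable_mul_fourier {m : Rn n → ℂ} (hm : IsTestOn Set.univ m)
    (g : 𝓢(Rn n, ℂ)) : Integrable (fun ξ => m ξ * 𝓕 (g : Rn n → ℂ) ξ) := by
  have hg := (𝓕 g).continuous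
  rw [SchwartzMap.fourier_coe] at hg
  exact (hm.contDiff.continuous.mul hg).integrable_of_hasCompactSupport hm.compact.mul_right

lemma IsMultiplierBound.add {D₁ D₂ : ℝ≥0∞} {m₁ m₂ : Rn n → ℂ} (h₁ : IsMultiplierBound p R D₁ m₁)
    (h₂ : IsMultiplierBound p R D₂ m₂) (hm₁ : IsTestOn Set.univ m₁) (hm₂ : IsTestOn Set.univ m₂) :
    IsMultiplierBound p R (p.LpAddConst * (D₁ + D₂)) (fun ξ => m₁ ξ + m₂ ξ) := fun g hg => by
  have hi₁ := hm₁.integrable_mul_fourier g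
  have hi₂ := hm₂.integrable_mul_fourier g
  simp only [add_mul]
  rw [fourierInv_add_apply hi₁ hi₂, mul_assoc, add_mul]
  refine (eLpNorm_add_le' (continuous_fourierInv hi₁).aestronglyMeasurable
    (continuous_fourierInv hi₂).aestronglyMeasurable p).trans ?_
  exact mul_le_mul_right (add_le_add (h₁ g hg) (h₂ g hg)) _

lemma IsMultiplierBound.mono {D D' : ℝ≥0∞} {m : Rn n → ℂ} (h : IsMultiplierBound p R D m)
    (hD : D ≤ D') : IsMultiplierBound p R D' m := fun g hg =>
  (h g hg).trans (mul_le_mul_left hD _)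

lemma fourier_comp_smul_apply (f : Rn n → ℂ) {r : ℝ} (hr : 0 < r) (ξ : Rn n) :
    𝓕 (fun x => f (r⁻¹ • x)) ξ = ((r ^ n : ℝ) : ℂ) * 𝓕 f (r • ξ) := by
  have h := Measure.integral_comp_smul (volume : Measure (Rn n))
    (fun x => cexp (((-2 * Real.pi * ⟪x, r • ξ⟫_ℝ : ℝ) : ℂ) * I) • f x) r⁻¹
  rw [Real.fourier_eq', Real.fourier_eq']
  rw [finrank_euclideanSpace_fin, inv_pow, inv_inv, abs_of_pos (by positivity)] at h
  rw [← real_smul, ← h]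
  refine integral_congr_ae (.of_forall fun x => ?_)
  simp only [real_inner_smul_left, real_inner_smul_right]
  rw [mul_inv_cancel_left₀ hr.ne']

lemma fourierInv_comp_smul_apply (f : Rn n → ℂ) {r : ℝ} (hr : 0 < r) (x : Rn n) :
    𝓕⁻ (fun ξ => f (r⁻¹ • ξ)) x = ((r ^ n : ℝ) : ℂ) * 𝓕⁻ f (r • x) := by
  rw [Real.fourierInv_eq_fourier_neg, Real.fourierInv_eq_fourier_neg, fourier_comp_smul_apply f hr,
    smul_neg]

lemma eLpNorm_comp_smul (f : Rn n → ℂ) (p : ℝ≥0∞) {r : ℝ} (hr : 0 < r) :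
    eLpNorm (fun x => f (r • x)) p volume =
      ENNReal.ofReal |(r ^ n)⁻¹| ^ (1 / p).toReal * eLpNorm f p volume := by
  have hc : ENNReal.ofReal |(r ^ n)⁻¹| ≠ 0 := by
    rw [Ne, ENNReal.ofReal_eq_zero, not_le]
    positivity
  have he := (Homeomorph.smulOfNeZero (α := Rn n) r hr.ne').measurableEmbedding
  have h := he.eLpNorm_map_measure (μ := volume) (g := f) (p := p)
  have hmap : Measure.map (Homeomorph.smulOfNeZero (α := Rn n) r hr.ne') volume =
      ENNReal.ofReal |(r ^ n)⁻¹| • (volume : Measure (Rn n)) := by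
    have := Measure.map_addHaar_smul (volume : Measure (Rn n)) hr.ne'
    rwa [finrank_euclideanSpace_fin] at this
  rw [hmap, eLpNorm_smul_measure_of_ne_zero hc, smul_eq_mul] at h
  exact h.symm

lemma IsMultiplierBound.comp_smul {D : ℝ≥0∞} {m : Rn n → ℂ} (h : IsMultiplierBound p R D m)
    {r : ℝ} (hr : 0 < r) : IsMultiplierBound p (r * R) D (fun ξ => m (r⁻¹ • ξ)) := fun g hg => by
  set e : Rn n ≃L[ℝ] Rn n := ContinuousLinearEquiv.smulLeft (Units.mk0 r⁻¹ (inv_ne_zero hr.ne'))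
    with he
  set G : 𝓢(Rn n, ℂ) := SchwartzMap.compCLMOfContinuousLinearEquiv ℂ e g with hG
  have hGx : (G : Rn n → ℂ) = fun x => g (r⁻¹ • x) := rfl
  have hFG : ∀ ξ, 𝓕 (G : Rn n → ℂ) ξ = ((r ^ n : ℝ) : ℂ) * 𝓕 (g : Rn n → ℂ) (r • ξ) := fun ξ => by
    rw [hGx, fourier_comp_smul_apply _ hr]
  have hb := h G fun ξ hξ => by
    rw [hFG, hg _ (by rw [norm_smul, Real.norm_of_nonneg hr.le]; gcongr), mul_zero]
  have h1 : 𝓕⁻ (fun ξ => m (r⁻¹ • ξ) * 𝓕 (g : Rn n → ℂ) ξ) =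
      fun x => 𝓕⁻ (fun ξ => m ξ * 𝓕 (G : Rn n → ℂ) ξ) (r • x) := by
    ext x
    have := fourierInv_comp_smul_apply (fun ξ => m ξ * 𝓕 (g : Rn n → ℂ) (r • ξ)) hr x
    simp only [smul_inv_smul₀ hr.ne'] at this
    rw [this]
    have e2 : (fun ξ => m ξ * 𝓕 (G : Rn n → ℂ) ξ) =
        fun ξ => ((r ^ n : ℝ) : ℂ) * (m ξ * 𝓕 (g : Rn n → ℂ) (r • ξ)) := by
      ext ξ
      rw [hFG]
      ring
    rw [e2, fourierInv_const_mul]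
  have h2 : (g : Rn n → ℂ) = fun x => G (r • x) := by
    ext x
    rw [hGx]
    simp only [inv_smul_smul₀ hr.ne']
  rw [h1, h2, eLpNorm_comp_smul _ p hr, eLpNorm_comp_smul _ p hr, mul_left_comm]
  exact mul_le_mul_right hb _

end MultiplierAlgebra

section CosSqrt

open FormalMultilinearSeries in
/-- The function `s ↦ cos √s` extends to a smooth function on `ℝ`. -/
lemma exists_contDiff_cos_sqrt : ∃ c : ℝ → ℝ, ContDiff ℝ (⊤ : ℕ∞) c ∧
    ∀ x, c (x ^ 2) = Real.cos x := by
  set a : ℕ → ℝ := fun k => (-1) ^ k / ((2 * k).factorial : ℝ) with ha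
  have hfac : ∀ k : ℕ, ((2 * k).factorial : ℝ) ≠ 0 := fun k => by positivity
  have hr : (ofScalars ℝ a).radius = ⊤ := by
    refine ofScalars_radius_eq_top_of_tendsto ℝ a (.of_forall fun k => ?_) ?_
    · exact div_ne_zero (pow_ne_zero _ (by norm_num)) (hfac k)
    · have h : ∀ k : ℕ, ‖a k.succ‖ / ‖a k‖ = 1 / ((2 * k + 1) * (2 * k + 2)) := fun k => by
        have : (2 * (k + 1)).factorial = (2 * k + 2) * ((2 * k + 1) * (2 * k).factorial) := by
          rw [show 2 * (k + 1) = 2 * k + 1 + 1 by ring, Nat.factorial_succ, Nat.factorial_succ]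
        simp only [ha, norm_div, norm_pow, norm_neg, norm_one, one_pow, Nat.succ_eq_add_one, this]
        rw [Real.norm_natCast, Real.norm_natCast]
        push_cast
        have := hfac k
        field_simp
      simp only [h]
      refine squeeze_zero (fun k => by positivity) (fun k => ?_)
        tendsto_one_div_add_atTop_nhds_zero_nat
      refine one_div_le_one_div_of_le (by positivity) ?_
      have : (0 : ℝ) ≤ k := k.cast_nonneg
      nlinarith
  have hb := (ofScalars ℝ a).hasFPowerSeriesOnBall (by rw [hr]; exact ENNReal.zero_lt_top)
  rw [hr] at hb
  refine ⟨(ofScalars ℝ a).sum, ?_, fun x => ?_⟩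
  · refine AnalyticOnNhd.contDiff fun x _ => ?_
    exact hb.analyticAt_of_mem (by simp)
  · have h1 : (ofScalars ℝ a).sum (x ^ 2) = ∑' k, a k • (x ^ 2) ^ k := ofScalars_sum_eq a _
    rw [h1, ← (Real.hasSum_cos x).tsum_eq]
    refine tsum_congr fun k => ?_
    simp only [ha, smul_eq_mul]
    rw [pow_mul]
    ring

lemma exists_contDiff_sinc_sqrt : ∃ c : ℝ → ℝ, ContDiff ℝ (⊤ : ℕ∞) c ∧
    ∀ x ≠ 0, c (x ^ 2) = Real.sin x / x := by
  obtain ⟨c, hc, hcx⟩ := exists_contDiff_cos_sqrt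
  have hc' : ContDiff ℝ (⊤ : ℕ∞) (deriv c) := (contDiff_infty_iff_deriv.1 hc).2
  refine ⟨fun s => -2 * deriv c s, contDiff_const.mul hc', fun x hx => ?_⟩
  have h1 : HasDerivAt (fun y => c (y ^ 2)) (deriv c (x ^ 2) * (2 * x)) x := by
    have := (hc.differentiable (by simp) (x ^ 2)).hasDerivAt.comp x (hasDerivAt_pow 2 x)
    simpa [Function.comp_def] using this
  have h2 : HasDerivAt (fun y => c (y ^ 2)) (-Real.sin x) x := by
    rw [funext hcx]
    exact Real.hasDerivAt_cos x
  have := h1.unique h2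
  rw [eq_div_iff hx]
  linarith

end CosSqrt

section WaveMultipliers

variable {n : ℕ} {p : ℝ≥0∞}

lemma fourierInv_congr_ae {f g : Rn n → ℂ} (h : f =ᵐ[volume] g) : 𝓕⁻ f = 𝓕⁻ g := by
  ext x
  rw [Real.fourierInv_eq, Real.fourierInv_eq]
  refine integral_congr_ae ?_
  filter_upwards [h] with ξ hξ
  rw [hξ]

lemma IsMultiplierBound.eLpNorm_le {R : ℝ} {D : ℝ≥0∞} {m : Rn n → ℂ}
    (h : IsMultiplierBound p R D m) {g : 𝓢(Rn n, ℂ)}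
    (hg : ∀ ξ, R < ‖ξ‖ → 𝓕 (g : Rn n → ℂ) ξ = 0) {m' : Rn n → ℂ}
    (hm : ∀ᵐ ξ, 𝓕 (g : Rn n → ℂ) ξ ≠ 0 → m' ξ = m ξ) :
    eLpNorm (𝓕⁻ fun ξ => m' ξ * 𝓕 (g : Rn n → ℂ) ξ) p volume ≤ D * eLpNorm g p volume := by
  rw [fourierInv_congr_ae (g := fun ξ => m ξ * 𝓕 (g : Rn n → ℂ) ξ)]
  · exact h g hg
  · filter_upwards [hm] with ξ hξ
    by_cases h0 : 𝓕 (g : Rn n → ℂ) ξ = 0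
    · rw [h0, mul_zero, mul_zero]
    · rw [hξ h0]

lemma isTestOn_contDiffBump (f : ContDiffBump (0 : Rn n)) :
    IsTestOn Set.univ (fun ξ => ((f ξ : ℝ) : ℂ)) :=
  ⟨Complex.ofRealCLM.contDiff.comp f.contDiff,
    f.hasCompactSupport.comp_left (g := fun x : ℝ => (x : ℂ)) (by simp), Set.subset_univ _⟩

lemma exists_ball_cutoff (n : ℕ) : ∃ a : Rn n → ℂ, IsTestOn Set.univ a ∧
    (∀ ξ, 4 < ‖ξ‖ → a ξ = 0) ∧ ∀ ξ, ‖ξ‖ ≤ 2 → a ξ = 1 := by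
  refine ⟨_, isTestOn_contDiffBump ⟨2, 4, by norm_num, by norm_num⟩, fun ξ hξ => ?_, fun ξ hξ => ?_⟩
  · rw [ContDiffBump.zero_of_le_dist _ (by simpa using hξ.le), ofReal_zero]
  · rw [ContDiffBump.one_of_mem_closedBall _ (by simpa using hξ), ofReal_one]

lemma exists_annulus_cutoff (n : ℕ) : ∃ a : Rn n → ℂ, IsTestOn {0}ᶜ a ∧
    (∀ ξ, 4 < ‖ξ‖ → a ξ = 0) ∧ ∀ ξ, 1 / 2 ≤ ‖ξ‖ → ‖ξ‖ ≤ 2 → a ξ = 1 := by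
  obtain ⟨a, ha, ha0, ha1⟩ := exists_ball_cutoff n
  set f : ContDiffBump (0 : Rn n) := ⟨1 / 4, 1 / 2, by norm_num, by norm_num⟩ with hf
  have hb := isTestOn_contDiffBump f
  have hT : IsTestOn Set.univ (fun ξ => a ξ + -1 * ((f ξ : ℝ) : ℂ)) :=
    ha.add (hb.mul isOpen_univ contDiffOn_const)
  refine ⟨fun ξ => a ξ + -1 * ((f ξ : ℝ) : ℂ), ⟨hT.contDiff, hT.compact, ?_⟩, fun ξ hξ => ?_,
    fun ξ hξ hξ' => ?_⟩
  · rw [Set.subset_compl_singleton_iff, notMem_tsupport_iff_eventuallyEq]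
    filter_upwards [Metric.ball_mem_nhds (0 : Rn n) (by norm_num : (0 : ℝ) < 1 / 4)] with ξ hξ
    have hξ' : ‖ξ‖ < 1 / 4 := by simpa using hξ
    rw [ha1 ξ (by linarith), f.one_of_mem_closedBall (by simpa [hf] using hξ'.le)]
    simp
  · change a ξ + -1 * ((f ξ : ℝ) : ℂ) = 0
    rw [ha0 ξ hξ, f.zero_of_le_dist (by simp only [hf, dist_zero_right]; linarith)]
    simp
  · change a ξ + -1 * ((f ξ : ℝ) : ℂ) = 1
    rw [ha1 ξ hξ', f.zero_of_le_dist (by simpa [hf] using hξ)]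
    simp

lemma exists_isMultiplierBound_combination (hn : 2 ≤ n) (hp : p ≠ 0) {a : Rn n → ℂ}
    (ha : IsTestOn {0}ᶜ a) {R : ℝ} (hR : ∀ ξ, R < ‖ξ‖ → a ξ = 0) :
    ∃ D : ℝ≥0, ∀ (κ : ℝ) (z w : ℂ), ‖z‖ ≤ 1 → ‖w‖ ≤ 1 → IsMultiplierBound p R
      (D * ENNReal.ofReal ((1 + |κ|) ^ (((n : ℝ) - 1) * |p⁻¹.toReal - 1 / 2|)))
      (fun ξ => (z * cexp (I * ((κ * ‖ξ‖ : ℝ) : ℂ)) + w * cexp (-(I * ((κ * ‖ξ‖ : ℝ) : ℂ)))) *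
        a ξ) := by
  obtain ⟨D, hD⟩ := exists_isMultiplierBound_exp_norm hn hp ha hR
  have hφ : ContDiffOn ℝ (⊤ : ℕ∞) (norm : Rn n → ℝ) {0}ᶜ := fun ξ hξ =>
    (contDiffAt_norm ℝ hξ).contDiffWithinAt
  have hT : ∀ (κ : ℝ) (z : ℂ), IsTestOn Set.univ
      (fun ξ : Rn n => z * (cexp (I * ((κ * ‖ξ‖ : ℝ) : ℂ)) * a ξ)) := fun κ z => by
    have := (ha.comp_mul isOpen_compl_singleton hφ contDiff_cexp_I κ).mul isOpen_compl_singleton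
      (contDiffOn_const (c := z))
    exact ⟨this.contDiff, this.compact, Set.subset_univ _⟩
  refine ⟨p.LpAddConst.toNNReal * (D + D), fun κ z w hz hw => ?_⟩
  have h := ((hD κ).const_mul z).add ((hD (-κ)).const_mul w) (hT κ z) (hT (-κ) w)
  have e : (fun ξ : Rn n => z * (cexp (I * ((κ * ‖ξ‖ : ℝ) : ℂ)) * a ξ) +
      w * (cexp (I * ((-κ * ‖ξ‖ : ℝ) : ℂ)) * a ξ)) = fun ξ =>
      (z * cexp (I * ((κ * ‖ξ‖ : ℝ) : ℂ)) + w * cexp (-(I * ((κ * ‖ξ‖ : ℝ) : ℂ)))) * a ξ := by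
    ext ξ
    have : I * ((-κ * ‖ξ‖ : ℝ) : ℂ) = -(I * ((κ * ‖ξ‖ : ℝ) : ℂ)) := by push_cast; ring
    rw [this]
    ring
  rw [e] at h
  refine h.mono ?_
  rw [ENNReal.coe_mul, ENNReal.coe_toNNReal (ENNReal.LpAddConst_lt_top p).ne, mul_assoc, abs_neg,
    ENNReal.coe_add, add_mul]
  have hle : ∀ {z : ℂ}, ‖z‖ ≤ 1 → ∀ x : ℝ≥0∞, ‖z‖ₑ * x ≤ x := fun {z} hz x => by
    refine mul_le_of_le_one_left' ?_
    rw [← ofReal_norm]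
    exact ENNReal.ofReal_le_one.2 hz
  exact mul_le_mul_right (add_le_add (hle hz _) (hle hw _)) _

/-- The multiplier of `cos(t√-Δ)`, for the Fourier transform of Mathlib. -/
def waveCos (t : ℝ) (ζ : Rn n) : ℂ := ((Real.cos (t * (2 * Real.pi * ‖ζ‖)) : ℝ) : ℂ)

/-- The multiplier of `sin(t√-Δ)/√-Δ`, for the Fourier transform of Mathlib. -/
def waveSin (t : ℝ) (ζ : Rn n) : ℂ :=
  ((Real.sin (t * (2 * Real.pi * ‖ζ‖)) / (2 * Real.pi * ‖ζ‖) : ℝ) : ℂ)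

lemma exists_eLpNorm_wave_high_le (hn : 2 ≤ n) (hp : p ≠ 0) :
    ∃ D : ℝ≥0, ∀ L : ℝ, 0 < L → ∀ (t : ℝ) (g : 𝓢(Rn n, ℂ)),
      (∀ ζ, 𝓕 (g : Rn n → ℂ) ζ ≠ 0 → L / 2 ≤ 2 * Real.pi * ‖ζ‖ ∧ 2 * Real.pi * ‖ζ‖ ≤ 2 * L) →
      eLpNorm (𝓕⁻ fun ζ => waveCos t ζ * 𝓕 (g : Rn n → ℂ) ζ) p volume ≤
        D * ENNReal.ofReal ((1 + |t| * L) ^ (((n : ℝ) - 1) * |p⁻¹.toReal - 1 / 2|)) *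
          eLpNorm g p volume ∧
      eLpNorm (𝓕⁻ fun ζ => waveSin t ζ * 𝓕 (g : Rn n → ℂ) ζ) p volume ≤
        D * ENNReal.ofReal ((1 + |t| * L) ^ (((n : ℝ) - 1) * |p⁻¹.toReal - 1 / 2|)) *
          ENNReal.ofReal L⁻¹ * eLpNorm g p volume := by
  obtain ⟨a, ha, ha0, ha1⟩ := exists_annulus_cutoff n
  have hb : IsTestOn {0}ᶜ (fun ξ : Rn n => ((‖ξ‖⁻¹ : ℝ) : ℂ) * a ξ) := by
    refine ha.mul isOpen_compl_singleton (Complex.ofRealCLM.contDiff.comp_contDiffOn ?_)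
    exact fun ξ hξ => ((contDiffAt_norm ℝ hξ).inv (norm_ne_zero_iff.2 hξ)).contDiffWithinAt
  obtain ⟨D₀, hD₀⟩ := exists_isMultiplierBound_combination hn hp ha ha0
  obtain ⟨D₁, hD₁⟩ := exists_isMultiplierBound_combination hn hp hb
    (fun ξ hξ => by rw [ha0 ξ hξ, mul_zero])
  refine ⟨max D₀ D₁, fun L hL t g hg => ?_⟩
  have hpi := Real.pi_pos
  have hr : 0 < L / (2 * Real.pi) := by positivity
  have hκ : |t * L| = |t| * L := by rw [abs_mul, abs_of_pos hL]
  have hsupp : ∀ ξ, L / (2 * Real.pi) * 4 < ‖ξ‖ → 𝓕 (g : Rn n → ℂ) ξ = 0 := fun ξ hξ => by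
    by_contra h
    have := (hg ξ h).2
    rw [div_mul_eq_mul_div, div_lt_iff₀ (by positivity)] at hξ
    linarith
  have hnorm : ∀ ζ : Rn n, ‖(L / (2 * Real.pi))⁻¹ • ζ‖ = 2 * Real.pi * ‖ζ‖ / L := fun ζ => by
    rw [norm_smul, norm_inv, Real.norm_of_nonneg hr.le, inv_div]
    ring
  have hcut : ∀ ζ, 𝓕 (g : Rn n → ℂ) ζ ≠ 0 → a ((L / (2 * Real.pi))⁻¹ • ζ) = 1 ∧ ζ ≠ 0 :=
    fun ζ hζ => by
      obtain ⟨h1, h2⟩ := hg ζ hζ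
      refine ⟨ha1 _ ?_ ?_, ?_⟩
      · rw [hnorm, le_div_iff₀ hL]; linarith
      · rw [hnorm, div_le_iff₀ hL]; exact h2
      · rintro rfl
        rw [norm_zero, mul_zero] at h1
        linarith
  constructor
  · refine (((hD₀ (t * L) (1 / 2) (1 / 2) (by norm_num) (by norm_num)).comp_smul hr).eLpNorm_le
      hsupp (m' := waveCos t) (.of_forall fun ζ hζ => ?_)).trans ?_
    · rw [(hcut ζ hζ).1, mul_one, hnorm]
      · rw [show t * L * (2 * Real.pi * ‖ζ‖ / L) = t * (2 * Real.pi * ‖ζ‖) by field_simp,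
          waveCos, ofReal_cos, Complex.cos]
        ring_nf
    · rw [hκ]
      gcongr
      exact le_max_left _ _
  · refine ((((hD₁ (t * L) (1 / (2 * I)) (-(1 / (2 * I))) (by norm_num)
      (by norm_num)).const_mul ((L⁻¹ : ℝ) : ℂ)).comp_smul hr).eLpNorm_le hsupp (m' := waveSin t)
      (.of_forall fun ζ hζ => ?_)).trans ?_
    rotate_left
    · rw [hκ, ← ofReal_norm, norm_real, Real.norm_of_nonneg (by positivity), mul_comm (ENNReal.ofReal L⁻¹)]
      gcongr
      exact le_max_right _ _
    · rw [(hcut ζ hζ).1, mul_one, hnorm]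
      · have hz : ‖ζ‖ ≠ 0 := norm_ne_zero_iff.2 (hcut ζ hζ).2
        have hz' : (‖ζ‖ : ℂ) ≠ 0 := by exact_mod_cast hz
        have hL' : (L : ℂ) ≠ 0 := by exact_mod_cast hL.ne'
        have hpi' : (Real.pi : ℂ) ≠ 0 := by exact_mod_cast hpi.ne'
        rw [show t * L * (2 * Real.pi * ‖ζ‖ / L) = t * (2 * Real.pi * ‖ζ‖) by field_simp,
          waveSin, ofReal_div, ofReal_sin, Complex.sin]
        set E := ((t * (2 * Real.pi * ‖ζ‖) : ℝ) : ℂ) with hE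
        have e1 : -E * I = -(I * E) := by ring
        have e2 : E * I = I * E := by ring
        rw [e1, e2]
        push_cast
        field_simp
        linear_combination (cexp (-(I * E)) - cexp (I * E)) * I_sq

lemma exists_eLpNorm_wave_low_le (hn : 2 ≤ n) (hp : p ≠ 0) (τ : ℝ) :
    ∃ D : ℝ≥0, ∀ t : ℝ, |t| ≤ τ → ∀ g : 𝓢(Rn n, ℂ),
      (∀ ζ, 𝓕 (g : Rn n → ℂ) ζ ≠ 0 → 2 * Real.pi * ‖ζ‖ ≤ 2) →
      eLpNorm (𝓕⁻ fun ζ => waveCos t ζ * 𝓕 (g : Rn n → ℂ) ζ) p volume ≤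
        D * eLpNorm g p volume ∧
      eLpNorm (𝓕⁻ fun ζ => waveSin t ζ * 𝓕 (g : Rn n → ℂ) ζ) p volume ≤
        D * eLpNorm g p volume := by
  obtain ⟨a, ha, ha0, ha1⟩ := exists_ball_cutoff n
  obtain ⟨c₀, hc₀, hc₀'⟩ := exists_contDiff_cos_sqrt
  obtain ⟨c₁, hc₁, hc₁'⟩ := exists_contDiff_sinc_sqrt
  obtain ⟨D₀, hD₀⟩ := exists_isMultiplierBound_comp_norm_sq hn hp
    (Complex.ofRealCLM.contDiff.comp hc₀) ha ha0 (sq_nonneg τ)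
  obtain ⟨D₁, hD₁⟩ := exists_isMultiplierBound_comp_norm_sq hn hp
    (Complex.ofRealCLM.contDiff.comp hc₁) ha ha0 (sq_nonneg τ)
  refine ⟨max D₀ (τ.toNNReal * D₁), fun t ht g hg => ?_⟩
  have hpi := Real.pi_pos
  have hr : 0 < 1 / (2 * Real.pi) := by positivity
  have ht2 : |t ^ 2| ≤ τ ^ 2 := by
    rw [abs_pow]
    gcongr
  have hsupp : ∀ ξ, 1 / (2 * Real.pi) * 4 < ‖ξ‖ → 𝓕 (g : Rn n → ℂ) ξ = 0 := fun ξ hξ => by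
    by_contra h
    have := hg ξ h
    rw [div_mul_eq_mul_div, div_lt_iff₀ (by positivity)] at hξ
    linarith
  have hnorm : ∀ ζ : Rn n, ‖(1 / (2 * Real.pi))⁻¹ • ζ‖ = 2 * Real.pi * ‖ζ‖ := fun ζ => by
    rw [norm_smul, norm_inv, Real.norm_of_nonneg hr.le, inv_div, div_one]
  have hcut : ∀ ζ, 𝓕 (g : Rn n → ℂ) ζ ≠ 0 → a ((1 / (2 * Real.pi))⁻¹ • ζ) = 1 := fun ζ hζ =>
    ha1 _ ((hnorm ζ).trans_le (hg ζ hζ))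
  constructor
  · refine (((hD₀ (t ^ 2) ht2).comp_smul hr).eLpNorm_le hsupp (m' := waveCos t)
      (.of_forall fun ζ hζ => ?_)).trans ?_
    rotate_left
    · gcongr
      exact le_max_left _ _
    · rw [hcut ζ hζ, mul_one, hnorm, ← mul_pow]
      · simp only [Function.comp_apply, hc₀', waveCos, ofRealCLM_apply]
  · refine ((((hD₁ (t ^ 2) ht2).const_mul (t : ℂ)).comp_smul hr).eLpNorm_le hsupp
      (m' := waveSin t) ?_).trans ?_
    rotate_left
    · gcongr
      rw [← ofReal_norm, norm_real, Real.norm_eq_abs]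
      refine (mul_le_mul_left (ENNReal.ofReal_le_ofReal ht) _).trans ?_
      rw [ENNReal.ofReal, ← ENNReal.coe_mul]
      exact_mod_cast le_max_right _ _
    · have : Nonempty (Fin n) := ⟨⟨0, by omega⟩⟩
      have hae : ∀ᵐ ζ : Rn n, ζ ≠ 0 := by
        rw [ae_iff]
        simp
      filter_upwards [hae] with ζ hζ0 hζ
      rw [hcut ζ hζ, mul_one, hnorm, ← mul_pow]
      · rcases eq_or_ne t 0 with rfl | ht0
        · simp [waveSin]
        · have hz : ‖ζ‖ ≠ 0 := norm_ne_zero_iff.2 hζ0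
          have hne : t * (2 * Real.pi * ‖ζ‖) ≠ 0 := by positivity
          simp only [Function.comp_apply, hc₁' _ hne, waveSin, ofRealCLM_apply]
          rw [← ofReal_mul]
          congr 1
          field_simp

end WaveMultipliers

section WaveInterface

variable {n : ℕ}

lemma ftransform_eq (f : Rn n → ℂ) (ξ : Rn n) :
    ftransform n f ξ = 𝓕 f ((2 * Real.pi)⁻¹ • ξ) := by
  rw [Real.fourier_eq', ftransform]
  refine integral_congr_ae (.of_forall fun x => ?_)
  simp only [real_inner_smul_right, smul_eq_mul]
  congr 2
  have hpi : (Real.pi : ℂ) ≠ 0 := by exact_mod_cast Real.pi_ne_zero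
  push_cast
  field_simp

lemma integral_exp_inner_mul (G : Rn n → ℂ) (x : Rn n) :
    ((((2 * Real.pi) ^ n)⁻¹ : ℝ) : ℂ) *
      ∫ ξ : Rn n, cexp (I * ((⟪x, ξ⟫_ℝ : ℝ) : ℂ)) * G ξ =
    𝓕⁻ (fun ζ => G ((2 * Real.pi) • ζ)) x := by
  have h := Measure.integral_comp_smul (volume : Measure (Rn n))
    (fun ξ => cexp (I * ((⟪x, ξ⟫_ℝ : ℝ) : ℂ)) * G ξ) (2 * Real.pi)
  have hpi := Real.pi_pos
  rw [finrank_euclideanSpace_fin, abs_of_pos (by positivity), real_smul] at h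
  rw [← h, Real.fourierInv_eq']
  refine integral_congr_ae (.of_forall fun ζ => ?_)
  simp only [real_inner_smul_right, smul_eq_mul, real_inner_comm x ζ]
  rw [mul_comm I]

lemma invFT_eq (h : Rn n → ℝ) :
    invFT n h = 𝓕⁻ (fun ζ => (h ((2 * Real.pi) • ζ) : ℂ)) := by
  ext x
  exact integral_exp_inner_mul (fun ξ => (h ξ : ℂ)) x

lemma smoothOp_eq (h : Rn n → ℝ) (g : Rn n → ℂ) :
    smoothOp n h g = kernelConv (𝓕⁻ (fun ζ => (h ((2 * Real.pi) • ζ) : ℂ))) g := by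
  rw [← invFT_eq]
  rfl

lemma continuous_fourier_schwartz (f : 𝓢(Rn n, ℂ)) : Continuous (𝓕 (f : Rn n → ℂ)) := by
  have := (𝓕 f).continuous
  rwa [SchwartzMap.fourier_coe] at this

lemma integrable_inv_norm_mul_fourier (hn : 2 ≤ n) (f : 𝓢(Rn n, ℂ)) :
    Integrable (fun ζ : Rn n => ((‖ζ‖⁻¹ : ℝ) : ℂ) * 𝓕 (f : Rn n → ℂ) ζ) := by
  have : Nonempty (Fin n) := ⟨⟨0, by omega⟩⟩
  have hrad : Integrable (fun ζ : Rn n => ‖ζ‖⁻¹ * ((1 + ‖ζ‖) ^ (n + 1))⁻¹) := by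
    refine (integrable_fun_norm_addHaar (volume : Measure (Rn n))
      (f := fun y : ℝ => y⁻¹ * ((1 + y) ^ (n + 1))⁻¹)).2 ?_
    rw [finrank_euclideanSpace_fin]
    have h3 : IntegrableOn (fun y : ℝ => (1 + ‖y‖) ^ (-(3 : ℝ))) (Set.Ioi 0) :=
      (integrable_one_add_norm (by simp)).integrableOn
    refine h3.mono' (by fun_prop) ?_
    refine (ae_restrict_iff' measurableSet_Ioi).2 (.of_forall fun y hy => ?_)
    have hy : 0 < y := hy
    obtain ⟨m, rfl⟩ := Nat.exists_eq_add_of_le hn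
    rw [Real.norm_of_nonneg (by positivity), smul_eq_mul, Real.norm_of_nonneg hy.le,
      Real.rpow_neg (by positivity), show (3 : ℝ) = ((3 : ℕ) : ℝ) by norm_num, Real.rpow_natCast,
      show 2 + m - 1 = m + 1 by omega, show 2 + m + 1 = m + 3 by omega, pow_succ, pow_add, mul_inv]
    have : y ^ m * ((1 + y) ^ m)⁻¹ ≤ 1 := by
      rw [← div_eq_mul_inv, div_le_one (by positivity)]
      gcongr
      linarith
    calc y ^ m * y * (y⁻¹ * (((1 + y) ^ m)⁻¹ * ((1 + y) ^ 3)⁻¹))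
        = (y ^ m * ((1 + y) ^ m)⁻¹) * ((1 + y) ^ 3)⁻¹ := by field_simp
      _ ≤ 1 * ((1 + y) ^ 3)⁻¹ := by gcongr
      _ = _ := one_mul _
  obtain ⟨C, hC⟩ : ∃ C : ℝ, ∀ ζ, (1 + ‖ζ‖) ^ (n + 1) * ‖𝓕 (f : Rn n → ℂ) ζ‖ ≤ C := by
    have h := fun ζ => SchwartzMap.one_add_le_sup_seminorm_apply (𝕜 := ℝ) (m := (n + 1, 0))
      (k := n + 1) (n := 0) le_rfl le_rfl (𝓕 f) ζ
    simp only [norm_iteratedFDeriv_zero, SchwartzMap.fourier_coe] at h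
    exact ⟨_, h⟩
  refine (hrad.const_mul C).mono' ?_ (.of_forall fun ζ => ?_)
  · exact (by fun_prop : Measurable fun ζ : Rn n => ((‖ζ‖⁻¹ : ℝ) : ℂ)).aestronglyMeasurable.mul
      (continuous_fourier_schwartz f).aestronglyMeasurable
  · rw [norm_mul, norm_real, norm_inv, norm_norm]
    have : ‖𝓕 (f : Rn n → ℂ) ζ‖ ≤ C * ((1 + ‖ζ‖) ^ (n + 1))⁻¹ := by
      rw [← div_eq_mul_inv, le_div_iff₀ (by positivity), mul_comm]
      exact hC ζ
    calc _ ≤ ‖ζ‖⁻¹ * (C * ((1 + ‖ζ‖) ^ (n + 1))⁻¹) := by gcongr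
      _ = _ := by ring

lemma integrable_fourier_schwartz (f : 𝓢(Rn n, ℂ)) : Integrable (𝓕 (f : Rn n → ℂ)) := by
  have := (𝓕 f).integrable (μ := volume)
  rwa [SchwartzMap.fourier_coe] at this

lemma integrable_waveCos_mul (f : 𝓢(Rn n, ℂ)) (t : ℝ) :
    Integrable (fun ζ => waveCos t ζ * 𝓕 (f : Rn n → ℂ) ζ) := by
  refine (integrable_fourier_schwartz f).bdd_mul (c := 1) ?_ (.of_forall fun ζ => ?_)
  · exact (by unfold waveCos; fun_prop : Continuous (waveCos (n := n) t)).aestronglyMeasurable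
  · rw [waveCos, norm_real]
    exact Real.abs_cos_le_one _

lemma integrable_waveSin_mul (hn : 2 ≤ n) (f : 𝓢(Rn n, ℂ)) (t : ℝ) :
    Integrable (fun ζ => waveSin t ζ * 𝓕 (f : Rn n → ℂ) ζ) := by
  have h := (integrable_inv_norm_mul_fourier hn f).bdd_mul (c := 1)
    (f := fun ζ => ((Real.sin (t * (2 * Real.pi * ‖ζ‖)) * (2 * Real.pi)⁻¹ : ℝ) : ℂ))
    (by fun_prop) (.of_forall fun ζ => ?_)
  · refine h.congr (.of_forall fun ζ => ?_)
    simp only [waveSin]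
    rw [← mul_assoc, ← ofReal_mul]
    congr 2
    rw [div_eq_mul_inv, mul_inv]
    ring
  · rw [norm_real, norm_mul, norm_inv, Real.norm_eq_abs, Real.norm_of_nonneg (by positivity)]
    have h1 := Real.abs_sin_le_one (t * (2 * Real.pi * ‖ζ‖))
    have h2 : (2 * Real.pi)⁻¹ ≤ 1 := inv_le_one_of_one_le₀ (by linarith [Real.pi_gt_three])
    exact mul_le_one₀ h1 (by positivity) h2

lemma waveSol_eq (hn : 2 ≤ n) (f0 f1 : 𝓢(Rn n, ℂ)) (t : ℝ) :
    waveSol n f0 f1 t = 𝓕⁻ (fun ζ => waveCos t ζ * 𝓕 (f0 : Rn n → ℂ) ζ +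
      waveSin t ζ * 𝓕 (f1 : Rn n → ℂ) ζ) := by
  have hpi : (Real.pi : ℂ) ≠ 0 := by exact_mod_cast Real.pi_ne_zero
  have key : ∀ (G : Rn n → ℂ) (ε : ℝ) (x : Rn n),
      ((((2 * Real.pi) ^ n)⁻¹ : ℝ) : ℂ) *
        ∫ ξ : Rn n, cexp (I * (((⟪x, ξ⟫_ℝ + ε * ‖ξ‖ : ℝ)) : ℂ)) * G ξ =
      𝓕⁻ (fun ζ => cexp (I * ((ε * (2 * Real.pi * ‖ζ‖) : ℝ) : ℂ)) * G ((2 * Real.pi) • ζ)) x := by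
    intro G ε x
    have h := integral_exp_inner_mul (fun ξ => cexp (I * ((ε * ‖ξ‖ : ℝ) : ℂ)) * G ξ) x
    simp only [← mul_assoc, ← Complex.exp_add, ← mul_add, ← ofReal_add] at h
    rw [h]
    refine congrArg (fun g : Rn n → ℂ => 𝓕⁻ g x) (funext fun ζ => ?_)
    rw [norm_smul, Real.norm_of_nonneg (by positivity : 0 ≤ 2 * Real.pi)]
  have hF : ∀ (f : Rn n → ℂ) (ζ : Rn n), ftransform n f ((2 * Real.pi) • ζ) = 𝓕 f ζ := by
    intro f ζ
    rw [ftransform_eq, smul_smul, inv_mul_cancel₀ (by positivity), one_smul]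
  have hnorm : ∀ ζ : Rn n, ‖(2 * Real.pi) • ζ‖ = 2 * Real.pi * ‖ζ‖ := fun ζ => by
    rw [norm_smul, Real.norm_of_nonneg (by positivity)]
  have hInt : ∀ ε σ : ℝ, Integrable fun ζ : Rn n =>
      cexp (I * ((ε * (2 * Real.pi * ‖ζ‖) : ℝ) : ℂ)) *
        (𝓕 (f0 : Rn n → ℂ) ζ / 2 +
          σ * (𝓕 (f1 : Rn n → ℂ) ζ / (2 * I * ((2 * Real.pi * ‖ζ‖ : ℝ) : ℂ)))) := by
    intro ε σ
    refine Integrable.bdd_mul (c := 1) (((integrable_fourier_schwartz f0).div_const 2).add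
      (Integrable.const_mul ?_ _)) (by fun_prop) (.of_forall fun ζ => ?_)
    · refine ((integrable_inv_norm_mul_fourier hn f1).const_mul (4 * Real.pi * I)⁻¹).congr
        (.of_forall fun ζ => ?_)
      simp only
      push_cast
      rw [div_eq_mul_inv, mul_inv, mul_inv, mul_inv, mul_inv, mul_inv]
      rw [show (4 : ℂ) = 2 * 2 by norm_num, mul_inv]
      ring
    · rw [mul_comm, norm_exp_ofReal_mul_I]
  ext x
  have h1 := key (fun ξ => ftransform n f0 ξ / 2 +
    ftransform n f1 ξ / (2 * Complex.I * (‖ξ‖ : ℂ))) t x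
  have h2 := key (fun ξ => ftransform n f0 ξ / 2 -
    ftransform n f1 ξ / (2 * Complex.I * (‖ξ‖ : ℂ))) (-t) x
  simp only [neg_mul, ← sub_eq_add_neg] at h2
  rw [waveSol, h1, h2]
  simp only [hF, hnorm]
  have i1 := hInt t 1
  have i2 := hInt (-t) (-1)
  simp only [ofReal_neg, ofReal_one, one_mul, neg_mul, ← sub_eq_add_neg] at i1 i2
  have hadd := congrFun (fourierInv_add_apply i1 i2) x
  simp only [ofReal_neg]
  refine hadd.symm.trans ?_
  refine congrArg (fun g : Rn n → ℂ => 𝓕⁻ g x) (funext fun ζ => ?_)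
  rw [waveCos, waveSin]
  set E := ((t * (2 * Real.pi * ‖ζ‖) : ℝ) : ℂ) with hE
  rw [ofReal_div, ofReal_cos, ofReal_sin, ← hE, Complex.cos, Complex.sin,
    show -E * I = I * -E by ring, show E * I = I * E by ring]
  simp only [div_eq_mul_inv, mul_inv, inv_I]
  ring

lemma IsTestOn.kernelConv_fourierInv_fourierInv {U : Set (Rn n)} {H : Rn n → ℂ}
    (hH : IsTestOn U H) {u : Rn n → ℂ} (hu : Integrable u) :
    kernelConv (𝓕⁻ H) (𝓕⁻ u) = 𝓕⁻ (fun ζ => H ζ * u ζ) := by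
  set K := 𝓕⁻ (hH.compact.toSchwartzMap hH.contDiff) with hK
  have hcoe : (K : Rn n → ℂ) = 𝓕⁻ H := by
    rw [hK, SchwartzMap.fourierInv_coe]; rfl
  have hF : ∀ ξ, 𝓕 (K : Rn n → ℂ) ξ = H ξ := fun ξ => by
    rw [← SchwartzMap.fourier_coe, hK, FourierTransform.fourier_fourierInv_eq]; rfl
  rw [← hcoe]
  ext x
  have hKx : Integrable (fun y => K (y + x)) := K.integrable.comp_add_right x
  have h := VectorFourier.integral_fourierIntegral_smul_eq_flip (L := innerₗ (Rn n))
    (μ := volume) (ν := volume) Real.continuous_fourierChar continuous_inner hKx hu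
  have hflip : (innerₗ (Rn n)).flip = innerₗ (Rn n) := by
    ext a b
    simp
  rw [hflip] at h
  have hshift := VectorFourier.fourierIntegral_comp_add_right Real.fourierChar volume
    (innerₗ (Rn n)) (K : Rn n → ℂ) x
  have hshift' : VectorFourier.fourierIntegral Real.fourierChar volume (innerₗ (Rn n))
      (fun y => K (y + x)) = fun w => Real.fourierChar (innerₗ (Rn n) x w) •
        𝓕 (K : Rn n → ℂ) w := hshift
  rw [hshift'] at h
  rw [kernelConv, ← integral_neg_eq_self, Real.fourierInv_eq]
  refine Eq.trans ?_ (h.symm.trans ?_)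
  · refine integral_congr_ae (.of_forall fun y => ?_)
    simp only [sub_neg_eq_add, smul_eq_mul, Real.fourierInv_eq_fourier_neg, neg_neg, add_comm x]
    rfl
  · refine integral_congr_ae (.of_forall fun ζ => ?_)
    simp only [hF, innerₗ_apply_apply, Circle.smul_def, smul_eq_mul, real_inner_comm x ζ, mul_assoc]

end WaveInterface

section LittlewoodPaley

variable {n : ℕ} {p : ℝ≥0∞} {ψ0 : Rn n → ℝ}

lemma IsLPBase.contDiff_lpPiece (h : IsLPBase n ψ0) (j : ℕ) :
    ContDiff ℝ (⊤ : ℕ∞) (lpPiece n ψ0 j) := by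
  have h0 := h.1
  unfold lpPiece
  split_ifs
  · exact h0
  · exact (h0.comp (contDiff_const_smul _)).sub (h0.comp (contDiff_const_smul _))

lemma IsLPBase.lpPiece_eq_zero_of_lt (h : IsLPBase n ψ0) (j : ℕ) {ξ : Rn n}
    (hξ : 2 * (2 : ℝ) ^ j < ‖ξ‖) : lpPiece n ψ0 j ξ = 0 := by
  unfold lpPiece
  split_ifs with hj
  · subst hj
    exact h.2.2 ξ (by simpa using hξ)
  · have h2 : (0 : ℝ) < 2 ^ j := by positivity
    have hlt : 2 < ((2 : ℝ) ^ j)⁻¹ * ‖ξ‖ := by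
      rw [inv_mul_eq_div, lt_div_iff₀ h2]
      exact hξ
    rw [h.2.2, h.2.2, sub_zero]
    · rw [norm_smul, Real.norm_of_nonneg (by positivity), zpow_add₀ two_ne_zero, zpow_neg,
        zpow_natCast, zpow_one]
      linarith
    · rw [norm_smul, Real.norm_of_nonneg (by positivity), zpow_neg, zpow_natCast]
      exact hlt

lemma IsLPBase.lpPiece_eq_zero_of_gt (h : IsLPBase n ψ0) {j : ℕ} (hj : j ≠ 0) {ξ : Rn n}
    (hξ : ‖ξ‖ < (2 : ℝ) ^ j / 2) : lpPiece n ψ0 j ξ = 0 := by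
  have h2 : (0 : ℝ) < 2 ^ j := by positivity
  have hlt : ((2 : ℝ) ^ j)⁻¹ * ‖ξ‖ ≤ 1 / 2 := by
    rw [inv_mul_eq_div, div_le_iff₀ h2]
    linarith
  rw [lpPiece, if_neg hj, h.2.1, h.2.1, sub_self]
  · rw [norm_smul, Real.norm_of_nonneg (by positivity), zpow_add₀ two_ne_zero, zpow_neg,
      zpow_natCast, zpow_one]
    linarith
  · rw [norm_smul, Real.norm_of_nonneg (by positivity), zpow_neg, zpow_natCast]
    linarith

lemma IsLPBase.isTestOn_lpPiece (h : IsLPBase n ψ0) (j : ℕ) :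
    IsTestOn Set.univ (fun ζ : Rn n => (lpPiece n ψ0 j ((2 * Real.pi) • ζ) : ℂ)) := by
  have hpi := Real.pi_pos
  refine ⟨Complex.ofRealCLM.contDiff.comp
    ((h.contDiff_lpPiece j).comp (contDiff_const_smul _)), ?_, Set.subset_univ _⟩
  refine HasCompactSupport.intro (isCompact_closedBall (0 : Rn n) (2 * 2 ^ j)) fun ζ hζ => ?_
  rw [mem_closedBall_zero_iff, not_le] at hζ
  rw [h.lpPiece_eq_zero_of_lt j, ofReal_zero]
  rw [norm_smul, Real.norm_of_nonneg (by positivity)]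
  nlinarith [norm_nonneg ζ, Real.pi_gt_three]

lemma IsLPBase.exists_schwartz_smoothOp (h : IsLPBase n ψ0) (j : ℕ) (f : 𝓢(Rn n, ℂ)) :
    ∃ g : 𝓢(Rn n, ℂ), (g : Rn n → ℂ) = smoothOp n (lpPiece n ψ0 j) f ∧
      ∀ ζ, 𝓕 (g : Rn n → ℂ) ζ =
        (lpPiece n ψ0 j ((2 * Real.pi) • ζ) : ℂ) * 𝓕 (f : Rn n → ℂ) ζ := by
  have hH := h.isTestOn_lpPiece j
  set K := 𝓕⁻ (hH.compact.toSchwartzMap hH.contDiff) with hK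
  have hcoe : (K : Rn n → ℂ) =
      𝓕⁻ (fun ζ : Rn n => (lpPiece n ψ0 j ((2 * Real.pi) • ζ) : ℂ)) := by
    rw [hK, SchwartzMap.fourierInv_coe]; rfl
  refine ⟨SchwartzMap.convolution (ContinuousLinearMap.mul ℂ ℂ) f K, ?_, fun ζ => ?_⟩
  · rw [← kernelConv_schwartz_eq, smoothOp_eq, hcoe]
  · rw [← kernelConv_schwartz_eq, fourier_kernelConv_schwartz, ← SchwartzMap.fourier_coe, hK,
      FourierTransform.fourier_fourierInv_eq]
    rfl

lemma IsLPBase.smoothOp_waveSol (hn : 2 ≤ n) (h : IsLPBase n ψ0) (j : ℕ) (f0 f1 : 𝓢(Rn n, ℂ))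
    (t : ℝ) {g0 g1 : 𝓢(Rn n, ℂ)}
    (hg0 : ∀ ζ, 𝓕 (g0 : Rn n → ℂ) ζ =
      (lpPiece n ψ0 j ((2 * Real.pi) • ζ) : ℂ) * 𝓕 (f0 : Rn n → ℂ) ζ)
    (hg1 : ∀ ζ, 𝓕 (g1 : Rn n → ℂ) ζ =
      (lpPiece n ψ0 j ((2 * Real.pi) • ζ) : ℂ) * 𝓕 (f1 : Rn n → ℂ) ζ) :
    smoothOp n (lpPiece n ψ0 j) (waveSol n f0 f1 t) =
      𝓕⁻ (fun ζ => waveCos t ζ * 𝓕 (g0 : Rn n → ℂ) ζ) +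
        𝓕⁻ (fun ζ => waveSin t ζ * 𝓕 (g1 : Rn n → ℂ) ζ) := by
  rw [smoothOp_eq, waveSol_eq hn, (h.isTestOn_lpPiece j).kernelConv_fourierInv_fourierInv
    (u := fun ζ => waveCos t ζ * 𝓕 (f0 : Rn n → ℂ) ζ + waveSin t ζ * 𝓕 (f1 : Rn n → ℂ) ζ)
    ((integrable_waveCos_mul f0 t).add (integrable_waveSin_mul hn f1 t)),
    ← fourierInv_add_apply (integrable_waveCos_mul g0 t) (integrable_waveSin_mul hn g1 t)]
  congr 1
  ext ζ
  rw [hg0, hg1]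
  ring

lemma IsLPBase.exists_eLpNorm_smoothOp_waveSol_le (hn : 2 ≤ n) (hp : p ≠ 0)
    (h : IsLPBase n ψ0) {ν : ℝ} (hν : ν = ((n : ℝ) - 1) * |p⁻¹.toReal - 1 / 2|)
    {τ : ℝ} (hτ : 0 ≤ τ) :
    ∃ C : ℝ≥0, ∀ (f0 f1 : 𝓢(Rn n, ℂ)) (t : ℝ), |t| ≤ τ → ∀ j : ℕ,
      eLpNorm (smoothOp n (lpPiece n ψ0 j) (waveSol n f0 f1 t)) p volume ≤
        C * (ENNReal.ofReal ((2 : ℝ) ^ ((j : ℝ) * ν)) *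
            eLpNorm (smoothOp n (lpPiece n ψ0 j) f0) p volume +
          ENNReal.ofReal ((2 : ℝ) ^ ((j : ℝ) * (ν - 1))) *
            eLpNorm (smoothOp n (lpPiece n ψ0 j) f1) p volume) := by
  obtain ⟨D₀, hD₀⟩ := exists_eLpNorm_wave_low_le hn hp τ
  obtain ⟨D₁, hD₁⟩ := exists_eLpNorm_wave_high_le hn hp
  have hν0 : 0 ≤ ν := by
    have : (2 : ℝ) ≤ n := by exact_mod_cast hn
    rw [hν]
    exact mul_nonneg (by linarith) (abs_nonneg _)
  set M : ℝ≥0 := max D₀ (D₁ * ((1 + τ) ^ ν).toNNReal) with hM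
  refine ⟨p.LpAddConst.toNNReal * M, fun f0 f1 t ht j => ?_⟩
  obtain ⟨g0, hg0, hg0'⟩ := h.exists_schwartz_smoothOp j f0
  obtain ⟨g1, hg1, hg1'⟩ := h.exists_schwartz_smoothOp j f1
  rw [h.smoothOp_waveSol hn j f0 f1 t hg0' hg1', ← hg0, ← hg1]
  have hsupp : ∀ (f g : 𝓢(Rn n, ℂ)), (∀ ζ, 𝓕 (g : Rn n → ℂ) ζ =
      (lpPiece n ψ0 j ((2 * Real.pi) • ζ) : ℂ) * 𝓕 (f : Rn n → ℂ) ζ) → ∀ ζ,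
      𝓕 (g : Rn n → ℂ) ζ ≠ 0 → 2 * Real.pi * ‖ζ‖ ≤ 2 * 2 ^ j ∧
        (j ≠ 0 → (2 : ℝ) ^ j / 2 ≤ 2 * Real.pi * ‖ζ‖) := by
    intro f g hg ζ hζ
    rw [hg] at hζ
    have hz : lpPiece n ψ0 j ((2 * Real.pi) • ζ) ≠ 0 := fun h0 => hζ (by rw [h0]; simp)
    have hnorm : ‖(2 * Real.pi) • ζ‖ = 2 * Real.pi * ‖ζ‖ := by
      rw [norm_smul, Real.norm_of_nonneg (by positivity)]
    rw [← hnorm]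
    exact ⟨not_lt.1 fun hlt => hz (h.lpPiece_eq_zero_of_lt j hlt),
      fun hj => not_lt.1 fun hlt => hz (h.lpPiece_eq_zero_of_gt hj hlt)⟩
  have hpow : ENNReal.ofReal ((2 : ℝ) ^ ((j : ℝ) * (ν - 1))) =
      ENNReal.ofReal ((2 : ℝ) ^ ((j : ℝ) * ν)) * ENNReal.ofReal ((2 : ℝ) ^ j)⁻¹ := by
    rw [← ENNReal.ofReal_mul (by positivity), mul_sub, mul_one, Real.rpow_sub two_pos,
      Real.rpow_natCast, div_eq_mul_inv]
  have hbound :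
      eLpNorm (𝓕⁻ fun ζ => waveCos t ζ * 𝓕 (g0 : Rn n → ℂ) ζ) p volume ≤
        M * (ENNReal.ofReal ((2 : ℝ) ^ ((j : ℝ) * ν)) * eLpNorm g0 p volume) ∧
      eLpNorm (𝓕⁻ fun ζ => waveSin t ζ * 𝓕 (g1 : Rn n → ℂ) ζ) p volume ≤
        M * (ENNReal.ofReal ((2 : ℝ) ^ ((j : ℝ) * (ν - 1))) * eLpNorm g1 p volume) := by
    rcases eq_or_ne j 0 with rfl | hj
    · have e0 := (hD₀ t ht g0 fun ζ hζ => by simpa using (hsupp f0 g0 hg0' ζ hζ).1).1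
      have e1 := (hD₀ t ht g1 fun ζ hζ => by simpa using (hsupp f1 g1 hg1' ζ hζ).1).2
      simp only [Nat.cast_zero, zero_mul, Real.rpow_zero, ENNReal.ofReal_one, one_mul]
      have hDM : (D₀ : ℝ≥0∞) ≤ M := by exact_mod_cast le_max_left _ _
      exact ⟨e0.trans (by gcongr), e1.trans (by gcongr)⟩
    · have hL : (0 : ℝ) < 2 ^ j := by positivity
      have hL1 : (1 : ℝ) ≤ 2 ^ j := one_le_pow₀ one_le_two
      have e0 := (hD₁ (2 ^ j) hL t g0 fun ζ hζ =>
        ⟨(hsupp f0 g0 hg0' ζ hζ).2 hj, (hsupp f0 g0 hg0' ζ hζ).1⟩).1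
      have e1 := (hD₁ (2 ^ j) hL t g1 fun ζ hζ =>
        ⟨(hsupp f1 g1 hg1' ζ hζ).2 hj, (hsupp f1 g1 hg1' ζ hζ).1⟩).2
      rw [← hν] at e0 e1
      have hDM : (D₁ : ℝ≥0∞) * ENNReal.ofReal ((1 + |t| * 2 ^ j) ^ ν) ≤
          M * ENNReal.ofReal ((2 : ℝ) ^ ((j : ℝ) * ν)) := by
        have hr : (1 + |t| * 2 ^ j) ^ ν ≤ (1 + τ) ^ ν * (2 : ℝ) ^ ((j : ℝ) * ν) := by
          rw [Real.rpow_mul two_pos.le, Real.rpow_natCast, ← Real.mul_rpow (by positivity) hL.le]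
          refine Real.rpow_le_rpow (by positivity) ?_ hν0
          nlinarith [abs_nonneg t]
        calc (D₁ : ℝ≥0∞) * ENNReal.ofReal ((1 + |t| * 2 ^ j) ^ ν)
            ≤ D₁ * ENNReal.ofReal ((1 + τ) ^ ν * (2 : ℝ) ^ ((j : ℝ) * ν)) := by gcongr
          _ = ((D₁ * ((1 + τ) ^ ν).toNNReal : ℝ≥0) : ℝ≥0∞) *
              ENNReal.ofReal ((2 : ℝ) ^ ((j : ℝ) * ν)) := by
            rw [ENNReal.ofReal_mul (by positivity), ENNReal.coe_mul, mul_assoc]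
            rfl
          _ ≤ _ := by
            gcongr
            exact le_max_right _ _
      refine ⟨e0.trans ?_, e1.trans ?_⟩
      · rw [← mul_assoc]
        gcongr
      · rw [hpow, ← mul_assoc, ← mul_assoc]
        gcongr
  refine (eLpNorm_add_le' (continuous_fourierInv (integrable_waveCos_mul g0 t)).aestronglyMeasurable
    (continuous_fourierInv (integrable_waveSin_mul hn g1 t)).aestronglyMeasurable p).trans ?_
  rw [ENNReal.coe_mul, ENNReal.coe_toNNReal (ENNReal.LpAddConst_lt_top p).ne, mul_assoc,
    mul_add (M : ℝ≥0∞)]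
  exact mul_le_mul_right (add_le_add hbound.1 hbound.2) _

end LittlewoodPaley

section SequenceNorm

variable {q : ℝ≥0∞} {u v : ℕ → ℝ≥0∞}

lemma lqSum_mono (h : ∀ j, u j ≤ v j) : lqSum q u ≤ lqSum q v := by
  unfold lqSum
  split_ifs
  · exact iSup_mono h
  · refine ENNReal.rpow_le_rpow (ENNReal.tsum_le_tsum fun j => ?_) (by positivity)
    exact ENNReal.rpow_le_rpow (h j) ENNReal.toReal_nonneg

lemma lqSum_const_mul (hq : q ≠ 0) (c : ℝ≥0∞) : lqSum q (fun j => c * u j) = c * lqSum q u := by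
  unfold lqSum
  split_ifs with h
  · rw [ENNReal.mul_iSup]
  · have hq' : 0 < q.toReal := ENNReal.toReal_pos hq h
    simp only [ENNReal.mul_rpow_of_nonneg _ _ hq'.le]
    rw [ENNReal.tsum_mul_left, ENNReal.mul_rpow_of_nonneg _ _ (by positivity), ← ENNReal.rpow_mul,
      mul_one_div_cancel hq'.ne', ENNReal.rpow_one]

lemma exists_lqSum_add_le (hq : q ≠ 0) :
    ∃ K : ℝ≥0, ∀ u v : ℕ → ℝ≥0∞, lqSum q (fun j => u j + v j) ≤ K * (lqSum q u + lqSum q v) := by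
  by_cases h : q = ∞
  · refine ⟨1, fun u v => ?_⟩
    simp only [lqSum, if_pos h, ENNReal.coe_one, one_mul]
    exact iSup_le fun j => add_le_add (le_iSup u j) (le_iSup v j)
  · have hq' : 0 < q.toReal := ENNReal.toReal_pos hq h
    have hmax : ∀ {r : ℝ} (_ : 0 ≤ r) (a b : ℝ≥0∞), (a + b) ^ r ≤ 2 ^ r * (a ^ r + b ^ r) := by
      intro r hr a b
      have hab : a + b ≤ 2 * max a b := by
        rw [two_mul]
        exact add_le_add (le_max_left _ _) (le_max_right _ _)
      refine (ENNReal.rpow_le_rpow hab hr).trans ?_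
      rw [ENNReal.mul_rpow_of_nonneg _ _ hr]
      gcongr
      rcases max_cases a b with ⟨e, -⟩ | ⟨e, -⟩ <;> rw [e]
      · exact le_self_add
      · exact le_add_self
    have hK : (2 : ℝ≥0∞) ^ (1 / q.toReal) ≠ ∞ :=
      ENNReal.rpow_ne_top_of_nonneg (by positivity) (by simp)
    refine ⟨2 * ((2 : ℝ≥0∞) ^ (1 / q.toReal)).toNNReal, fun u v => ?_⟩
    rw [ENNReal.coe_mul, ENNReal.coe_toNNReal hK, ENNReal.coe_ofNat, mul_assoc]
    simp only [lqSum, if_neg h]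
    calc (∑' j, (u j + v j) ^ q.toReal) ^ (1 / q.toReal)
        ≤ (∑' j, 2 ^ q.toReal * (u j ^ q.toReal + v j ^ q.toReal)) ^ (1 / q.toReal) := by
          refine ENNReal.rpow_le_rpow (ENNReal.tsum_le_tsum fun j => ?_) (by positivity)
          exact hmax hq'.le _ _
      _ = 2 * (∑' j, u j ^ q.toReal + ∑' j, v j ^ q.toReal) ^ (1 / q.toReal) := by
          rw [ENNReal.tsum_mul_left, ENNReal.mul_rpow_of_nonneg _ _ (by positivity),
            ← ENNReal.rpow_mul, mul_one_div_cancel hq'.ne', ENNReal.rpow_one, ENNReal.tsum_add]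
      _ ≤ _ := by
          gcongr
          exact hmax (by positivity) _ _

end SequenceNorm

end

/-- Global Besov–Lipschitz estimate for the solution of the wave equation:
for `n ≥ 2`, `n/(n+1) < p ≤ ∞`, `0 < q ≤ ∞`, `s ∈ ℝ` and `ν = (n-1)|1/p - 1/2|`,
`sup_{t ∈ [-τ,τ]} ‖u(t,·)‖_{B^s_{p,q}} ≤ C_τ (‖f0‖_{B^{s+ν}_{p,q}} + ‖f1‖_{B^{s+ν-1}_{p,q}})`. -/
theorem global_besov_estimate_wave_equation
    (n : ℕ) (hn : 2 ≤ n) (s : ℝ) (p q : ℝ≥0∞)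
    (hp : ENNReal.ofReal ((n : ℝ) / ((n : ℝ) + 1)) < p) (hq : 0 < q)
    (ψ0 : Rn n → ℝ) (hψ0 : IsLPBase n ψ0)
    (ν : ℝ) (hν : ν = ((n : ℝ) - 1) * |p⁻¹.toReal - 1 / 2|)
    (τ : ℝ) (hτ : 0 < τ) :
    ∃ C : ℝ≥0, ∀ f0 f1 : SchwartzMap (Rn n) ℂ, ∀ t ∈ Set.Icc (-τ) τ,
      besovNorm n ψ0 s p q (waveSol n ⇑f0 ⇑f1 t) ≤
        (C : ℝ≥0∞) *
          (besovNorm n ψ0 (s + ν) p q ⇑f0 + besovNorm n ψ0 (s + ν - 1) p q ⇑f1) := by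
  obtain ⟨C, hC⟩ := hψ0.exists_eLpNorm_smoothOp_waveSol_le hn (bot_le.trans_lt hp).ne' hν hτ.le
  obtain ⟨K, hK⟩ := exists_lqSum_add_le hq.ne'
  refine ⟨C * K, fun f0 f1 t ht => ?_⟩
  have hw : ∀ (j : ℕ) (a b : ℝ), ENNReal.ofReal ((2 : ℝ) ^ ((j : ℝ) * (a + b))) =
      ENNReal.ofReal ((2 : ℝ) ^ ((j : ℝ) * a)) * ENNReal.ofReal ((2 : ℝ) ^ ((j : ℝ) * b)) :=
    fun j a b => by
      rw [← ENNReal.ofReal_mul (by positivity), ← Real.rpow_add two_pos, mul_add]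
  rw [ENNReal.coe_mul, mul_assoc]
  refine (lqSum_mono fun j => ?_).trans
    ((lqSum_const_mul hq.ne' (C : ℝ≥0∞)).trans_le (mul_le_mul_right (hK _ _) _))
  refine (mul_le_mul_right (hC f0 f1 t (abs_le.2 ht) j) _).trans_eq ?_
  rw [add_sub_assoc, hw, hw]
  ring
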